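/- Let $K$ be a number field with ring of integers $\mathcal{O}_K$ and let $\xi \in \mathcal{O}_K$ be a nonzero non-unit. Then the lower density of algebraic integers representable as a prime element plus a power of $\xi$ is positive; that is, $\liminf_{x \to \infty} \; \#\{\zeta \in \mathcal{O}_K : \operatorname{house}(\zeta) \le x \text{ and } \exists\, \pi, k \text{ with } \pi \text{ a prime element of } \mathcal{O}_K,\ k \ge 1,\ \zeta = \pi + \xi^k\} \,/\, \#\{\zeta \in \mathcal{O}_K : \operatorname{house}(\zeta) \le x\} > 0$. -/

import Mathlib

namespace Romanov

open MeasureTheory Module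
open scoped ContDiff nonZeroDivisors

set_option linter.unusedSectionVars false

/-! ### Smooth sums over lattices -/

section LatticeSum

/-- If every function in a chain of successive derivatives is `1`-periodic, a bound for one of them
is a bound for the first derivative. -/
lemma abs_le_of_periodic_of_hasDerivAt (k : ℕ) :
    ∀ (P : ℕ → ℝ → ℝ), (∀ j s, HasDerivAt (P j) (P (j + 1) s) s) →
      (∀ j s, P j (s + 1) = P j s) → ∀ B : ℝ, (∀ s, |P (k + 1) s| ≤ B) → ∀ s, |P 1 s| ≤ B := by
  induction k with
  | zero => intro P _ _ B hB s; simpa using hB s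
  | succ k ih =>
    intro P hd hp B hB s
    have h2 : ∀ s, |P 2 s| ≤ B :=
      ih (fun j => P (j + 1)) (fun j s => hd (j + 1) s) (fun j s => hp (j + 1) s) B hB
    obtain ⟨c, hc, hc0⟩ := exists_hasDerivAt_eq_zero (f := P 0) (f' := P 1) (lt_add_one s)
      (fun x _ => (hd 0 x).continuousAt.continuousWithinAt) (hp 0 s).symm (fun x _ => hd 0 x)
    have := Convex.norm_image_sub_le_of_norm_hasDerivWithin_le (f := P 1) (f' := P 2)
      (s := Set.univ) (C := B) (fun x _ => (hd 1 x).hasDerivWithinAt) (fun x _ => h2 x)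
      convex_univ (Set.mem_univ c) (Set.mem_univ s)
    rw [hc0, sub_zero, Real.norm_eq_abs, Real.norm_eq_abs] at this
    have hB0 : 0 ≤ B := (abs_nonneg _).trans (h2 s)
    have h1 : |s - c| ≤ 1 := by rw [abs_le]; constructor <;> linarith [hc.1, hc.2]
    nlinarith

variable {E ι : Type*} [NormedAddCommGroup E] [NormedSpace ℝ E] [Fintype ι] (b : Basis ι ℝ E)

/-- The sum of the rescaled function `F (T⁻¹ • ·)` over a translate of the lattice spanned
by `b`. -/
noncomputable def latticeSum (F : E → ℝ) (T : ℝ) (v : E) : ℝ :=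
  ∑' l : Submodule.span ℤ (Set.range b), F (T⁻¹ • (v + l))

lemma latticeSum_add_mem (F : E → ℝ) (T : ℝ) (v : E) (m : Submodule.span ℤ (Set.range b)) :
    latticeSum b F T (v + m) = latticeSum b F T v := by
  unfold latticeSum
  rw [← (Equiv.addLeft m).tsum_eq (fun l : Submodule.span ℤ (Set.range b) => F (T⁻¹ • (v + l)))]
  simp [add_assoc]

lemma exists_finset_latticeSum {F : E → ℝ} (hF : HasCompactSupport F) {T : ℝ} (hT : 0 < T)
    {B : Set E} (hB : Bornology.IsBounded B) :
    ∃ s : Finset (Submodule.span ℤ (Set.range b)), ∀ v ∈ B, ∀ l ∉ s, F (T⁻¹ • (v + l)) = 0 := by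
  have := b.finiteDimensional_of_finite
  have : ProperSpace E := FiniteDimensional.proper ℝ E
  obtain ⟨R, hR⟩ := hF.isCompact.isBounded.subset_closedBall 0
  obtain ⟨R', hR'⟩ := hB.subset_closedBall 0
  have hfin := ZSpan.setFinite_inter b
    (Metric.isBounded_closedBall (x := (0 : E)) (r := T * R + R'))
  have hfin2 : Set.Finite {l : Submodule.span ℤ (Set.range b) |
      (l : E) ∈ Metric.closedBall (0 : E) (T * R + R')} := by
    refine Set.Finite.of_finite_image (f := Subtype.val) (hfin.subset ?_)
      Subtype.val_injective.injOn
    rintro _ ⟨l, hl, rfl⟩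
    exact ⟨hl, l.2⟩
  refine ⟨hfin2.toFinset, fun v hv l hl => ?_⟩
  by_contra hne
  apply hl
  have h1 : T⁻¹ • (v + (l : E)) ∈ Metric.closedBall (0 : E) R :=
    hR (subset_tsupport _ hne)
  have h2 := hR' hv
  simp only [Metric.mem_closedBall, dist_zero_right, norm_smul, norm_inv, Real.norm_eq_abs,
    abs_of_pos hT, Set.Finite.mem_toFinset, Set.mem_ofPred_eq] at h1 h2 ⊢
  have h3 : ‖v + (l : E)‖ ≤ T * R := by
    rwa [inv_mul_le_iff₀ hT] at h1
  calc ‖(l : E)‖ = ‖(v + l) - v‖ := by simp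
    _ ≤ ‖v + (l : E)‖ + ‖v‖ := norm_sub_le _ _
    _ ≤ _ := add_le_add h3 h2

lemma latticeSum_eq_sum {F : E → ℝ} {T : ℝ} {v : E} {s : Finset (Submodule.span ℤ (Set.range b))}
    (h : ∀ l ∉ s, F (T⁻¹ • (v + l)) = 0) :
    latticeSum b F T v = ∑ l ∈ s, F (T⁻¹ • (v + l)) :=
  tsum_eq_sum h

lemma hasDerivAt_latticeSum {F : E → ℝ} (hF : HasCompactSupport F) (hd : Differentiable ℝ F)
    {T : ℝ} (hT : 0 < T) (v e : E) (s : ℝ) :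
    HasDerivAt (fun s : ℝ => latticeSum b F T (v + s • e))
      (T⁻¹ * latticeSum b (fun y => fderiv ℝ F y e) T (v + s • e)) s := by
  have hbd : Bornology.IsBounded ((fun s : ℝ => v + s • e) '' Metric.closedBall s 1) :=
    ((isCompact_closedBall s 1).image (by fun_prop)).isBounded
  obtain ⟨t, ht⟩ := exists_finset_latticeSum b hF hT hbd
  obtain ⟨t', ht'⟩ := exists_finset_latticeSum b (hF.fderiv_apply ℝ e) hT hbd
  classical
  have h1 : ∀ x ∈ Metric.closedBall s 1, latticeSum b F T (v + x • e) =
      ∑ l ∈ t ∪ t', F (T⁻¹ • (v + x • e + l)) := fun x hx =>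
    latticeSum_eq_sum b fun l hl => ht _ ⟨x, hx, rfl⟩ l (fun h => hl (Finset.mem_union_left _ h))
  have h2 : latticeSum b (fun y => fderiv ℝ F y e) T (v + s • e) =
      ∑ l ∈ t ∪ t', fderiv ℝ F (T⁻¹ • (v + s • e + l)) e :=
    latticeSum_eq_sum b fun l hl => ht' _ ⟨s, by simp, rfl⟩ l
      (fun h => hl (Finset.mem_union_right _ h))
  rw [h2, Finset.mul_sum]
  have h3 : HasDerivAt (fun x : ℝ => ∑ l ∈ t ∪ t', F (T⁻¹ • (v + x • e + l)))
      (∑ l ∈ t ∪ t', T⁻¹ * fderiv ℝ F (T⁻¹ • (v + s • e + l)) e) s := by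
    refine HasDerivAt.fun_sum fun l _ => ?_
    have hg : HasDerivAt (fun x : ℝ => T⁻¹ • (v + x • e + (l : E))) (T⁻¹ • e) s := by
      have := (((hasDerivAt_id s).smul_const e).const_add v).add_const (l : E)
      rw [one_smul] at this
      exact this.const_smul T⁻¹
    have := (hd (T⁻¹ • (v + s • e + (l : E)))).hasFDerivAt.comp_hasDerivAt s hg
    rw [map_smul, smul_eq_mul] at this
    exact this
  refine h3.congr_of_eventuallyEq ?_
  filter_upwards [Metric.closedBall_mem_nhds s one_pos] with x hx using h1 x hx

lemma card_Icc_ceil_floor_le {a x T c : ℝ} (hc : 0 ≤ c) (hT : 1 ≤ T) (hx : x = c * T) :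
    ((Finset.Icc ⌈-x - a⌉ ⌊x - a⌋).card : ℝ) ≤ (2 * c + 1) * T := by
  rw [Int.card_Icc]
  have h1 := Int.floor_le (x - a)
  have h2 := Int.le_ceil (-x - a)
  have h0 : 0 ≤ c * T := by positivity
  rcases le_total 0 (⌊x - a⌋ + 1 - ⌈-x - a⌉) with h | h
  · have : (((⌊x - a⌋ + 1 - ⌈-x - a⌉).toNat : ℤ) : ℝ) = ((⌊x - a⌋ + 1 - ⌈-x - a⌉ : ℤ) : ℝ) := by
      rw [Int.toNat_of_nonneg h]
    rw [Int.cast_natCast] at this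
    rw [this]
    push_cast
    nlinarith
  · rw [Int.toNat_of_nonpos h]
    simp
    positivity

lemma abs_latticeSum_le {F : E → ℝ} (hF : HasCompactSupport F) (hc : Continuous F) :
    ∃ C : ℝ, ∀ T : ℝ, 1 ≤ T → ∀ v, |latticeSum b F T v| ≤ C * T ^ Fintype.card ι := by
  have := b.finiteDimensional_of_finite
  obtain ⟨R, hR⟩ := hF.isCompact.isBounded.subset_closedBall 0
  obtain ⟨A, hA⟩ := hc.bounded_above_of_compact_support hF
  obtain ⟨D, hD⟩ : ∃ D : ℝ, ∀ (i : ι) (y : E), |b.repr y i| ≤ D * ‖y‖ := by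
    let φ := b.equivFunL.toContinuousLinearMap
    refine ⟨‖φ‖, fun i y => ?_⟩
    calc |b.repr y i| = ‖φ y i‖ := rfl
      _ ≤ ‖φ y‖ := norm_le_pi_norm _ _
      _ ≤ ‖φ‖ * ‖y‖ := φ.le_opNorm y
  have hA0 : 0 ≤ A := (norm_nonneg _).trans (hA 0)
  set c : ℝ := |D| * |R|
  refine ⟨A * (2 * c + 1) ^ Fintype.card ι, fun T hT v => ?_⟩
  have hT0 : 0 < T := by linarith
  have hc0 : 0 ≤ c := by positivity
  let x := c * T
  classical
  obtain ⟨s, hs⟩ := exists_finset_latticeSum b hF hT0 (B := {v}) Bornology.isBounded_singleton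
  rw [latticeSum_eq_sum b (hs v rfl)]
  let box : Finset (ι → ℤ) :=
    Fintype.piFinset fun i => Finset.Icc ⌈-x - b.repr v i⌉ ⌊x - b.repr v i⌋
  let t := s.filter fun l : Submodule.span ℤ (Set.range b) => F (T⁻¹ • (v + (l : E))) ≠ 0
  have hcard : t.card ≤ box.card := by
    refine Finset.card_le_card_of_injOn (fun l => (b.restrictScalars ℤ).equivFun l) ?_
      (fun _ _ _ _ h => (b.restrictScalars ℤ).equivFun.injective h)
    intro l hl
    have hl' : F (T⁻¹ • (v + l)) ≠ 0 := (Finset.mem_filter.mp hl).2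
    have h1 : T⁻¹ • (v + (l : E)) ∈ Metric.closedBall (0 : E) R := hR (subset_tsupport _ hl')
    rw [Finset.mem_coe, Fintype.mem_piFinset]
    intro i
    have h2 : |b.repr (v + (l : E)) i| ≤ x := by
      refine (hD i _).trans ?_
      have h3 : ‖v + (l : E)‖ ≤ T * R := by
        simp only [Metric.mem_closedBall, dist_zero_right, norm_smul, norm_inv, Real.norm_eq_abs,
          abs_of_pos hT0] at h1
        rwa [inv_mul_le_iff₀ hT0] at h1
      calc D * ‖v + (l : E)‖ ≤ |D| * ‖v + (l : E)‖ := by gcongr; exact le_abs_self D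
        _ ≤ |D| * (T * R) := by gcongr
        _ ≤ |D| * (T * |R|) := by gcongr; exact le_abs_self R
        _ = x := by simp only [x, c]; ring
    have h4 : b.repr (l : E) i = (((b.restrictScalars ℤ).repr l i : ℤ) : ℝ) := by
      have := b.restrictScalars_repr_apply ℤ l i
      simpa using this.symm
    rw [map_add, Finsupp.add_apply, h4, abs_le] at h2
    rw [Finset.mem_Icc, Int.ceil_le, Int.le_floor]
    simp only [Basis.equivFun_apply]
    constructor <;> linarith [h2.1, h2.2]
  have hbox : (box.card : ℝ) ≤ ((2 * c + 1) * T) ^ Fintype.card ι := by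
    rw [Fintype.card_piFinset, Nat.cast_prod]
    calc _ ≤ ∏ _i : ι, ((2 * c + 1) * T) :=
          Finset.prod_le_prod (fun _ _ => Nat.cast_nonneg _)
            fun i _ => card_Icc_ceil_floor_le hc0 hT rfl
      _ = _ := by simp
  rw [← Finset.sum_filter_ne_zero]
  calc |∑ l ∈ t, F (T⁻¹ • (v + l))| ≤ ∑ l ∈ t, |F (T⁻¹ • (v + l))| := Finset.abs_sum_le_sum_abs _ _
    _ ≤ ∑ l ∈ t, A := Finset.sum_le_sum fun l _ => hA _
    _ = t.card * A := by simp
    _ ≤ ((2 * c + 1) * T) ^ Fintype.card ι * A := by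
        gcongr
        exact (Nat.cast_le.mpr hcard).trans hbox
    _ = _ := by rw [mul_pow]; ring

/-- The iterated derivative of `F` in the direction `e`. -/
noncomputable def iterDirDeriv (F : E → ℝ) (e : E) : ℕ → E → ℝ
  | 0 => F
  | j + 1 => fun y => fderiv ℝ (iterDirDeriv F e j) y e

lemma iterDirDeriv_spec {F : E → ℝ} (hF : HasCompactSupport F) (hs : ContDiff ℝ ∞ F) (e : E)
    (j : ℕ) : HasCompactSupport (iterDirDeriv F e j) ∧ ContDiff ℝ ∞ (iterDirDeriv F e j) := by
  induction j with
  | zero => exact ⟨hF, hs⟩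
  | succ j ih =>
    refine ⟨ih.1.fderiv_apply ℝ e, ?_⟩
    exact (ih.2.fderiv_right (m := ∞) (by simp)).clm_apply contDiff_const

lemma abs_latticeSum_add_smul_sub_le {F : E → ℝ} (hF : HasCompactSupport F) (hs : ContDiff ℝ ∞ F)
    (i : ι) : ∃ C : ℝ, ∀ T : ℝ, 1 ≤ T → ∀ v, ∀ s ∈ Set.Icc (0 : ℝ) 1,
      |latticeSum b F T (v + s • b i) - latticeSum b F T v| ≤ C := by
  obtain ⟨C, hC⟩ := abs_latticeSum_le b (iterDirDeriv_spec hF hs (b i) (Fintype.card ι)).1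
    (iterDirDeriv_spec hF hs (b i) (Fintype.card ι)).2.continuous
  refine ⟨C, fun T hT v s hs01 => ?_⟩
  have hT0 : 0 < T := by linarith
  let P : ℕ → ℝ → ℝ := fun j s => (T⁻¹) ^ j * latticeSum b (iterDirDeriv F (b i) j) T (v + s • b i)
  have hd : ∀ j s, HasDerivAt (P j) (P (j + 1) s) s := fun j s => by
    have hj := iterDirDeriv_spec hF hs (b i) j
    have := (hasDerivAt_latticeSum b hj.1 (hj.2.differentiable (by simp)) hT0 v (b i) s).const_mul
      ((T⁻¹) ^ j)
    rw [← mul_assoc, ← pow_succ] at this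
    exact this
  have hp : ∀ j s, P j (s + 1) = P j s := fun j s => by
    have := latticeSum_add_mem b (iterDirDeriv F (b i) j) T (v + s • b i)
      ⟨b i, Submodule.subset_span ⟨i, rfl⟩⟩
    simp only [P, add_smul, one_smul, ← add_assoc, ← this]
  obtain ⟨k, hk⟩ : ∃ k, Fintype.card ι = k + 1 :=
    ⟨Fintype.card ι - 1, (Nat.succ_pred_eq_of_pos (Fintype.card_pos_iff.mpr ⟨i⟩)).symm⟩
  have hB : ∀ s, |P (k + 1) s| ≤ C := fun s => by
    simp only [P, ← hk]
    rw [abs_mul, abs_of_pos (by positivity), inv_pow, inv_mul_le_iff₀ (by positivity), mul_comm]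
    exact hC T hT _
  have h1 := abs_le_of_periodic_of_hasDerivAt k P hd hp C hB
  have := Convex.norm_image_sub_le_of_norm_hasDerivWithin_le (f := P 0) (f' := P 1)
      (s := Set.univ) (C := C) (fun x _ => (hd 0 x).hasDerivWithinAt) (fun x _ => h1 x)
      convex_univ (Set.mem_univ 0) (Set.mem_univ s)
  simp only [P, iterDirDeriv, pow_zero, one_mul, zero_smul, add_zero, sub_zero,
    Real.norm_eq_abs] at this
  refine this.trans ?_
  have hC0 : 0 ≤ C := (abs_nonneg _).trans (hB 0)
  rw [abs_of_nonneg hs01.1]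
  nlinarith [hs01.2]

lemma abs_latticeSum_sub_le {F : E → ℝ} (hF : HasCompactSupport F) (hs : ContDiff ℝ ∞ F) :
    ∃ C : ℝ, ∀ T : ℝ, 1 ≤ T → ∀ v ∈ ZSpan.fundamentalDomain b,
      |latticeSum b F T v - latticeSum b F T 0| ≤ C := by
  classical
  choose C hC using abs_latticeSum_add_smul_sub_le b hF hs
  refine ⟨∑ i, C i, fun T hT v hv => ?_⟩
  rw [ZSpan.mem_fundamentalDomain] at hv
  have key : ∀ t : Finset ι, |latticeSum b F T (∑ i ∈ t, b.repr v i • b i) - latticeSum b F T 0| ≤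
      ∑ i ∈ t, C i := by
    intro t
    induction t using Finset.induction_on with
    | empty => simp
    | insert i t hi ih =>
      rw [Finset.sum_insert hi, Finset.sum_insert hi, add_comm (b.repr v i • b i)]
      have := hC i T hT (∑ i ∈ t, b.repr v i • b i) (b.repr v i) ⟨(hv i).1, (hv i).2.le⟩
      exact (abs_sub_le _ (latticeSum b F T (∑ i ∈ t, b.repr v i • b i)) _).trans
        (add_le_add this ih)
  have := key Finset.univ
  rwa [b.sum_repr] at this

/-- Smooth counting of lattice points with a bounded error term. -/
theorem abs_latticeSum_sub_integral_le [MeasurableSpace E] [BorelSpace E] (μ : Measure E)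
    [μ.IsAddHaarMeasure] {F : E → ℝ} (hF : HasCompactSupport F) (hs : ContDiff ℝ ∞ F) :
    ∃ C : ℝ, ∀ T : ℝ, 1 ≤ T →
      |latticeSum b F T 0 -
        T ^ Fintype.card ι * ((∫ y, F y ∂μ) / μ.real (ZSpan.fundamentalDomain b))| ≤ C := by
  have := b.finiteDimensional_of_finite
  have : ProperSpace E := FiniteDimensional.proper ℝ E
  obtain ⟨C, hC⟩ := abs_latticeSum_sub_le b hF hs
  refine ⟨C, fun T hT => ?_⟩
  have hT0 : 0 < T := by linarith
  set Φ := ZSpan.fundamentalDomain b with hΦ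
  have hΦb : Bornology.IsBounded Φ := ZSpan.fundamentalDomain_isBounded b
  have hΦt : μ Φ < ⊤ := hΦb.measure_lt_top
  have hΦ0 : 0 < μ.real Φ := ENNReal.toReal_pos (ZSpan.measure_fundamentalDomain_ne_zero b) hΦt.ne
  have hInt : ∫ y, F (T⁻¹ • y) ∂μ = T ^ Fintype.card ι * ∫ y, F y ∂μ := by
    rw [Measure.integral_comp_smul, Module.finrank_eq_card_basis b, inv_pow, inv_inv,
      abs_of_pos (by positivity), smul_eq_mul]
  obtain ⟨t, ht⟩ := exists_finset_latticeSum b hF hT0 hΦb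
  have hcont : ∀ l : E, Continuous fun y => F (T⁻¹ • (y + l)) := fun l =>
    hs.continuous.comp (by fun_prop)
  have hionl : ∀ l : E, IntegrableOn (fun y => F (T⁻¹ • (y + l))) Φ μ := fun l =>
    ((hcont l).continuousOn.integrableOn_compact hΦb.isCompact_closure).mono_set subset_closure
  have hunfold : ∫ y, F (T⁻¹ • y) ∂μ = ∫ y in Φ, latticeSum b F T y ∂μ := by
    have hfd := ZSpan.isAddFundamentalDomain b μ
    have hI : Integrable (fun y => F (T⁻¹ • y)) μ :=
      (hs.continuous.comp (continuous_const_smul _)).integrable_of_hasCompactSupport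
        (hF.comp_homeomorph (Homeomorph.smulOfNeZero T⁻¹ (inv_ne_zero hT0.ne')))
    have : VAddInvariantMeasure (Submodule.span ℤ (Set.range b)) E μ :=
      inferInstanceAs <| VAddInvariantMeasure (Submodule.span ℤ (Set.range b)).toAddSubgroup E μ
    rw [hfd.integral_eq_tsum'' _ hI]
    have h1 : ∀ l : Submodule.span ℤ (Set.range b), l ∉ t →
        ∫ y in Φ, F (T⁻¹ • (l +ᵥ y)) ∂μ = 0 := fun l hl => by
      rw [setIntegral_congr_fun (ZSpan.fundamentalDomain_measurableSet b) (g := fun _ => (0 : ℝ))]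
      · simp
      · intro y hy
        have := ht y hy l hl
        rwa [add_comm] at this
    rw [tsum_eq_sum h1]
    have h2 : ∫ y in Φ, latticeSum b F T y ∂μ = ∫ y in Φ, ∑ l ∈ t, F (T⁻¹ • (y + l)) ∂μ :=
      setIntegral_congr_fun (ZSpan.fundamentalDomain_measurableSet b) fun y hy =>
        latticeSum_eq_sum b (ht y hy)
    rw [h2, integral_finsetSum _ fun (l : Submodule.span ℤ (Set.range b)) _ => hionl l]
    refine Finset.sum_congr rfl fun l _ => ?_
    congr 1; ext y
    rw [add_comm]; rfl
  have hfin : latticeSum b F T 0 * μ.real Φ = ∫ y in Φ, latticeSum b F T 0 ∂μ := by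
    rw [setIntegral_const, smul_eq_mul, mul_comm]
  have hIon : IntegrableOn (fun y => latticeSum b F T y) Φ μ := by
    refine (integrable_finsetSum t fun l _ => hionl l).congr ?_
    filter_upwards [ae_restrict_mem (ZSpan.fundamentalDomain_measurableSet b)] with y hy
    exact (latticeSum_eq_sum b (ht y hy)).symm
  have hmain : |∫ y in Φ, (latticeSum b F T y - latticeSum b F T 0) ∂μ| ≤ C * μ.real Φ :=
    (Real.norm_eq_abs _).symm.trans_le
      (norm_setIntegral_le_of_norm_le_const hΦt fun y hy => hC T hT y hy)
  rw [integral_sub hIon (integrableOn_const hΦt.ne), ← hunfold, ← hfin, hInt] at hmain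
  rw [abs_sub_comm, ← mul_div_assoc, div_sub' hΦ0.ne', abs_div, abs_of_pos hΦ0, div_le_iff₀ hΦ0,
    mul_comm (μ.real Φ)]
  exact hmain

end LatticeSum

open NumberField NumberField.mixedEmbedding

/-! ### Smoothing over the unit group -/

section UnitSmoothing

open scoped Classical

variable {K : Type*} [Field K] [NumberField K]

lemma contDiffAt_normAtPlace (v : InfinitePlace K) {y : mixedSpace K} (hy : normAtPlace v y ≠ 0) :
    ContDiffAt ℝ ∞ (fun y : mixedSpace K => normAtPlace v y) y := by
  rcases v.isReal_or_isComplex with hv | hv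
  · have h : (fun y : mixedSpace K => normAtPlace v y) = fun y => ‖y.1 ⟨v, hv⟩‖ :=
      funext fun y => normAtPlace_apply_of_isReal hv y
    rw [normAtPlace_apply_of_isReal hv, norm_ne_zero_iff] at hy
    rw [h]
    exact ContDiffAt.norm ℝ (by fun_prop) hy
  · have h : (fun y : mixedSpace K => normAtPlace v y) = fun y => ‖y.2 ⟨v, hv⟩‖ :=
      funext fun y => normAtPlace_apply_of_isComplex hv y
    rw [normAtPlace_apply_of_isComplex hv, norm_ne_zero_iff] at hy
    rw [h]
    exact ContDiffAt.norm ℝ (by fun_prop) hy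

lemma contDiffAt_norm_mixedSpace {y : mixedSpace K} (hy : mixedEmbedding.norm y ≠ 0) :
    ContDiffAt ℝ ∞ (fun y : mixedSpace K => mixedEmbedding.norm y) y := by
  rw [mixedEmbedding.norm_ne_zero_iff] at hy
  simp_rw [mixedEmbedding.norm_apply]
  exact contDiffAt_prod fun v _ => (contDiffAt_normAtPlace v (hy v)).pow _

lemma finite_units_of_forall_le (B : ℝ) :
    {u : (𝓞 K)ˣ | ∀ v : InfinitePlace K, v (u : K) ≤ B}.Finite := by
  refine Set.Finite.of_finite_image (f := fun u : (𝓞 K)ˣ => ((u : 𝓞 K) : K))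
    ((Embeddings.finite_of_norm_le K ℂ B).subset ?_) ?_
  · rintro _ ⟨u, hu, rfl⟩
    exact ⟨RingOfIntegers.isIntegral_coe _, fun φ => hu (InfinitePlace.mk φ)⟩
  · intro u _ u' _ h
    exact Units.ext (RingOfIntegers.ext h)

lemma normAtPlace_le_norm (v : InfinitePlace K) (y : mixedSpace K) : normAtPlace v y ≤ ‖y‖ := by
  rw [norm_eq_sup'_normAtPlace]
  exact Finset.le_sup' (fun w => normAtPlace w y) (Finset.mem_univ v)

lemma normAtPlace_unit_smul (v : InfinitePlace K) (u : (𝓞 K)ˣ) (y : mixedSpace K) :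
    normAtPlace v (u • y) = v (u : K) * normAtPlace v y := by
  rw [unitSMul_smul, map_mul, normAtPlace_apply]

/-- Only finitely many units move some point of a suitable neighbourhood of a point of nonzero norm
into a given ball. -/
lemma exists_finset_units_eventually {y₀ : mixedSpace K} (hy : mixedEmbedding.norm y₀ ≠ 0) (R : ℝ) :
    ∃ s : Finset (𝓞 K)ˣ, ∀ᶠ y in nhds y₀, ∀ u ∉ s, R < ‖u • y‖ := by
  rw [mixedEmbedding.norm_ne_zero_iff] at hy
  have hpos : ∀ v, 0 < normAtPlace v y₀ := fun v => (normAtPlace_nonneg v y₀).lt_of_ne' (hy v)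
  obtain ⟨δ, hδ0, hδ⟩ : ∃ δ > 0, ∀ v, δ < normAtPlace v y₀ := by
    refine ⟨(Finset.univ.inf' Finset.univ_nonempty fun v => normAtPlace v y₀) / 2, ?_, ?_⟩
    · refine half_pos ((Finset.lt_inf'_iff _).mpr fun v _ => hpos v)
    · intro v
      have h0 := (Finset.lt_inf'_iff Finset.univ_nonempty).mpr
        fun v (_ : v ∈ (Finset.univ : Finset (InfinitePlace K))) => hpos v
      have := Finset.inf'_le (fun v => normAtPlace v y₀) (Finset.mem_univ v)
      linarith
  refine ⟨(finite_units_of_forall_le (K := K) (R / δ)).toFinset, ?_⟩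
  have hev : ∀ᶠ y in nhds y₀, ∀ v, δ < normAtPlace v y :=
    Filter.eventually_all.mpr fun v =>
      (continuous_normAtPlace v).continuousAt.eventually_const_lt (hδ v)
  filter_upwards [hev] with y hyδ u hu
  rw [Set.Finite.mem_toFinset] at hu
  simp only [Set.mem_ofPred_eq, not_forall, not_le] at hu
  obtain ⟨v, hv⟩ := hu
  rw [div_lt_iff₀ hδ0] at hv
  refine (hv.trans_le ?_).trans_le (normAtPlace_le_norm v (u • y))
  rw [normAtPlace_unit_smul]
  gcongr
  exact (hyδ v).le

/-- A point of nonzero bounded norm can be moved by a unit into a fixed ball. -/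
lemma exists_unit_smul_norm_le (K : Type*) [Field K] [NumberField K] :
    ∃ R : ℝ, 0 < R ∧ ∀ y : mixedSpace K, mixedEmbedding.norm y ≠ 0 →
      ∃ u : (𝓞 K)ˣ, ‖u • y‖ ≤ R * mixedEmbedding.norm y ^ ((finrank ℚ K : ℝ)⁻¹) := by
  obtain ⟨R, hR⟩ := (fundamentalCone.isBounded_normLeOne K).subset_closedBall 0
  refine ⟨max R 1, by positivity, fun y hy => ?_⟩
  obtain ⟨u, hu⟩ := fundamentalCone.exists_unit_smul_mem hy
  refine ⟨u, ?_⟩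
  have hn : (finrank ℚ K) ≠ 0 := finrank_pos.ne'
  have hpos : 0 < mixedEmbedding.norm y := (mixedEmbedding.norm_nonneg y).lt_of_ne' hy
  set t := mixedEmbedding.norm y ^ ((finrank ℚ K : ℝ)⁻¹) with ht
  have ht0 : 0 < t := by positivity
  have htn : t ^ finrank ℚ K = mixedEmbedding.norm y := Real.rpow_inv_natCast_pow hpos.le hn
  have hmem : t⁻¹ • u • y ∈ fundamentalCone.normLeOne K := by
    rw [fundamentalCone.mem_normLeOne]
    refine ⟨fundamentalCone.smul_mem_of_mem hu (by positivity), ?_⟩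
    rw [mixedEmbedding.norm_smul, norm_unit_smul, abs_of_pos (by positivity), inv_pow, htn,
      inv_mul_cancel₀ hy]
  have := hR hmem
  rw [mem_closedBall_zero_iff, _root_.norm_smul, norm_inv, Real.norm_eq_abs, abs_of_pos ht0,
    inv_mul_le_iff₀ ht0, mul_comm] at this
  exact this.trans (mul_le_mul_of_nonneg_right (le_max_left _ _) ht0.le)

lemma finite_unit_smul_le {y : mixedSpace K} (hy : mixedEmbedding.norm y ≠ 0) (R : ℝ) :
    {u : (𝓞 K)ˣ | ‖u • y‖ ≤ R}.Finite := by
  obtain ⟨s, hs⟩ := exists_finset_units_eventually hy R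
  refine s.finite_toSet.subset fun u hu => ?_
  by_contra hus
  exact absurd (hs.self_of_nhds u hus) (not_lt.mpr hu)

/-- A smooth function of the norm is the sum over the unit group of the translates of a smooth
compactly supported function. -/
theorem exists_unit_smoothing (W : ℝ → ℝ) {a b : ℝ} (ha : 0 < a)
    (hW : ∀ t, 0 < t → ContDiffAt ℝ ∞ W t) (hsupp : ∀ t, W t ≠ 0 → t ∈ Set.Icc a b) :
    ∃ f : mixedSpace K → ℝ, HasCompactSupport f ∧ ContDiff ℝ ∞ f ∧ f 0 = 0 ∧
      (∀ y, mixedEmbedding.norm y ≠ 0 →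
        ∑' u : (𝓞 K)ˣ, f (u • y) = W (mixedEmbedding.norm y)) ∧
      ((∀ t, 0 ≤ W t) → ∀ y, 0 ≤ f y) := by
  obtain ⟨R, hR0, hR⟩ := exists_unit_smul_norm_le K
  let ρ : ℝ := R * (max b 0) ^ ((finrank ℚ K : ℝ)⁻¹) + 1
  have hρ : 0 < ρ := by positivity
  let g : ContDiffBump (0 : mixedSpace K) := ⟨ρ, ρ + 1, hρ, by linarith⟩
  have hg0 : ∀ y : mixedSpace K, ρ + 1 < ‖y‖ → g y = 0 := fun y hy =>
    g.zero_of_le_dist (by simpa using hy.le)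
  have hg1 : ∀ y : mixedSpace K, ‖y‖ ≤ ρ → g y = 1 := fun y hy =>
    g.one_of_mem_closedBall (by simpa using hy)
  let S : mixedSpace K → ℝ := fun y => ∑' u : (𝓞 K)ˣ, g (u • y)
  have hSinv : ∀ (u : (𝓞 K)ˣ) y, S (u • y) = S y := fun u y => by
    simp only [S, ← mul_smul]
    exact (Equiv.mulRight u).tsum_eq fun u' : (𝓞 K)ˣ => g (u' • y)
  have hSsum : ∀ y, mixedEmbedding.norm y ≠ 0 → Summable fun u : (𝓞 K)ˣ => g (u • y) := by
    intro y hy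
    refine summable_of_hasFiniteSupport ((finite_unit_smul_le hy (ρ + 1)).subset fun u hu => ?_)
    by_contra h
    exact hu (hg0 _ (not_le.mp h))
  have hSpos : ∀ y, mixedEmbedding.norm y ∈ Set.Icc a b → 0 < S y := by
    intro y hy
    have hy0 : mixedEmbedding.norm y ≠ 0 := (ha.trans_le hy.1).ne'
    obtain ⟨u, hu⟩ := hR y hy0
    refine (hSsum y hy0).tsum_pos (fun u => g.nonneg) u ?_
    rw [hg1]
    · exact one_pos
    · refine hu.trans ?_
      have : mixedEmbedding.norm y ^ ((finrank ℚ K : ℝ)⁻¹) ≤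
          (max b 0) ^ ((finrank ℚ K : ℝ)⁻¹) :=
        Real.rpow_le_rpow (mixedEmbedding.norm_nonneg y) (hy.2.trans (le_max_left _ _))
          (by positivity)
      have := mul_le_mul_of_nonneg_left this hR0.le
      simp only [ρ]; linarith
  have hSdiff : ∀ y, mixedEmbedding.norm y ≠ 0 → ContDiffAt ℝ ∞ S y := by
    intro y hy
    obtain ⟨s, hs⟩ := exists_finset_units_eventually hy (ρ + 1)
    have : S =ᶠ[nhds y] fun y => ∑ u ∈ s, g (u • y) := by
      filter_upwards [hs] with z hz
      exact tsum_eq_sum fun u hu => hg0 _ (hz u hu)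
    refine ContDiffAt.congr_of_eventuallyEq ?_ this
    refine ContDiffAt.sum fun u _ => ?_
    simp_rw [unitSMul_smul]
    refine g.contDiff.contDiffAt.comp _ ?_
    exact contDiffAt_const.mul contDiffAt_id
  let f : mixedSpace K → ℝ := fun y => W (mixedEmbedding.norm y) * g y / S y
  have hf : ∀ y, f y ≠ 0 → mixedEmbedding.norm y ∈ Set.Icc a b := fun y hy => by
    refine hsupp _ fun h => hy ?_
    simp [f, h]
  have hts : ∀ y ∈ tsupport f, mixedEmbedding.norm y ∈ Set.Icc a b := by
    have : IsClosed {y : mixedSpace K | mixedEmbedding.norm y ∈ Set.Icc a b} :=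
      isClosed_Icc.preimage (mixedEmbedding.continuous_norm K)
    exact fun y hy => closure_minimal (fun y hy => hf y hy) this hy
  refine ⟨f, ?_, ?_, ?_, ?_, ?_⟩
  · refine g.hasCompactSupport.mono fun y hy h => hy ?_
    simp [f, h]
  · rw [contDiff_iff_contDiffAt]
    intro y
    by_cases hy : y ∈ tsupport f
    swap
    · exact contDiffAt_const.congr_of_eventuallyEq (notMem_tsupport_iff_eventuallyEq.mp hy)
    have hN := hts y hy
    have hN0 : 0 < mixedEmbedding.norm y := ha.trans_le hN.1
    refine ContDiffAt.div (ContDiffAt.mul ?_ g.contDiff.contDiffAt) (hSdiff y hN0.ne')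
      (hSpos y hN).ne'
    exact (hW _ hN0).comp y (contDiffAt_norm_mixedSpace hN0.ne')
  · by_contra h
    have := (hf 0 h).1
    rw [map_zero] at this
    linarith
  · intro y hy
    have h1 : ∀ u : (𝓞 K)ˣ, f (u • y) = W (mixedEmbedding.norm y) / S y * g (u • y) := fun u => by
      simp only [f, hSinv, norm_unit_smul]; ring
    simp_rw [h1]
    rw [tsum_mul_left]
    by_cases hw : W (mixedEmbedding.norm y) = 0
    · simp [hw]
    · exact div_mul_cancel₀ _ (hSpos y (hsupp _ hw)).ne'
  · intro h0 y
    exact div_nonneg (mul_nonneg (h0 _) g.nonneg) (tsum_nonneg fun u => g.nonneg)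

end UnitSmoothing

/-! ### Smooth counting of ideals in a class -/

section ClassCounting

open scoped Classical

variable {K : Type*} [Field K] [NumberField K]

lemma exists_span_singleton_eq_mul {a J : (Ideal (𝓞 K))⁰}
    (h : ClassGroup.mk0 a * ClassGroup.mk0 J = 1) :
    ∃ α : 𝓞 K, Ideal.span {α} = (a : Ideal (𝓞 K)) * J := by
  rw [← map_mul] at h
  have := ((ClassGroup.mk0_eq_one_iff (a * J).2).mp h).principal
  obtain ⟨α, hα⟩ := this
  rw [Submonoid.coe_mul] at hα
  exact ⟨α, hα.symm⟩

lemma mem_right_of_span_singleton_eq_mul {R : Type*} [CommRing R] {a J : Ideal R} {α : R}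
    (h : Ideal.span {α} = a * J) : α ∈ J :=
  Ideal.mul_le_right (I := a) (h ▸ Ideal.mem_span_singleton_self α)

lemma mk0_mul_mk0_eq_one_of_span {a J : (Ideal (𝓞 K))⁰} {α : 𝓞 K}
    (h : Ideal.span {α} = (a : Ideal (𝓞 K)) * J) : ClassGroup.mk0 a * ClassGroup.mk0 J = 1 := by
  rw [← map_mul]
  refine (ClassGroup.mk0_eq_one_iff (a * J).2).mpr ?_
  rw [Submonoid.coe_mul, ← h]
  exact ⟨α, rfl⟩

/-- The sum of `W (N(a) / X)` over the ideals `a` of a fixed class is a sum over a lattice. -/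
lemma tsum_class_eq_latticeSum {W : ℝ → ℝ} {f : mixedSpace K → ℝ} (hf : HasCompactSupport f)
    (hf0 : f 0 = 0) (hfW : ∀ y, mixedEmbedding.norm y ≠ 0 →
      ∑' u : (𝓞 K)ˣ, f (u • y) = W (mixedEmbedding.norm y))
    (c : ClassGroup (𝓞 K)) (J : (Ideal (𝓞 K))⁰) (hJ : ClassGroup.mk0 J = c⁻¹) {T X : ℝ}
    (hT : 0 < T) (hTX : T ^ finrank ℚ K = Ideal.absNorm (J : Ideal (𝓞 K)) * X) :
    ∑' a : {a : (Ideal (𝓞 K))⁰ // ClassGroup.mk0 a = c},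
        W (Ideal.absNorm ((a : (Ideal (𝓞 K))⁰) : Ideal (𝓞 K)) / X) =
      latticeSum (fractionalIdealLatticeBasis K (FractionalIdeal.mk0 K J)) f T 0 := by
  set b := fractionalIdealLatticeBasis K (FractionalIdeal.mk0 K J) with hb
  have hJ0 : (J : Ideal (𝓞 K)) ≠ 0 := nonZeroDivisors.coe_ne_zero J
  have hmem : ∀ α : 𝓞 K, α ∈ (J : Ideal (𝓞 K)) →
      mixedEmbedding K α ∈ Submodule.span ℤ (Set.range b) := fun α hα => by
    rw [hb, mem_span_fractionalIdealLatticeBasis]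
    refine ⟨α, ?_, rfl⟩
    rw [FractionalIdeal.coe_mk0]
    exact FractionalIdeal.mem_coeIdeal_of_mem _ hα
  have hgen : ∀ a : {a : (Ideal (𝓞 K))⁰ // ClassGroup.mk0 a = c}, ∃ α : 𝓞 K,
      Ideal.span {α} = ((a : (Ideal (𝓞 K))⁰) : Ideal (𝓞 K)) * J := fun a =>
    exists_span_singleton_eq_mul (by rw [a.2, hJ, mul_inv_cancel])
  choose α hα using hgen
  have hα0 : ∀ a, α a ≠ 0 := fun a h => by
    have := hα a
    rw [h, Ideal.span_singleton_eq_bot.mpr rfl] at this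
    exact mul_ne_zero (nonZeroDivisors.coe_ne_zero a.1) hJ0 this.symm
  have hαJ : ∀ a, α a ∈ (J : Ideal (𝓞 K)) := fun a =>
    mem_right_of_span_singleton_eq_mul (hα a)
  let ψ : {a : (Ideal (𝓞 K))⁰ // ClassGroup.mk0 a = c} × (𝓞 K)ˣ → Submodule.span ℤ (Set.range b) :=
    fun p => ⟨mixedEmbedding K ((p.2 : 𝓞 K) * α p.1 : 𝓞 K), hmem _ (Ideal.mul_mem_left _ _ (hαJ _))⟩
  have hψ : Function.Injective ψ := by
    rintro ⟨a, u⟩ ⟨a', u'⟩ h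
    have h1 : (u : 𝓞 K) * α a = u' * α a' :=
      RingOfIntegers.ext (mixedEmbedding_injective K (congrArg Subtype.val h))
    have h2 : Ideal.span {α a} = Ideal.span {α a'} := by
      rw [Ideal.span_singleton_eq_span_singleton]
      refine ⟨u * u'⁻¹, ?_⟩
      rw [Units.val_mul, ← mul_assoc, mul_comm (α a), h1, mul_comm, ← mul_assoc, Units.inv_mul,
        one_mul]
    rw [hα, hα] at h2
    obtain rfl : a = a' := Subtype.ext (Subtype.ext (mul_right_cancel₀ hJ0 h2))
    exact Prod.ext rfl (Units.ext (mul_right_cancel₀ (hα0 a) h1))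
  have hrange : ∀ l : Submodule.span ℤ (Set.range b), (l : mixedSpace K) ≠ 0 → l ∈ Set.range ψ := by
    rintro ⟨l, hl⟩ hl0
    have hl' := hl
    rw [hb, mem_span_fractionalIdealLatticeBasis, FractionalIdeal.coe_mk0] at hl'
    obtain ⟨x, hx, rfl⟩ := hl'
    obtain ⟨β, hβ, rfl⟩ := (FractionalIdeal.mem_coeIdeal _).mp hx
    have hβ0 : β ≠ 0 := fun h => hl0 (by simp [h])
    obtain ⟨a, ha⟩ := Ideal.dvd_iff_le.mpr ((Ideal.span_singleton_le_iff_mem _).mpr hβ)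
    have ha0 : a ≠ 0 := fun h => hβ0 (by simpa [h] using ha)
    let a' : (Ideal (𝓞 K))⁰ := ⟨a, mem_nonZeroDivisors_of_ne_zero ha0⟩
    have hac : ClassGroup.mk0 a' = c := by
      have h1 := mk0_mul_mk0_eq_one_of_span (a := a') (J := J) (α := β) (by rw [ha, mul_comm])
      rwa [hJ, mul_inv_eq_one] at h1
    have h3 : Associated (α ⟨a', hac⟩) β := by
      rw [← Ideal.span_singleton_eq_span_singleton, hα, ha, mul_comm]
    obtain ⟨u, hu⟩ := h3
    refine ⟨(⟨a', hac⟩, u), Subtype.ext ?_⟩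
    simp only [ψ]
    rw [mul_comm, hu]
  obtain ⟨s, hs⟩ := exists_finset_latticeSum b hf hT (B := {0}) Bornology.isBounded_singleton
  have hsum : Summable fun l : Submodule.span ℤ (Set.range b) => f (T⁻¹ • (0 + l)) :=
    summable_of_ne_finset_zero (s := s) (hs 0 rfl)
  rw [latticeSum, ← hψ.tsum_eq]
  · refine Eq.trans ?_ (hsum.comp_injective hψ).tsum_prod.symm
    refine tsum_congr fun a => ?_
    have hN : (mixedEmbedding.norm (T⁻¹ • mixedEmbedding K (α a))) =
        Ideal.absNorm ((a : (Ideal (𝓞 K))⁰) : Ideal (𝓞 K)) / X := by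
      have h1 : (mixedEmbedding.norm (mixedEmbedding K (α a : K)) : ℝ) =
          Ideal.absNorm ((a : (Ideal (𝓞 K))⁰) : Ideal (𝓞 K)) *
            Ideal.absNorm (J : Ideal (𝓞 K)) := by
        have h2 := Ideal.absNorm_span_singleton (α a)
        rw [hα, map_mul] at h2
        rw [mixedEmbedding.norm_eq_norm, ← Nat.cast_mul, h2, ← Algebra.coe_norm_int,
          Nat.cast_natAbs]
        norm_cast
      have hNJ : (0 : ℝ) < Ideal.absNorm (J : Ideal (𝓞 K)) :=
        Nat.cast_pos.mpr (Ideal.absNorm_pos_of_nonZeroDivisors J)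
      rw [mixedEmbedding.norm_smul, h1, abs_of_pos (by positivity), inv_pow, hTX]
      have hX : X ≠ 0 := fun h => by
        rw [h, mul_zero] at hTX
        exact (pow_pos hT _).ne' hTX
      field_simp
    have hNne : mixedEmbedding.norm (T⁻¹ • mixedEmbedding K (α a : K)) ≠ 0 := by
      rw [mixedEmbedding.norm_smul]
      refine mul_ne_zero (by positivity) ?_
      rw [mixedEmbedding.norm_eq_norm]
      simpa using hα0 a
    rw [← hN, ← hfW _ hNne]
    refine tsum_congr fun u => ?_
    simp only [ψ, Function.comp, zero_add]
    rw [unitSMul_smul, mul_smul_comm, ← map_mul, ← map_mul]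
  · intro l hl
    refine hrange l fun h => hl ?_
    simp [h, hf0]

lemma exists_support_subset_Icc {w : ℝ → ℝ} (hc : HasCompactSupport w) :
    ∃ A : ℝ, 0 < A ∧ ∀ x, w x ≠ 0 → x ∈ Set.Icc (-A) A := by
  obtain ⟨A, hA⟩ := hc.isCompact.isBounded.subset_closedBall 0
  refine ⟨max A 1, by positivity, fun x hx => ?_⟩
  have := hA (subset_tsupport _ hx)
  rw [mem_closedBall_zero_iff, Real.norm_eq_abs, abs_le] at this
  exact ⟨by linarith [le_max_left A 1], this.2.trans (le_max_left _ _)⟩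

lemma finite_nonZeroDivisors_absNorm_le (x : ℝ) :
    {a : (Ideal (𝓞 K))⁰ | (Ideal.absNorm (a : Ideal (𝓞 K)) : ℝ) ≤ x}.Finite := by
  refine Set.Finite.of_finite_image (f := Subtype.val)
    ((Ideal.finite_setOfPred_absNorm_le (S := 𝓞 K) ⌊x⌋₊).subset ?_) Subtype.val_injective.injOn
  rintro _ ⟨a, ha, rfl⟩
  exact Nat.le_floor ha

lemma absNorm_pos (a : (Ideal (𝓞 K))⁰) : (0 : ℝ) < Ideal.absNorm (a : Ideal (𝓞 K)) :=
  Nat.cast_pos.mpr (Ideal.absNorm_pos_of_nonZeroDivisors a)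

/-- Smooth counting of the ideals in a given class, with a bounded error term and a main term which
does not depend on the class. -/
theorem exists_classSum_bound (K : Type*) [Field K] [NumberField K] {w : ℝ → ℝ}
    (hw : ContDiff ℝ ∞ w) (hc : HasCompactSupport w) :
    ∃ κ C : ℝ, ((∀ x, 0 ≤ w x) → (∃ x, w x ≠ 0) → 0 < κ) ∧
      ∀ (c : ClassGroup (𝓞 K)) (τ : ℝ),
        |∑' a : {a : (Ideal (𝓞 K))⁰ // ClassGroup.mk0 a = c},
          w (Real.log (Ideal.absNorm ((a : (Ideal (𝓞 K))⁰) : Ideal (𝓞 K))) - τ) -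
            κ * Real.exp τ| ≤ C := by
  obtain ⟨A, hA0, hA⟩ := exists_support_subset_Icc hc
  let W : ℝ → ℝ := fun t => if 0 < t then w (Real.log t) else 0
  have hWd : ∀ t, 0 < t → ContDiffAt ℝ ∞ W t := fun t ht => by
    have h1 : ContDiffAt ℝ ∞ (fun t => w (Real.log t)) t :=
      hw.contDiffAt.comp t (Real.contDiffAt_log.mpr ht.ne')
    refine h1.congr_of_eventuallyEq ?_
    filter_upwards [lt_mem_nhds ht] with s hs
    simp [W, hs]
  have hWs : ∀ t, W t ≠ 0 → t ∈ Set.Icc (Real.exp (-A)) (Real.exp A) := fun t ht => by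
    by_cases h : 0 < t
    · simp only [W, h, if_true] at ht
      have := hA _ ht
      rwa [Set.mem_Icc, Real.le_log_iff_exp_le h, Real.log_le_iff_le_exp h] at this
    · simp [W, h] at ht
  obtain ⟨f, hfc, hfd, hf0, hfW, hfnn⟩ := exists_unit_smoothing (K := K) W (Real.exp_pos _) hWd hWs
  set V := volume.real (ZSpan.fundamentalDomain (latticeBasis K)) with hV
  have hV0 : 0 < V := ENNReal.toReal_pos (ZSpan.measure_fundamentalDomain_ne_zero _)
    (ZSpan.fundamentalDomain_isBounded _).measure_lt_top.ne
  set κ := (∫ y, f y) / V with hκ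
  obtain ⟨M, hM⟩ := hw.continuous.bounded_above_of_compact_support hc
  have hM0 : 0 ≤ M := (norm_nonneg _).trans (hM 0)
  have key : ∀ c : ClassGroup (𝓞 K), ∃ C : ℝ, ∀ τ : ℝ,
        |∑' a : {a : (Ideal (𝓞 K))⁰ // ClassGroup.mk0 a = c},
          w (Real.log (Ideal.absNorm ((a : (Ideal (𝓞 K))⁰) : Ideal (𝓞 K))) - τ) -
            κ * Real.exp τ| ≤ C := by
    intro c
    obtain ⟨J, hJ⟩ := ClassGroup.mk0_surjective (R := 𝓞 K) c⁻¹
    set b := fractionalIdealLatticeBasis K (FractionalIdeal.mk0 K J) with hb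
    obtain ⟨C, hC⟩ := abs_latticeSum_sub_integral_le b volume hfc hfd
    have hNJ := absNorm_pos J
    have hvol : volume.real (ZSpan.fundamentalDomain b) = Ideal.absNorm (J : Ideal (𝓞 K)) * V := by
      rw [Measure.real, hb, volume_fundamentalDomain_fractionalIdealLatticeBasis,
        ENNReal.toReal_mul, FractionalIdeal.coe_mk0, FractionalIdeal.coeIdeal_absNorm,
        ENNReal.toReal_ofReal (by positivity), hV, Measure.real]
      simp
    have hcard : Fintype.card (Free.ChooseBasisIndex ℤ (FractionalIdeal.mk0 K J)) =
        finrank ℚ K := by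
      rw [← Module.finrank_eq_card_basis b, mixedEmbedding.finrank]
    have hfin := (finite_nonZeroDivisors_absNorm_le (K := K) (Real.exp A))
    have hterm : ∀ (a : {a : (Ideal (𝓞 K))⁰ // ClassGroup.mk0 a = c}) (τ : ℝ),
        W (Ideal.absNorm ((a : (Ideal (𝓞 K))⁰) : Ideal (𝓞 K)) / Real.exp τ) =
        w (Real.log (Ideal.absNorm ((a : (Ideal (𝓞 K))⁰) : Ideal (𝓞 K))) - τ) := fun a τ => by
      have := absNorm_pos a.1
      simp only [W]
      rw [if_pos (by positivity), Real.log_div this.ne' (Real.exp_pos _).ne', Real.log_exp]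
    refine ⟨max C (hfin.toFinset.card * M + |κ|), fun τ => ?_⟩
    rcases le_or_gt 1 ((Ideal.absNorm (J : Ideal (𝓞 K)) : ℝ) * Real.exp τ) with h1 | h1
    · refine le_trans ?_ (le_max_left _ _)
      have hn : finrank ℚ K ≠ 0 := finrank_pos.ne'
      set T := ((Ideal.absNorm (J : Ideal (𝓞 K)) : ℝ) * Real.exp τ) ^ ((finrank ℚ K : ℝ)⁻¹)
      have hT : 1 ≤ T := Real.one_le_rpow h1 (by positivity)
      have hTn : T ^ finrank ℚ K = Ideal.absNorm (J : Ideal (𝓞 K)) * Real.exp τ :=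
        Real.rpow_inv_natCast_pow (by positivity) hn
      have h2 := hC T hT
      rw [← tsum_class_eq_latticeSum hfc hf0 hfW c J hJ (by linarith) hTn, hvol, hcard, hTn] at h2
      simp_rw [hterm] at h2
      have h3 : κ * Real.exp τ = (Ideal.absNorm (J : Ideal (𝓞 K)) : ℝ) * Real.exp τ *
          ((∫ y, f y) / (Ideal.absNorm (J : Ideal (𝓞 K)) * V)) := by
        rw [hκ]
        field_simp
      rw [h3]
      exact h2
    · refine le_trans ?_ (le_max_right _ _)
      have hτ : Real.exp τ ≤ 1 := by
        have : (1 : ℝ) ≤ Ideal.absNorm (J : Ideal (𝓞 K)) := by exact_mod_cast hNJ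
        nlinarith [Real.exp_pos τ]
      have hτ0 : τ ≤ 0 := by simpa using hτ
      refine (abs_sub _ _).trans (add_le_add ?_ ?_)
      · let s : Finset {a : (Ideal (𝓞 K))⁰ // ClassGroup.mk0 a = c} :=
          hfin.toFinset.subtype _
        rw [tsum_eq_sum (s := s)]
        · refine (Finset.abs_sum_le_sum_abs _ _).trans ?_
          refine (Finset.sum_le_sum fun a _ => hM _).trans ?_
          rw [Finset.sum_const, nsmul_eq_mul]
          gcongr
          rw [Finset.card_subtype]
          exact Finset.card_filter_le _ _
        · intro a ha
          by_contra hne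
          apply ha
          have h3 := (hA _ hne).2
          rw [Finset.mem_subtype, Set.Finite.mem_toFinset]
          have := absNorm_pos a.1
          rw [Set.mem_ofPred_eq, ← Real.log_le_iff_le_exp this]
          linarith
      · rw [abs_mul, abs_of_pos (Real.exp_pos τ)]
        nlinarith [abs_nonneg κ]
  choose C hC using key
  obtain ⟨C', hC'⟩ := Finite.exists_le C
  refine ⟨κ, C', fun hnn ⟨x, hx⟩ => ?_, fun c τ => (hC c τ).trans (hC' c)⟩
  have hfnn' : ∀ y, 0 ≤ f y := hfnn fun t => by
    simp only [W]; split_ifs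
    · exact hnn _
    · exact le_rfl
  refine div_pos ?_ hV0
  have hn : finrank ℚ K ≠ 0 := finrank_pos.ne'
  have hN : mixedEmbedding.norm
      ((Real.exp x ^ ((finrank ℚ K : ℝ)⁻¹)) • (1 : mixedSpace K)) = Real.exp x := by
    rw [mixedEmbedding.norm_smul, map_one, mul_one, abs_of_pos (by positivity),
      Real.rpow_inv_natCast_pow (by positivity) hn]
  have h1 := hfW _ (by rw [hN]; positivity)
  rw [hN] at h1
  have h2 : W (Real.exp x) = w x := by simp [W, Real.exp_pos]
  rw [h2] at h1
  obtain ⟨u, hu⟩ : ∃ u : (𝓞 K)ˣ,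
      f (u • ((Real.exp x ^ ((finrank ℚ K : ℝ)⁻¹)) • (1 : mixedSpace K))) ≠ 0 := by
    by_contra! h
    rw [tsum_congr h, tsum_zero] at h1
    exact hx h1.symm
  exact hfd.continuous.integral_pos_of_hasCompactSupport_nonneg_nonzero hfc hfnn' hu

end ClassCounting

/-! ### Smooth sums over a type with a size function -/

section SmoothSum

open scoped Convolution

variable {ι κ : Type*}

/-- A nonnegative function with finite sublevel sets. -/
structure IsSize (x : ι → ℝ) : Prop where
  nonneg : ∀ i, 0 ≤ x i
  finite : ∀ X, {i | x i ≤ X}.Finite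

/-- The sum of the coefficients `f`, with the weight `w` centred at size `τ`. -/
noncomputable def smoothSum (x : ι → ℝ) (f : ι → ℂ) (w : ℝ → ℝ) (τ : ℝ) : ℂ :=
  ∑' i, f i * (w (x i - τ) : ℂ)

lemma IsSize.prod {x : ι → ℝ} {y : κ → ℝ} (hx : IsSize x) (hy : IsSize y) :
    IsSize fun p : ι × κ => x p.1 + y p.2 where
  nonneg p := add_nonneg (hx.nonneg _) (hy.nonneg _)
  finite X := by
    refine ((hx.finite X).prod (hy.finite X)).subset fun p hp => ?_
    have h1 := hx.nonneg p.1
    have h2 := hy.nonneg p.2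
    simp only [Set.mem_ofPred_eq] at hp
    exact ⟨by simp only [Set.mem_ofPred_eq]; linarith, by simp only [Set.mem_ofPred_eq]; linarith⟩

variable {x : ι → ℝ} {y : κ → ℝ} {f : ι → ℂ} {g : κ → ℂ} {w v : ℝ → ℝ} {A B : ℝ}

lemma smoothSum_eq_sum (hx : IsSize x) (hA : ∀ z, w z ≠ 0 → z ∈ Set.Icc (-A) A) {τ X : ℝ}
    (hX : τ + A ≤ X) :
    smoothSum x f w τ = ∑ i ∈ (hx.finite X).toFinset, f i * (w (x i - τ) : ℂ) := by
  refine tsum_eq_sum fun i hi => ?_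
  rw [Set.Finite.mem_toFinset, Set.mem_ofPred_eq, not_le] at hi
  have : w (x i - τ) = 0 := by
    by_contra h
    linarith [(hA _ h).2]
  simp [this]

lemma smoothSum_eq_zero (hx : IsSize x) (hA : ∀ z, w z ≠ 0 → z ∈ Set.Icc (-A) A) {τ : ℝ}
    (hτ : τ < -A) : smoothSum x f w τ = 0 := by
  rw [smoothSum, ← tsum_zero (α := ℂ) (β := ι)]
  refine tsum_congr fun i => ?_
  have : w (x i - τ) = 0 := by
    by_contra h
    linarith [(hA _ h).2, hx.nonneg i]
  simp [this]

lemma continuous_smoothSum (hx : IsSize x) (hw : Continuous w) (hc : HasCompactSupport w) :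
    Continuous (smoothSum x f w) := by
  obtain ⟨A, -, hA⟩ := exists_support_subset_Icc hc
  rw [continuous_iff_continuousAt]
  intro τ₀
  have : ContinuousAt (fun τ => ∑ i ∈ (hx.finite (τ₀ + 1 + A)).toFinset,
      f i * (w (x i - τ) : ℂ)) τ₀ := by
    refine Continuous.continuousAt ?_
    fun_prop
  refine this.congr ?_
  filter_upwards [gt_mem_nhds (lt_add_one τ₀)] with τ hτ
  exact (smoothSum_eq_sum hx hA (by linarith)).symm

lemma convolution_apply_sub (a b : ℝ) :
    (w ⋆[ContinuousLinearMap.lsmul ℝ ℝ] v) (a + b) = ∫ τ, w (a - τ) * v (b + τ) := by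
  rw [convolution_def, ← integral_sub_left_eq_self _ volume a]
  refine integral_congr_ae (Filter.Eventually.of_forall fun τ => ?_)
  simp only [ContinuousLinearMap.lsmul_apply, smul_eq_mul]
  ring_nf

/-- The convolution of two smooth sums is the smooth sum over pairs. -/
lemma integral_smoothSum_mul_smoothSum (hx : IsSize x) (hy : IsSize y)
    (hw : Continuous w) (hwc : HasCompactSupport w) (hv : Continuous v)
    (hvc : HasCompactSupport v) (t : ℝ) :
    ∫ τ, smoothSum x f w τ * smoothSum y g v (t - τ) =
      smoothSum (fun p : ι × κ => x p.1 + y p.2) (fun p => f p.1 * g p.2)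
        (w ⋆[ContinuousLinearMap.lsmul ℝ ℝ] v) t := by
  obtain ⟨A, hA0, hA⟩ := exists_support_subset_Icc hwc
  obtain ⟨B, hB0, hB⟩ := exists_support_subset_Icc hvc
  set s := (hx.finite (t + A + B)).toFinset with hs
  set s' := (hy.finite (t + A + B)).toFinset with hs'
  have h1 : ∀ τ, smoothSum x f w τ * smoothSum y g v (t - τ) =
      ∑ p ∈ s ×ˢ s', (f p.1 * g p.2) * ((w (x p.1 - τ) * v (y p.2 - t + τ) : ℝ) : ℂ) := by
    intro τ
    have h2 : ∑ p ∈ s ×ˢ s', (f p.1 * g p.2) * ((w (x p.1 - τ) * v (y p.2 - t + τ) : ℝ) : ℂ) =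
        (∑ i ∈ s, f i * (w (x i - τ) : ℂ)) * ∑ j ∈ s', g j * (v (y j - (t - τ)) : ℂ) := by
      rw [Finset.sum_mul_sum, ← Finset.sum_product']
      refine Finset.sum_congr rfl fun p _ => ?_
      push_cast
      rw [show y p.2 - t + τ = y p.2 - (t - τ) by ring]
      ring
    rw [h2]
    by_cases c1 : τ < -A
    · rw [smoothSum_eq_zero hx hA c1, zero_mul, Finset.sum_eq_zero, zero_mul]
      intro i _
      have : w (x i - τ) = 0 := by
        by_contra h
        linarith [(hA _ h).2, hx.nonneg i]
      simp [this]
    by_cases c2 : t - τ < -B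
    · rw [smoothSum_eq_zero hy hB c2, mul_zero]
      symm
      rw [mul_eq_zero]
      right
      refine Finset.sum_eq_zero fun j _ => ?_
      have : v (y j - (t - τ)) = 0 := by
        by_contra h
        linarith [(hB _ h).2, hy.nonneg j]
      simp [this]
    rw [smoothSum_eq_sum hx hA (X := t + A + B) (by linarith),
      smoothSum_eq_sum hy hB (X := t + A + B) (by linarith)]
  simp_rw [h1]
  rw [integral_finsetSum]
  · rw [smoothSum, tsum_eq_sum (s := s ×ˢ s')]
    · refine Finset.sum_congr rfl fun p _ => ?_
      rw [integral_const_mul, integral_complex_ofReal, ← convolution_apply_sub,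
        show x p.1 + (y p.2 - t) = x p.1 + y p.2 - t by ring]
    · intro p hp
      have hp' : t + A + B < x p.1 + y p.2 := by
        by_contra! h
        apply hp
        have h1 := hx.nonneg p.1
        have h2 := hy.nonneg p.2
        rw [Finset.mem_product, hs, hs', Set.Finite.mem_toFinset, Set.Finite.mem_toFinset]
        exact ⟨by simp only [Set.mem_ofPred_eq]; linarith,
          by simp only [Set.mem_ofPred_eq]; linarith⟩
      rw [show x p.1 + y p.2 - t = x p.1 + (y p.2 - t) by ring, convolution_apply_sub]
      rw [integral_eq_zero_of_ae, Complex.ofReal_zero, mul_zero]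
      refine Filter.Eventually.of_forall fun τ => ?_
      by_contra h
      simp only [Pi.zero_apply, mul_eq_zero, not_or] at h
      linarith [(hA _ h.1).2, (hB _ h.2).2]
  · intro p _
    have h3 : Continuous fun τ => w (x p.1 - τ) * v (y p.2 - t + τ) := by fun_prop
    have h4 : HasCompactSupport fun τ => w (x p.1 - τ) * v (y p.2 - t + τ) := by
      refine HasCompactSupport.of_support_subset_isCompact
        (isCompact_Icc (a := x p.1 - A) (b := x p.1 + A)) fun τ hτ => ?_
      have := hA _ (left_ne_zero_of_mul hτ)
      exact ⟨by linarith [this.2], by linarith [this.1]⟩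
    exact ((h3.integrable_of_hasCompactSupport h4).ofReal (𝕜 := ℂ)).const_mul _

end SmoothSum

/-! ### Positivity of the coefficients of `|ζ L|²` -/

section Positivity

open scoped ComplexConjugate Classical

lemma le_re_sum_fiber {β M : Type*} (S : Finset β) (π : β → M) (u : β → ℂ) (V : M → ℝ)
    (hV : ∀ a, 0 ≤ V a) {p₀ : β} (hp₀ : p₀ ∈ S) (huniq : ∀ p ∈ S, π p = π p₀ → p = p₀)
    (hu : ‖u p₀‖ = 1) :
    V (π p₀) ≤ (∑ p ∈ S, ∑ p' ∈ S,
      if π p = π p' then u p * conj (u p') * (V (π p) : ℂ) else 0).re := by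
  have h1 : (∑ p ∈ S, ∑ p' ∈ S, if π p = π p' then u p * conj (u p') * (V (π p) : ℂ) else 0) =
      ((∑ a ∈ S.image π, V a * Complex.normSq (∑ p ∈ S with π p = a, u p) : ℝ) : ℂ) := by
    rw [← Finset.sum_fiberwise_of_maps_to (g := π) (t := S.image π)
      (fun p hp => Finset.mem_image_of_mem _ hp)]
    push_cast
    refine Finset.sum_congr rfl fun a _ => ?_
    rw [Complex.normSq_eq_conj_mul_self, map_sum, mul_comm (∑ p ∈ S with π p = a, conj (u p)),
      Finset.sum_mul_sum, Finset.mul_sum]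
    refine Finset.sum_congr rfl fun p hp => ?_
    rw [Finset.mem_filter] at hp
    rw [← Finset.sum_filter, Finset.mul_sum]
    refine Finset.sum_congr (by ext p'; simp [hp.2, eq_comm]) fun p' _ => ?_
    rw [hp.2]
    ring
  rw [h1, Complex.ofReal_re]
  have h2 : (∑ p ∈ S with π p = π p₀, u p) = u p₀ := by
    have : (S.filter fun p => π p = π p₀) = {p₀} := by
      ext p
      simp only [Finset.mem_filter, Finset.mem_singleton]
      exact ⟨fun h => huniq p h.1 h.2, by rintro rfl; exact ⟨hp₀, rfl⟩⟩
    rw [this, Finset.sum_singleton]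
  calc V (π p₀) = V (π p₀) * Complex.normSq (∑ p ∈ S with π p = π p₀, u p) := by
        rw [h2, Complex.normSq_eq_norm_sq, hu]; ring
    _ ≤ _ := Finset.single_le_sum
        (f := fun a => V a * Complex.normSq (∑ p ∈ S with π p = a, u p))
        (fun a _ => mul_nonneg (hV a) (Complex.normSq_nonneg _)) (Finset.mem_image_of_mem _ hp₀)

/-- The divisibility properties of the monoid of nonzero ideals used below, for an abstract
coprimality relation `R`. -/
structure HasCoprimeParts (M : Type*) [CommMonoid M] (R : M → M → Prop) : Prop where
  exists_parts : ∀ a b : M, ∃ g c d, a = g * c ∧ b = g * d ∧ R c d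
  symm : ∀ {c d}, R c d → R d c
  dvd_of_dvd_mul : ∀ {c d x : M}, R c d → c ∣ d * x → c ∣ x
  antisymm : ∀ {a b : M}, a ∣ b → b ∣ a → a = b

variable {M : Type*} [CancelCommMonoid M] {R : M → M → Prop}

lemma HasCoprimeParts.unique (hR : HasCoprimeParts M R) {g c d g' c' d' : M} (h : R c d)
    (h' : R c' d') (h1 : g * c = g' * c') (h2 : g * d = g' * d') : g = g' ∧ c = c' ∧ d = d' := by
  have h3 : c * d' = d * c' := by
    have : (g * g') * (c * d') = (g * g') * (d * c') := by
      calc (g * g') * (c * d') = (g * c) * (g' * d') := by ac_rfl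
        _ = (g' * c') * (g * d) := by rw [h1, h2]
        _ = (g * g') * (d * c') := by ac_rfl
    exact mul_left_cancel this
  have h4 : c ∣ c' := hR.dvd_of_dvd_mul h ⟨d', h3.symm⟩
  have h5 : c' ∣ c := hR.dvd_of_dvd_mul h' ⟨d, by rw [mul_comm d', h3, mul_comm]⟩
  have h6 := hR.antisymm h4 h5
  subst h6
  have h7 := mul_right_cancel h1
  subst h7
  exact ⟨rfl, rfl, mul_left_cancel h2⟩

lemma HasCoprimeParts.bijective_mul (hR : HasCoprimeParts M R) :
    Function.Bijective fun z : M × ((M × M) × {p : M × M // R p.1 p.2}) =>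
      (((z.2.1.1, z.1 * z.2.2.1.1), (z.2.1.2, z.1 * z.2.2.1.2)) : (M × M) × (M × M)) := by
  constructor
  · rintro ⟨g, ⟨a, b⟩, ⟨⟨c, d⟩, h⟩⟩ ⟨g', ⟨a', b'⟩, ⟨⟨c', d'⟩, h'⟩⟩ heq
    simp only [Prod.mk.injEq] at heq
    obtain ⟨⟨rfl, h1⟩, rfl, h2⟩ := heq
    obtain ⟨rfl, rfl, rfl⟩ := hR.unique h h' h1 h2
    rfl
  · rintro ⟨⟨a, c⟩, ⟨b, d⟩⟩
    obtain ⟨g, c', d', rfl, rfl, h⟩ := hR.exists_parts c d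
    exact ⟨⟨g, ⟨a, b⟩, ⟨⟨c', d'⟩, h⟩⟩, rfl⟩

lemma HasCoprimeParts.bijective_equalProducts (hR : HasCoprimeParts M R) :
    Function.Bijective fun z : (M × M) × {p : M × M // R p.1 p.2} =>
      (⟨((z.1.1 * z.2.1.2, z.2.1.1 * z.1.2), (z.1.1 * z.2.1.1, z.2.1.2 * z.1.2)), by
        dsimp only; ac_rfl⟩ : {q : (M × M) × (M × M) // q.1.1 * q.1.2 = q.2.1 * q.2.2}) := by
  constructor
  · rintro ⟨⟨a, b⟩, ⟨⟨c, d⟩, h⟩⟩ ⟨⟨a', b'⟩, ⟨⟨c', d'⟩, h'⟩⟩ heq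
    simp only [Subtype.mk.injEq, Prod.mk.injEq] at heq h h'
    obtain ⟨⟨h1, h2⟩, h3, h4⟩ := heq
    obtain ⟨rfl, rfl, rfl⟩ := hR.unique h h' h3 h1
    obtain rfl := mul_left_cancel h2
    rfl
  · rintro ⟨⟨⟨b1, c1⟩, ⟨b2, c2⟩⟩, h⟩
    obtain ⟨a, c, d, rfl, rfl, hcd⟩ := hR.exists_parts b2 b1
    simp only at h
    have h1 : d * c1 = c * c2 := by
      rw [mul_assoc, mul_assoc] at h
      exact mul_left_cancel h
    obtain ⟨e, rfl⟩ := hR.dvd_of_dvd_mul hcd ⟨c2, h1⟩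
    obtain rfl : c2 = d * e := by
      refine mul_left_cancel (a := c) ?_
      rw [← h1]; ac_rfl
    exact ⟨⟨⟨a, e⟩, ⟨⟨c, d⟩, hcd⟩⟩, rfl⟩

/-- The coefficients of `|ζ(s) L(s, φ)|²` are nonnegative, and at least one on squares. -/
lemma tsum_sq_le_re_smoothSum (hR : HasCoprimeParts M R) {ℓ : M → ℝ} (hℓ : IsSize ℓ)
    (hmul : ∀ a b, ℓ (a * b) = ℓ a + ℓ b) (φ : M →* ℂ) (hφ : ∀ a, ‖φ a‖ = 1)
    {V : ℝ → ℝ} (hV : ∀ z, 0 ≤ V z) (hVc : HasCompactSupport V) (t : ℝ) :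
    ∑' g, V (2 * ℓ g - t) ≤ (smoothSum
      (fun p : (M × M) × (M × M) => (ℓ p.1.1 + ℓ p.1.2) + (ℓ p.2.1 + ℓ p.2.2))
      (fun p => ((1 : ℂ) * φ p.1.2) * conj ((1 : ℂ) * φ p.2.2)) V t).re := by
  obtain ⟨A, hA0, hA⟩ := exists_support_subset_Icc hVc
  have hsize := (hℓ.prod hℓ).prod (hℓ.prod hℓ)
  have hunit : ∀ a, φ a * conj (φ a) = 1 := fun a => by
    rw [Complex.mul_conj, Complex.normSq_eq_norm_sq, hφ]; simp
  have hVX : ∀ z : ℝ, A < z → V z = 0 := fun z hz => by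
    by_contra h
    linarith [(hA _ h).2]
  have hone : ℓ 1 = 0 := by
    have := hmul 1 1
    rw [mul_one] at this
    linarith
  set G : (M × M) × (M × M) → ℂ := fun p => ((1 : ℂ) * φ p.1.2) * conj ((1 : ℂ) * φ p.2.2) *
    (V ((ℓ p.1.1 + ℓ p.1.2) + (ℓ p.2.1 + ℓ p.2.2) - t) : ℂ) with hG
  have hGs : Summable G := by
    refine summable_of_ne_finset_zero (s := (hsize.finite (t + A)).toFinset) fun p hp => ?_
    rw [Set.Finite.mem_toFinset, Set.mem_ofPred_eq, not_le] at hp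
    simp only [hG]
    rw [hVX _ (by linarith), Complex.ofReal_zero, mul_zero]
  let e₁ := Equiv.ofBijective _ hR.bijective_mul
  let e₂ := Equiv.ofBijective _ hR.bijective_equalProducts
  let F : M → {q : (M × M) × (M × M) // q.1.1 * q.1.2 = q.2.1 * q.2.2} → ℂ := fun g q =>
    φ q.1.1.2 * conj (φ q.1.2.2) * (V (ℓ q.1.1.1 + ℓ q.1.1.2 + 2 * ℓ g - t) : ℂ)
  have hGe : ∀ z, G (e₁ z) = F z.1 (e₂ z.2) := by
    rintro ⟨g, ⟨a, b⟩, ⟨⟨c, d⟩, h⟩⟩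
    simp only [hG, e₁, e₂, F, Equiv.ofBijective_apply, map_mul, one_mul, hmul]
    rw [show ℓ a + (ℓ g + ℓ c) + (ℓ b + (ℓ g + ℓ d)) - t =
      ℓ a + ℓ d + (ℓ c + ℓ b) + 2 * ℓ g - t by ring]
    have h1 := hunit g
    have h2 := hunit b
    congr 1
    calc φ g * φ c * (conj (φ g) * conj (φ d)) = (φ g * conj (φ g)) * (φ c * conj (φ d)) := by ring
      _ = (φ b * conj (φ b)) * (φ c * conj (φ d)) := by rw [h1, h2]
      _ = _ := by ring
  have hsum2 : Summable fun z => G (e₁ z) := hGs.comp_injective e₁.injective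
  have htot : smoothSum (fun p : (M × M) × (M × M) => (ℓ p.1.1 + ℓ p.1.2) + (ℓ p.2.1 + ℓ p.2.2))
      (fun p => ((1 : ℂ) * φ p.1.2) * conj ((1 : ℂ) * φ p.2.2)) V t = ∑' g, ∑' q, F g q := by
    rw [smoothSum]
    change ∑' p, G p = _
    rw [← e₁.tsum_eq, hsum2.tsum_prod]
    refine tsum_congr fun g => ?_
    rw [← e₂.tsum_eq]
    exact tsum_congr fun z => hGe (g, z)
  have hFsum : Summable fun g => ∑' q, F g q := by
    have := hsum2.prod
    refine this.congr fun g => ?_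
    rw [← e₂.tsum_eq]
    exact tsum_congr fun z => hGe (g, z)
  rw [htot, Complex.re_tsum hFsum]
  refine Summable.tsum_le_tsum (fun g => ?_) ?_ (Complex.hasSum_re hFsum.hasSum).summable
  · set X := max (t + A) 0 with hX
    set S := ((hℓ.prod hℓ).finite X).toFinset with hS
    have h1 : ∑' q, F g q = ∑ p ∈ S, ∑ p' ∈ S, if p.1 * p.2 = p'.1 * p'.2 then
        φ p.2 * conj (φ p'.2) * (V (ℓ (p.1 * p.2) + 2 * ℓ g - t) : ℂ) else 0 := by
      rw [← Finset.sum_product', ← Finset.sum_filter]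
      rw [tsum_eq_sum (s := Finset.subtype _ (S ×ˢ S))]
      · rw [Finset.sum_subtype_eq_sum_filter (f := fun p : (M × M) × (M × M) =>
          φ p.1.2 * conj (φ p.2.2) * (V (ℓ p.1.1 + ℓ p.1.2 + 2 * ℓ g - t) : ℂ))]
        simp only [hmul]
      · rintro ⟨q, hq⟩ hqS
        simp only [F]
        rw [hVX, Complex.ofReal_zero, mul_zero]
        by_contra! hle
        apply hqS
        have hg := hℓ.nonneg g
        have hq' : ℓ q.1.1 + ℓ q.1.2 = ℓ q.2.1 + ℓ q.2.2 := by rw [← hmul, hq, hmul]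
        have hXX : t + A ≤ X := le_max_left _ _
        rw [Finset.mem_subtype, Finset.mem_product, hS, Set.Finite.mem_toFinset,
          Set.Finite.mem_toFinset]
        exact ⟨by simp only [Set.mem_ofPred_eq]; linarith,
          by simp only [Set.mem_ofPred_eq]; linarith⟩
    rw [h1]
    have h2 := le_re_sum_fiber S (fun p : M × M => p.1 * p.2) (fun p => φ p.2)
      (fun a => V (ℓ a + 2 * ℓ g - t)) (fun _ => hV _) (p₀ := (1, 1))
      (by rw [hS, Set.Finite.mem_toFinset]; simp [hone, hX])
      (fun p _ h => by
        simp only [mul_one] at h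
        have h3 : p.1 = 1 := hR.antisymm ⟨p.2, h.symm⟩ (one_dvd _)
        have h4 : p.2 = 1 := by rwa [h3, one_mul] at h
        exact Prod.ext h3 h4) (hφ 1)
    simpa [hone] using h2
  · refine summable_of_ne_finset_zero (s := (hℓ.finite ((t + A) / 2)).toFinset) fun g hg => ?_
    rw [Set.Finite.mem_toFinset, Set.mem_ofPred_eq, not_le] at hg
    exact hVX _ (by linarith)

end Positivity

/-! ### Nonvanishing at the edge of absolute convergence -/

section Nonvanishing

open scoped ComplexConjugate Convolution

lemma integrable_mul_exp_neg {a : ℝ → ℂ} {A C : ℝ} (ha : Continuous a)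
    (hC : ∀ u, ‖a u‖ ≤ C * Real.exp (u / 2)) (hA : ∀ u < -A, a u = 0) :
    Integrable fun u => a u * (Real.exp (-u) : ℂ) := by
  have h1 : (fun u => a u * (Real.exp (-u) : ℂ)) =
      (Set.Ici (-A)).indicator fun u => a u * (Real.exp (-u) : ℂ) := by
    ext u
    by_cases h : u ∈ Set.Ici (-A)
    · rw [Set.indicator_of_mem h]
    · rw [Set.indicator_of_notMem h, hA u (by simpa using h), zero_mul]
  rw [h1, integrable_indicator_iff measurableSet_Ici, integrableOn_Ici_iff_integrableOn_Ioi]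
  refine Integrable.mono' (g := fun u => C * Real.exp (-(1 / 2) * u))
    ((exp_neg_integrableOn_Ioi (-A) (by norm_num : (0 : ℝ) < 1 / 2)).const_mul C)
    (by fun_prop) (Filter.Eventually.of_forall fun u => ?_)
  rw [norm_mul, Complex.norm_real, Real.norm_eq_abs, abs_of_pos (Real.exp_pos _)]
  calc ‖a u‖ * Real.exp (-u) ≤ C * Real.exp (u / 2) * Real.exp (-u) := by
        gcongr; exact hC u
    _ = C * Real.exp (-(1 / 2) * u) := by rw [mul_assoc, ← Real.exp_add]; ring_nf

lemma bound_mul_exp_half {a : ℝ → ℂ} {A C : ℝ} (hA0 : 0 ≤ A) (hC : ∀ u, ‖a u‖ ≤ C * (1 + |u|))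
    (hA : ∀ u < -A, a u = 0) (u : ℝ) :
    ‖a u‖ ≤ (C * (2 * (1 + A) * Real.exp (A / 2))) * Real.exp (u / 2) := by
  have hC0 : 0 ≤ C := by
    have := (norm_nonneg _).trans (hC 0)
    simpa using this
  by_cases h : u < -A
  · rw [hA u h, norm_zero]; positivity
  push Not at h
  refine (hC u).trans ?_
  rw [mul_assoc, mul_assoc (2 * (1 + A)), ← Real.exp_add]
  gcongr
  have h1 : A / 2 + u / 2 + 1 ≤ Real.exp (A / 2 + u / 2) := Real.add_one_le_exp _
  have h2 : |u| ≤ u + 2 * A := by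
    rw [abs_le]; constructor <;> linarith
  nlinarith

lemma norm_setIntegral_Ioi_mul_exp_neg_le {a : ℝ → ℂ} {C : ℝ} (hC : ∀ u, ‖a u‖ ≤ C) (y : ℝ) :
    ‖∫ u in Set.Ioi y, a u * (Real.exp (-u) : ℂ)‖ ≤ C * Real.exp (-y) := by
  rw [← integral_exp_neg_Ioi y, ← integral_const_mul]
  refine norm_integral_le_of_norm_le ?_ (Filter.Eventually.of_forall fun u => ?_)
  · have := exp_neg_integrableOn_Ioi y (by norm_num : (0 : ℝ) < 1)
    simp only [neg_mul, one_mul] at this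
    exact Integrable.const_mul this C
  · rw [norm_mul, Complex.norm_real, Real.norm_eq_abs, abs_of_pos (Real.exp_pos _)]
    gcongr
    exact hC u

/-- If `a` has a vanishing Laplace transform at `1` then its convolution with `κ exp + O(1)`
grows at most linearly. -/
lemma norm_integral_mul_comp_sub_le {a b : ℝ → ℂ} {A B C D κ : ℝ}
    (ha : Continuous a) (hb : Continuous b)
    (hA0 : 0 ≤ A) (hB0 : 0 ≤ B) (hC : ∀ u, ‖a u‖ ≤ C) (hA : ∀ u < -A, a u = 0)
    (hD : ∀ u, ‖b u - (κ * Real.exp u : ℝ)‖ ≤ D) (hB : ∀ u < -B, b u = 0)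
    (hzero : ∫ u, a u * (Real.exp (-u) : ℂ) = 0) (t : ℝ) :
    ‖∫ τ, b τ * a (t - τ)‖ ≤ (|κ| * C + D * C * (1 + A + B)) * (1 + |t|) := by
  have hC0 : 0 ≤ C := (norm_nonneg _).trans (hC 0)
  have hD0 : 0 ≤ D := (norm_nonneg _).trans (hD 0)
  have h0 : ∫ τ, b τ * a (t - τ) = ∫ u, b (t - u) * a u := by
    rw [← integral_sub_left_eq_self _ volume t]
    simp
  rw [h0]
  by_cases ht : t + B < -A
  · have : ∀ u, b (t - u) * a u = 0 := fun u => by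
      by_cases hu : u < -A
      · rw [hA u hu, mul_zero]
      · rw [hB (t - u) (by linarith), zero_mul]
    simp only [this, integral_zero, norm_zero]
    positivity
  push Not at ht
  have hInt := integrable_mul_exp_neg (A := A) (C := C * (2 * (1 + A) * Real.exp (A / 2))) ha
    (bound_mul_exp_half hA0 (fun u => (hC u).trans (le_mul_of_one_le_right hC0
      (by linarith [abs_nonneg u]))) hA) hA
  have h1 : ∫ u, b (t - u) * a u = ∫ u in Set.Iic (t + B), b (t - u) * a u := by
    symm
    refine setIntegral_eq_integral_of_forall_compl_eq_zero fun u hu => ?_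
    rw [hB (t - u) (by simp only [Set.mem_Iic, not_le] at hu; linarith), zero_mul]
  have h2 : ∀ u, b (t - u) * a u = ((κ * Real.exp t : ℝ) : ℂ) * (a u * (Real.exp (-u) : ℂ)) +
      (b (t - u) - (κ * Real.exp (t - u) : ℝ)) * a u := fun u => by
    rw [sub_eq_add_neg t u, Real.exp_add]
    push_cast
    ring
  have h3 : IntegrableOn (fun u => (b (t - u) - (κ * Real.exp (t - u) : ℝ)) * a u)
      (Set.Iic (t + B)) := by
    have hcont : Continuous fun u => (b (t - u) - (κ * Real.exp (t - u) : ℝ)) * a u := by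
      fun_prop
    have : IntegrableOn (fun u => (b (t - u) - (κ * Real.exp (t - u) : ℝ)) * a u)
      (Set.Icc (-A) (t + B)) := hcont.continuousOn.integrableOn_Icc
    refine this.of_forall_sdiff_eq_zero measurableSet_Iic fun u hu => ?_
    rw [hA u, mul_zero]
    have := hu.2
    simp only [Set.mem_Icc, not_and, not_le] at this
    by_contra! h
    exact absurd hu.1 (not_le.mpr (this h))
  rw [h1, integral_congr_ae (Filter.Eventually.of_forall h2),
    integral_add (hInt.integrableOn.const_mul _) h3, integral_const_mul]
  have h4 : ∫ u in Set.Iic (t + B), a u * (Real.exp (-u) : ℂ) =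
      -∫ u in Set.Ioi (t + B), a u * (Real.exp (-u) : ℂ) := by
    have := integral_add_compl (s := Set.Iic (t + B)) measurableSet_Iic hInt
    rw [hzero, Set.compl_Iic] at this
    exact eq_neg_of_add_eq_zero_left this
  have h5 : ‖((κ * Real.exp t : ℝ) : ℂ) * ∫ u in Set.Iic (t + B), a u * (Real.exp (-u) : ℂ)‖ ≤
      |κ| * C := by
    rw [h4, norm_mul, norm_neg, Complex.norm_real, Real.norm_eq_abs, abs_mul,
      abs_of_pos (Real.exp_pos t)]
    calc _ ≤ |κ| * Real.exp t * (C * Real.exp (-(t + B))) := by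
          gcongr; exact norm_setIntegral_Ioi_mul_exp_neg_le hC _
      _ = |κ| * C * Real.exp (-B) := by
          rw [show -(t + B) = -t + -B by ring, Real.exp_add, Real.exp_neg t]
          field_simp
      _ ≤ |κ| * C * 1 := by gcongr; simpa using hB0
      _ = _ := mul_one _
  have h6 : ‖∫ u in Set.Iic (t + B), (b (t - u) - (κ * Real.exp (t - u) : ℝ)) * a u‖ ≤
      D * C * (t + B + A) := by
    have h7 : ∫ u in Set.Iic (t + B), (b (t - u) - (κ * Real.exp (t - u) : ℝ)) * a u =
        ∫ u in Set.Icc (-A) (t + B), (b (t - u) - (κ * Real.exp (t - u) : ℝ)) * a u := by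
      refine setIntegral_eq_of_subset_of_forall_sdiff_eq_zero measurableSet_Iic
        Set.Icc_subset_Iic_self fun u hu => ?_
      rw [hA u, mul_zero]
      have := hu.2
      simp only [Set.mem_Icc, not_and, not_le] at this
      by_contra! h
      exact absurd hu.1 (not_le.mpr (this h))
    rw [h7]
    refine (norm_setIntegral_le_of_norm_le_const (C := D * C) (by simp) fun u _ => ?_).trans ?_
    · rw [norm_mul]; exact mul_le_mul (hD _) (hC _) (norm_nonneg _) hD0
    · rw [Real.volume_real_Icc_of_le ht, sub_neg_eq_add]
  refine (norm_add_le _ _).trans ((add_le_add h5 h6).trans ?_)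
  have h8 : t + B + A ≤ (1 + A + B) * (1 + |t|) := by
    nlinarith [abs_nonneg t, le_abs_self t, mul_nonneg hA0 (abs_nonneg t),
      mul_nonneg hB0 (abs_nonneg t)]
  have h9 : |κ| * C ≤ |κ| * C * (1 + |t|) :=
    le_mul_of_one_le_right (by positivity) (by linarith [abs_nonneg t])
  nlinarith [mul_le_mul_of_nonneg_left h8 (mul_nonneg hD0 hC0)]

/-- A convolution of two functions of linear growth has at most cubic growth. -/
lemma norm_integral_mul_comp_sub_le_cube {a b : ℝ → ℂ} {A C : ℝ} (hA0 : 0 ≤ A)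
    (ha : ∀ u, ‖a u‖ ≤ C * (1 + |u|)) (hb : ∀ u, ‖b u‖ ≤ C * (1 + |u|))
    (hA : ∀ u < -A, a u = 0) (hB : ∀ u < -A, b u = 0) {t : ℝ} (ht : 0 ≤ t) :
    ‖∫ τ, a τ * b (t - τ)‖ ≤ C ^ 2 * (1 + 2 * A + t) ^ 3 := by
  have hC0 : 0 ≤ C := by simpa using (norm_nonneg _).trans (ha 0)
  have h1 : ∫ τ, a τ * b (t - τ) = ∫ τ in Set.Icc (-A) (t + A), a τ * b (t - τ) := by
    symm
    refine setIntegral_eq_integral_of_forall_compl_eq_zero fun u hu => ?_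
    by_cases h : u < -A
    · rw [hA u h, zero_mul]
    · rw [hB (t - u), mul_zero]
      by_contra! h'
      exact hu ⟨by linarith, by linarith⟩
  rw [h1]
  refine (norm_setIntegral_le_of_norm_le_const (C := C ^ 2 * (1 + A + t) ^ 2) (by simp)
    fun u hu => ?_).trans ?_
  · rw [norm_mul]
    have h2 : ∀ s, s ∈ Set.Icc (-A) (t + A) → 1 + |s| ≤ 1 + A + t := fun s hs => by
      have : |s| ≤ A + t := abs_le.mpr ⟨by linarith [hs.1], by linarith [hs.2]⟩
      linarith
    have h3 := (ha u).trans (mul_le_mul_of_nonneg_left (h2 u hu) hC0)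
    have h4 := (hb (t - u)).trans (mul_le_mul_of_nonneg_left
      (h2 (t - u) ⟨by linarith [hu.2], by linarith [hu.1]⟩) hC0)
    calc ‖a u‖ * ‖b (t - u)‖ ≤ (C * (1 + A + t)) * (C * (1 + A + t)) :=
          mul_le_mul h3 h4 (norm_nonneg _) (by positivity)
      _ = _ := by ring
  · rw [Real.volume_real_Icc_of_le (by linarith)]
    have : 1 + A + t ≤ 1 + 2 * A + t := by linarith
    calc C ^ 2 * (1 + A + t) ^ 2 * (t + A - -A) ≤
        C ^ 2 * (1 + 2 * A + t) ^ 2 * (1 + 2 * A + t) :=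
          mul_le_mul (by gcongr) (by linarith) (by linarith) (by positivity)
      _ = _ := by ring

variable {M : Type*} [CancelCommMonoid M] {R : M → M → Prop}

/-- Abstract form of the nonvanishing of `L(1, φ)`. -/
theorem laplace_smoothSum_ne_zero (hR : HasCoprimeParts M R) {ℓ : M → ℝ} (hℓ : IsSize ℓ)
    (hmul : ∀ a b, ℓ (a * b) = ℓ a + ℓ b) (φ : M →* ℂ) (hφ : ∀ a, ‖φ a‖ = 1)
    (hone : ∀ w : ℝ → ℝ, ContDiff ℝ ∞ w → HasCompactSupport w →
      ∃ κ C : ℝ, ((∀ x, 0 ≤ w x) → (∃ x, w x ≠ 0) → 0 < κ) ∧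
        ∀ τ, ‖smoothSum ℓ 1 w τ - (κ * Real.exp τ : ℝ)‖ ≤ C)
    (hbdd : ∀ w : ℝ → ℝ, ContDiff ℝ ∞ w → HasCompactSupport w →
      ∃ C : ℝ, ∀ τ, ‖smoothSum ℓ φ w τ‖ ≤ C)
    {w : ℝ → ℝ} (hw : ContDiff ℝ ∞ w) (hwc : HasCompactSupport w) (hw0 : ∀ x, 0 ≤ w x)
    (hwne : ∃ x, w x ≠ 0) :
    ∫ u, smoothSum ℓ φ w u * (Real.exp (-u) : ℂ) ≠ 0 := by
  intro hzero
  obtain ⟨A, hA0, hA⟩ := exists_support_subset_Icc hwc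
  obtain ⟨κ, D, -, hD⟩ := hone w hw hwc
  obtain ⟨C, hC⟩ := hbdd w hw hwc
  set L := ContinuousLinearMap.lsmul ℝ ℝ (E := ℝ)
  set v := w ⋆[L] w with hv
  have hconv : ∀ {p : ℝ → ℝ}, ContDiff ℝ ∞ p → HasCompactSupport p → (∀ x, 0 ≤ p x) →
      (∃ x, p x ≠ 0) → ContDiff ℝ ∞ (p ⋆[L] p) ∧ HasCompactSupport (p ⋆[L] p) ∧
        (∀ x, 0 ≤ (p ⋆[L] p) x) ∧ ∃ x, (p ⋆[L] p) x ≠ 0 := by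
    intro p hp hpc hp0 hpne
    refine ⟨hpc.contDiff_convolution_right _ hp.continuous.locallyIntegrable hp,
      hpc.convolution _ hpc, fun x => integral_nonneg fun t => mul_nonneg (hp0 _) (hp0 _), ?_⟩
    obtain ⟨x, hx⟩ := hpne
    refine ⟨x + x, ne_of_gt ?_⟩
    rw [convolution_apply_sub]
    have hcont := hp.continuous
    refine Continuous.integral_pos_of_hasCompactSupport_nonneg_nonzero (x := 0)
      (by fun_prop) ?_ (fun τ => mul_nonneg (hp0 _) (hp0 _)) (by simpa using hx)
    obtain ⟨A, hA0, hA⟩ := exists_support_subset_Icc hpc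
    refine HasCompactSupport.of_support_subset_isCompact
        (isCompact_Icc (a := x - A) (b := x + A)) fun τ hτ => ?_
    have := hA _ (left_ne_zero_of_mul hτ)
    exact ⟨by linarith [this.2], by linarith [this.1]⟩
  obtain ⟨hvd, hvc, hv0, hvne⟩ := hconv hw hwc hw0 hwne
  obtain ⟨hVd, hVc, hV0, hVne⟩ := hconv hvd hvc hv0 hvne
  set V := v ⋆[L] v with hV
  obtain ⟨A', hA'0, hA'⟩ := exists_support_subset_Icc hvc
  set E := smoothSum (fun p : M × M => ℓ p.1 + ℓ p.2) (fun p => (1 : ℂ) * φ p.2) v with hE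
  set D' := |κ| * C + D * C * (1 + A + A) with hD'
  have hEb : ∀ t, ‖E t‖ ≤ D' * (1 + |t|) := fun t => by
    have h1 := integral_smoothSum_mul_smoothSum (f := (1 : M → ℂ)) (g := φ) hℓ hℓ hw.continuous hwc
      hw.continuous hwc t
    have h2 := norm_integral_mul_comp_sub_le
      (continuous_smoothSum (f := φ) hℓ hw.continuous hwc)
      (continuous_smoothSum (f := (1 : M → ℂ)) hℓ hw.continuous hwc) hA0.le hA0.le hC
      (fun u hu => smoothSum_eq_zero hℓ hA hu) hD (fun u hu => smoothSum_eq_zero hℓ hA hu) hzero t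
    rw [h1] at h2
    exact h2
  have hE0 : ∀ t < -A', E t = 0 := fun t ht => smoothSum_eq_zero (hℓ.prod hℓ) hA' ht
  have hEconj : ∀ t, conj (E t) =
      smoothSum (fun p : M × M => ℓ p.1 + ℓ p.2) (fun p => conj ((1 : ℂ) * φ p.2)) v t := by
    intro t
    rw [hE, smoothSum, Complex.conj_tsum, smoothSum]
    refine tsum_congr fun p => ?_
    rw [map_mul, Complex.conj_ofReal]
  obtain ⟨κ', C', hκ', hC'⟩ := hone (fun z => V (2 * z)) (hVd.comp (contDiff_const.mul contDiff_id))
    (hVc.comp_homeomorph (Homeomorph.mulLeft₀ 2 two_ne_zero))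
  have hκ'0 := hκ' (fun x => hV0 _) (by
    obtain ⟨x, hx⟩ := hVne
    exact ⟨x / 2, by simpa [mul_div_cancel₀] using hx⟩)
  have hmain : ∀ t, 0 ≤ t → κ' * Real.exp (t / 2) - C' ≤ D' ^ 2 * (1 + 2 * A' + t) ^ 3 := by
    intro t ht
    have h1 := norm_integral_mul_comp_sub_le_cube hA'0.le hEb
      (b := fun u => conj (E u)) (fun u => by rw [RCLike.norm_conj]; exact hEb u) hE0
      (fun u hu => by rw [hE0 u hu, map_zero]) ht
    simp only [hEconj] at h1
    rw [hE, integral_smoothSum_mul_smoothSum (hℓ.prod hℓ) (hℓ.prod hℓ) hvd.continuous hvc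
      hvd.continuous hvc] at h1
    have h2 := tsum_sq_le_re_smoothSum hR hℓ hmul φ hφ hV0 hVc t
    have h3 := (h2.trans (Complex.re_le_norm _)).trans h1
    refine le_trans ?_ h3
    have h4 := hC' (t / 2)
    have h5 : smoothSum ℓ 1 (fun z => V (2 * z)) (t / 2) =
        ((∑' g, V (2 * ℓ g - t) : ℝ) : ℂ) := by
      rw [smoothSum, Complex.ofReal_tsum]
      refine tsum_congr fun g => ?_
      rw [Pi.one_apply, one_mul, mul_sub, mul_div_cancel₀ _ two_ne_zero]
    rw [h5, ← Complex.ofReal_sub, Complex.norm_real, Real.norm_eq_abs] at h4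
    linarith [(abs_le.mp h4).1]
  have hlim : Filter.Tendsto (fun t : ℝ => (D' ^ 2 * (1 + 2 * A' + t) ^ 3 + C') *
      Real.exp (-(t / 2))) Filter.atTop (nhds 0) := by
    have h1 : ∀ n : ℕ, Filter.Tendsto (fun t : ℝ => t ^ n * Real.exp (-(1 / 2) * t)) Filter.atTop
        (nhds 0) := fun n => by
      have := tendsto_rpow_mul_exp_neg_mul_atTop_nhds_zero (n : ℝ) (1 / 2) (by norm_num)
      simpa using this
    have h2 := ((((h1 3).const_mul (D' ^ 2)).add
      ((h1 2).const_mul (3 * (1 + 2 * A') * D' ^ 2))).add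
      ((h1 1).const_mul (3 * (1 + 2 * A') ^ 2 * D' ^ 2))).add
      ((h1 0).const_mul ((1 + 2 * A') ^ 3 * D' ^ 2 + C'))
    simp only [mul_zero, add_zero] at h2
    refine h2.congr fun t => ?_
    rw [show -(1 / 2) * t = -(t / 2) by ring]
    ring
  have hev := (hlim.eventually (gt_mem_nhds hκ'0)).and (Filter.eventually_ge_atTop 0)
  obtain ⟨t, ht1, ht2⟩ := hev.exists
  have h1 := hmain t ht2
  have h2 : (κ' * Real.exp (t / 2)) * Real.exp (-(t / 2)) ≤
      (D' ^ 2 * (1 + 2 * A' + t) ^ 3 + C') * Real.exp (-(t / 2)) := by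
    gcongr
    linarith
  rw [mul_assoc, ← Real.exp_add, add_neg_cancel, Real.exp_zero, mul_one] at h2
  linarith

end Nonvanishing

/-! ### Mertens estimates -/

section Mertens

variable {M Q : Type*} [CommMonoid M] {ℓ : M → ℝ} {q : Q → M} {Λ : Q → ℝ} {φ : M →* ℂ}
  {w : ℝ → ℝ} {A : ℝ}

/-- `Λ` is a von Mangoldt function for `ℓ`, on the elements `q i`. -/
def IsVonMangoldt (ℓ : M → ℝ) (q : Q → M) (Λ : Q → ℝ) : Prop :=
  ∀ F : M → ℂ, F.support.Finite →
    ∑' a, (ℓ a : ℂ) * F a = ∑' p : Q × M, (Λ p.1 : ℂ) * F (q p.1 * p.2)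

lemma smoothSum_log_eq_sum (hℓ : IsSize ℓ) (hmul : ∀ a b, ℓ (a * b) = ℓ a + ℓ b)
    (hq : IsSize fun i => ℓ (q i)) (hΛ : IsVonMangoldt ℓ q Λ)
    (hA : ∀ z, w z ≠ 0 → z ∈ Set.Icc (-A) A) {τ X : ℝ} (hX : τ + A ≤ X) :
    smoothSum ℓ φ (fun z => z * w z) τ + τ * smoothSum ℓ φ w τ =
      ∑ i ∈ (hq.finite X).toFinset, (Λ i : ℂ) * φ (q i) * smoothSum ℓ φ w (τ - ℓ (q i)) := by
  have hVX : ∀ z : ℝ, A < z → w z = 0 := fun z hz => by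
    by_contra h
    linarith [(hA _ h).2]
  have hfin : ∀ a ∉ (hℓ.finite X).toFinset, w (ℓ a - τ) = 0 := fun a ha => by
    rw [Set.Finite.mem_toFinset, Set.mem_ofPred_eq, not_le] at ha
    exact hVX _ (by linarith)
  have h1 : smoothSum ℓ φ (fun z => z * w z) τ + τ * smoothSum ℓ φ w τ =
      ∑' a, (ℓ a : ℂ) * (φ a * (w (ℓ a - τ) : ℂ)) := by
    rw [smoothSum, smoothSum, ← tsum_mul_left, ← Summable.tsum_add]
    · refine tsum_congr fun a => ?_
      push_cast
      ring
    · exact summable_of_ne_finset_zero (s := (hℓ.finite X).toFinset) fun a ha => by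
        simp [hfin a ha]
    · exact summable_of_ne_finset_zero (s := (hℓ.finite X).toFinset) fun a ha => by
        simp [hfin a ha]
  have h2 : (Function.support fun a => φ a * (w (ℓ a - τ) : ℂ)).Finite := by
    refine (hℓ.finite X).subset fun a ha => ?_
    by_contra h
    exact ha (by simp [hfin a (by simpa using h)])
  have h3 : Summable fun p : Q × M => (Λ p.1 : ℂ) *
      (φ (q p.1 * p.2) * (w (ℓ (q p.1 * p.2) - τ) : ℂ)) := by
    refine summable_of_ne_finset_zero (s := ((hq.prod hℓ).finite X).toFinset) fun p hp => ?_
    rw [Set.Finite.mem_toFinset, Set.mem_ofPred_eq, not_le] at hp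
    rw [hmul, hVX _ (by linarith)]
    simp
  rw [h1, hΛ _ h2, h3.tsum_prod]
  have h4 : ∀ i, ∑' c, (Λ i : ℂ) * (φ (q i * c) * (w (ℓ (q i * c) - τ) : ℂ)) =
      (Λ i : ℂ) * φ (q i) * smoothSum ℓ φ w (τ - ℓ (q i)) := fun i => by
    rw [smoothSum, ← tsum_mul_left]
    refine tsum_congr fun c => ?_
    rw [hmul, map_mul, show ℓ (q i) + ℓ c - τ = ℓ c - (τ - ℓ (q i)) by ring]
    ring
  simp only [h4]
  refine tsum_eq_sum fun i hi => ?_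
  rw [Set.Finite.mem_toFinset, Set.mem_ofPred_eq, not_le] at hi
  rw [smoothSum_eq_zero hℓ hA (by linarith), mul_zero]

lemma abs_mul_exp_neg_le (hA0 : 0 ≤ A) {τ : ℝ} (hτ : -A ≤ τ) :
    |τ| * Real.exp (-τ) ≤ (1 + A) * Real.exp A := by
  have h1 : Real.exp (-τ) ≤ Real.exp A := Real.exp_le_exp.mpr (by linarith)
  have h3 : 1 ≤ Real.exp A := Real.one_le_exp hA0
  rcases le_or_gt 0 τ with h | h
  · rw [abs_of_nonneg h]
    have h2 : τ + 1 ≤ Real.exp τ := Real.add_one_le_exp τ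
    have h4 : τ * Real.exp (-τ) ≤ 1 := by
      rw [Real.exp_neg, ← div_eq_mul_inv, div_le_one (Real.exp_pos _)]
      linarith
    nlinarith
  · have : |τ| ≤ 1 + A := abs_le.mpr ⟨by linarith, by linarith⟩
    exact mul_le_mul this h1 (Real.exp_pos _).le (by linarith)

/-- Mertens' estimate for the trivial character. -/
theorem exists_abs_sum_vonMangoldt_sub_le (hℓ : IsSize ℓ)
    (hmul : ∀ a b, ℓ (a * b) = ℓ a + ℓ b)
    (hq : IsSize fun i => ℓ (q i)) (hΛ : IsVonMangoldt ℓ q Λ) (hΛ0 : ∀ i, 0 ≤ Λ i)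
    {Cch : ℝ} (hch : ∀ X, ∑ i ∈ (hq.finite X).toFinset, Λ i ≤ Cch * Real.exp X)
    (hone : ∀ w : ℝ → ℝ, ContDiff ℝ ∞ w → HasCompactSupport w →
      ∃ κ C : ℝ, ((∀ x, 0 ≤ w x) → (∃ x, w x ≠ 0) → 0 < κ) ∧
        ∀ τ, ‖smoothSum ℓ 1 w τ - (κ * Real.exp τ : ℝ)‖ ≤ C)
    (hw : ContDiff ℝ ∞ w) (hwc : HasCompactSupport w) (hw0 : ∀ x, 0 ≤ w x)
    (hwne : ∃ x, w x ≠ 0) :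
    ∃ C, ∀ X, 0 ≤ X → |∑ i ∈ (hq.finite X).toFinset, Λ i * Real.exp (-ℓ (q i)) - X| ≤ C := by
  obtain ⟨A, hA0, hA⟩ := exists_support_subset_Icc hwc
  obtain ⟨κ, C₁, hκ, hC₁⟩ := hone w hw hwc
  have hκ0 := hκ hw0 hwne
  obtain ⟨κ', C₂, -, hC₂⟩ := hone (fun z => z * w z) (contDiff_id.mul hw) hwc.mul_left
  have hC₁0 : 0 ≤ C₁ := (norm_nonneg _).trans (hC₁ 0)
  have hC₂0 : 0 ≤ C₂ := (norm_nonneg _).trans (hC₂ 0)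
  refine ⟨(C₁ * Cch * Real.exp A + C₁ * ((1 + A) * Real.exp A) + |κ'| + C₂ * Real.exp A) / κ + A,
    fun X hX => ?_⟩
  obtain ⟨τ, rfl⟩ : ∃ τ, X = τ + A := ⟨X - A, by ring⟩
  set s := (hq.finite (τ + A)).toFinset
  have hid := smoothSum_log_eq_sum (φ := 1) hℓ hmul hq hΛ hA (le_refl (τ + A))
  rw [show ⇑(1 : M →* ℂ) = (1 : M → ℂ) from rfl] at hid
  simp only [Pi.one_apply, mul_one] at hid
  set S := ∑ i ∈ s, Λ i * Real.exp (-ℓ (q i)) with hS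
  have h1 : ((κ * Real.exp τ * (S - τ) : ℝ) : ℂ) =
      -(∑ i ∈ s, (Λ i : ℂ) * (smoothSum ℓ 1 w (τ - ℓ (q i)) -
        (κ * Real.exp (τ - ℓ (q i)) : ℝ))) +
      τ * (smoothSum ℓ 1 w τ - (κ * Real.exp τ : ℝ)) + (κ' * Real.exp τ : ℝ) +
      (smoothSum ℓ 1 (fun z => z * w z) τ - (κ' * Real.exp τ : ℝ)) := by
    have h2 : ∑ i ∈ s, (Λ i : ℂ) * ((κ * Real.exp (τ - ℓ (q i)) : ℝ) : ℂ) =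
        ((κ * Real.exp τ * S : ℝ) : ℂ) := by
      rw [hS, Finset.mul_sum, Complex.ofReal_sum]
      refine Finset.sum_congr rfl fun i _ => ?_
      rw [sub_eq_add_neg, Real.exp_add]
      push_cast
      ring
    simp only [mul_sub, Finset.sum_sub_distrib, h2]
    push_cast
    linear_combination -hid
  have h3 : κ * Real.exp τ * |S - τ| ≤ C₁ * (Cch * Real.exp (τ + A)) + |τ| * C₁ +
      |κ'| * Real.exp τ + C₂ := by
    have h4 : κ * Real.exp τ * |S - τ| = ‖((κ * Real.exp τ * (S - τ) : ℝ) : ℂ)‖ := by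
      rw [Complex.norm_real, Real.norm_eq_abs, abs_mul,
        abs_of_pos (mul_pos hκ0 (Real.exp_pos τ))]
    rw [h4, h1]
    refine (norm_add_le _ _).trans (add_le_add ((norm_add_le _ _).trans (add_le_add
      ((norm_add_le _ _).trans (add_le_add ?_ ?_)) ?_)) (hC₂ τ))
    · rw [norm_neg]
      refine (norm_sum_le _ _).trans ?_
      refine le_trans ?_ (mul_le_mul_of_nonneg_left (hch (τ + A)) hC₁0)
      rw [Finset.mul_sum]
      refine Finset.sum_le_sum fun i _ => ?_
      rw [norm_mul, Complex.norm_real, Real.norm_eq_abs, abs_of_nonneg (hΛ0 i), mul_comm]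
      exact mul_le_mul_of_nonneg_right (hC₁ _) (hΛ0 i)
    · rw [norm_mul, Complex.norm_real, Real.norm_eq_abs]
      exact mul_le_mul_of_nonneg_left (hC₁ _) (abs_nonneg _)
    · rw [Complex.norm_real, Real.norm_eq_abs, abs_mul, abs_of_pos (Real.exp_pos τ)]
  have h5 : |S - τ| ≤ (C₁ * Cch * Real.exp A + C₁ * ((1 + A) * Real.exp A) + |κ'| +
      C₂ * Real.exp A) / κ := by
    rw [le_div_iff₀ hκ0]
    have h6 := mul_le_mul_of_nonneg_right h3 (Real.exp_pos (-τ)).le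
    have h7 := abs_mul_exp_neg_le hA0.le (τ := τ) (by linarith)
    have h8 : Real.exp (-τ) ≤ Real.exp A := Real.exp_le_exp.mpr (by linarith)
    have h9 : Real.exp τ * Real.exp (-τ) = 1 := by rw [← Real.exp_add]; simp
    calc |S - τ| * κ = κ * Real.exp τ * |S - τ| * Real.exp (-τ) := by
          linear_combination (-κ * |S - τ|) * h9
      _ ≤ _ := h6
      _ = C₁ * Cch * Real.exp A + C₁ * (|τ| * Real.exp (-τ)) + |κ'| + C₂ * Real.exp (-τ) := by
          rw [Real.exp_add]
          linear_combination (C₁ * Cch * Real.exp A + |κ'|) * h9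
      _ ≤ _ := by gcongr
  rw [show S - (τ + A) = (S - τ) - A by ring]
  refine (abs_sub _ _).trans ?_
  rw [abs_of_pos hA0]
  linarith

lemma setIntegral_Iic_comp_sub {f : ℝ → ℂ} (η c : ℝ) :
    ∫ τ in Set.Iic η, f (τ - c) = ∫ τ in Set.Iic (η - c), f τ := by
  rw [← integral_indicator measurableSet_Iic, ← integral_indicator measurableSet_Iic,
    ← integral_sub_right_eq_self ((Set.Iic (η - c)).indicator f) c]
  refine integral_congr_ae (Filter.Eventually.of_forall fun τ => ?_)
  simp [Set.indicator]

/-- Mertens' estimate for a nontrivial character. -/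
theorem exists_norm_sum_vonMangoldt_mul_le (hℓ : IsSize ℓ)
    (hmul : ∀ a b, ℓ (a * b) = ℓ a + ℓ b)
    (hq : IsSize fun i => ℓ (q i)) (hΛ : IsVonMangoldt ℓ q Λ) (hΛ0 : ∀ i, 0 ≤ Λ i)
    {Cch : ℝ} (hch : ∀ X, ∑ i ∈ (hq.finite X).toFinset, Λ i ≤ Cch * Real.exp X)
    (hφ : ∀ a, ‖φ a‖ = 1)
    (hbdd : ∀ w : ℝ → ℝ, ContDiff ℝ ∞ w → HasCompactSupport w →
      ∃ C : ℝ, ∀ τ, ‖smoothSum ℓ φ w τ‖ ≤ C)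
    (hw : ContDiff ℝ ∞ w) (hwc : HasCompactSupport w)
    (hne : ∫ u, smoothSum ℓ φ w u * (Real.exp (-u) : ℂ) ≠ 0) :
    ∃ C, ∀ X, ‖∑ i ∈ (hq.finite X).toFinset,
      (Λ i : ℂ) * φ (q i) * (Real.exp (-ℓ (q i)) : ℂ)‖ ≤ C := by
  obtain ⟨A, hA0, hA⟩ := exists_support_subset_Icc hwc
  obtain ⟨C₁, hC₁⟩ := hbdd w hw hwc
  obtain ⟨C₂, hC₂⟩ := hbdd (fun z => z * w z) (contDiff_id.mul hw) hwc.mul_left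
  have hC₁0 : 0 ≤ C₁ := (norm_nonneg _).trans (hC₁ 0)
  have hC₂0 : 0 ≤ C₂ := (norm_nonneg _).trans (hC₂ 0)
  set a := smoothSum ℓ φ w with ha
  have hac : Continuous a := continuous_smoothSum hℓ hw.continuous hwc
  have ha0 : ∀ u < -A, a u = 0 := fun u hu => smoothSum_eq_zero hℓ hA hu
  have hInt : Integrable fun u => a u * (Real.exp (-u) : ℂ) := integrable_mul_exp_neg hac
    (bound_mul_exp_half hA0.le (C := C₁) (fun u => (hC₁ u).trans (le_mul_of_one_le_right hC₁0
      (by linarith [abs_nonneg u]))) ha0) ha0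
  set B : ℝ → ℂ := fun τ => smoothSum ℓ φ (fun z => z * w z) τ + τ * a τ with hB
  have hBc : Continuous B := by
    have := continuous_smoothSum (f := φ) hℓ (continuous_id.mul hw.continuous) hwc.mul_left
    exact this.add (Complex.continuous_ofReal.mul hac)
  have hB0 : ∀ u < -A, B u = 0 := fun u hu => by
    simp only [hB]
    rw [ha0 u hu, mul_zero, add_zero]
    exact smoothSum_eq_zero hℓ (fun z hz => hA z (right_ne_zero_of_mul hz)) hu
  have hBint : Integrable fun u => B u * (Real.exp (-u) : ℂ) := integrable_mul_exp_neg hBc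
    (bound_mul_exp_half hA0.le (C := C₁ + C₂) (fun u => by
      refine (norm_add_le _ _).trans ?_
      rw [norm_mul, Complex.norm_real, Real.norm_eq_abs]
      have h1 := hC₂ u
      have h2 := mul_le_mul_of_nonneg_left (hC₁ u) (abs_nonneg u)
      nlinarith [mul_nonneg hC₂0 (abs_nonneg u)]) hB0) hB0
  set L := ∫ u, a u * (Real.exp (-u) : ℂ) with hL
  set K := ∫ u, ‖B u * (Real.exp (-u) : ℂ)‖ with hK
  refine ⟨(K + C₁ * Cch * Real.exp A) / ‖L‖, fun X => ?_⟩
  obtain ⟨η, rfl⟩ : ∃ η, X = η + A := ⟨X - A, by ring⟩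
  set s := (hq.finite (η + A)).toFinset
  set S := ∑ i ∈ s, (Λ i : ℂ) * φ (q i) * (Real.exp (-ℓ (q i)) : ℂ) with hS
  have hshift : ∀ c τ : ℝ, a (τ - c) * (Real.exp (-τ) : ℂ) =
      (Real.exp (-c) : ℂ) * (a (τ - c) * (Real.exp (-(τ - c)) : ℂ)) := fun c τ => by
    rw [show -τ = -c + -(τ - c) by ring, Real.exp_add]
    push_cast
    ring
  have h1 : ∫ τ in Set.Iic η, B τ * (Real.exp (-τ) : ℂ) =
      ∑ i ∈ s, (Λ i : ℂ) * φ (q i) * ((Real.exp (-ℓ (q i)) : ℂ) *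
        ∫ u in Set.Iic (η - ℓ (q i)), a u * (Real.exp (-u) : ℂ)) := by
    have h2 : ∀ τ ∈ Set.Iic η, B τ * (Real.exp (-τ) : ℂ) = ∑ i ∈ s, (Λ i : ℂ) * φ (q i) *
        (a (τ - ℓ (q i)) * (Real.exp (-τ) : ℂ)) := fun τ hτ => by
      simp only [hB]
      rw [smoothSum_log_eq_sum hℓ hmul hq hΛ hA (X := η + A)
        (by simp only [Set.mem_Iic] at hτ; linarith), Finset.sum_mul]
      exact Finset.sum_congr rfl fun i _ => mul_assoc _ _ _
    rw [setIntegral_congr_fun measurableSet_Iic h2, integral_finsetSum]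
    · refine Finset.sum_congr rfl fun i _ => ?_
      rw [integral_const_mul]
      congr 1
      simp_rw [hshift]
      rw [integral_const_mul,
        setIntegral_Iic_comp_sub (f := fun u => a u * (Real.exp (-u) : ℂ))]
    · intro i _
      refine Integrable.const_mul ?_ _
      simp_rw [hshift]
      exact ((hInt.comp_sub_right (ℓ (q i))).const_mul _).integrableOn
  have h3 : ∀ y, ∫ u in Set.Iic y, a u * (Real.exp (-u) : ℂ) =
      L - ∫ u in Set.Ioi y, a u * (Real.exp (-u) : ℂ) := fun y => by
    have := integral_add_compl (s := Set.Iic y) measurableSet_Iic hInt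
    rw [Set.compl_Iic] at this
    exact eq_sub_of_add_eq this
  have h4 : L * S = (∫ τ in Set.Iic η, B τ * (Real.exp (-τ) : ℂ)) +
      ∑ i ∈ s, (Λ i : ℂ) * φ (q i) * ((Real.exp (-ℓ (q i)) : ℂ) *
        ∫ u in Set.Ioi (η - ℓ (q i)), a u * (Real.exp (-u) : ℂ)) := by
    rw [h1, hS, Finset.mul_sum, ← Finset.sum_add_distrib]
    refine Finset.sum_congr rfl fun i _ => ?_
    rw [h3]
    ring
  have h5 : ‖L * S‖ ≤ K + C₁ * Cch * Real.exp A := by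
    rw [h4]
    refine (norm_add_le _ _).trans (add_le_add ?_ ?_)
    · refine (norm_integral_le_integral_norm _).trans ?_
      exact setIntegral_le_integral hBint.norm (Filter.Eventually.of_forall fun u => norm_nonneg _)
    · refine (norm_sum_le _ _).trans ?_
      have h6 := mul_le_mul_of_nonneg_left (hch (η + A)) (mul_nonneg hC₁0 (Real.exp_pos (-η)).le)
      have h7 : C₁ * Real.exp (-η) * (Cch * Real.exp (η + A)) = C₁ * Cch * Real.exp A := by
        rw [Real.exp_add, Real.exp_neg]
        field_simp
      rw [h7, Finset.mul_sum] at h6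
      refine le_trans (Finset.sum_le_sum fun i _ => ?_) h6
      rw [norm_mul, norm_mul, hφ, norm_mul, Complex.norm_real, Complex.norm_real, Real.norm_eq_abs,
        Real.norm_eq_abs, abs_of_nonneg (hΛ0 i), abs_of_pos (Real.exp_pos _), mul_one,
        mul_comm (Λ i)]
      refine mul_le_mul_of_nonneg_right ?_ (hΛ0 i)
      calc Real.exp (-ℓ (q i)) * ‖∫ u in Set.Ioi (η - ℓ (q i)), a u * (Real.exp (-u) : ℂ)‖ ≤
          Real.exp (-ℓ (q i)) * (C₁ * Real.exp (-(η - ℓ (q i)))) := by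
            gcongr; exact norm_setIntegral_Ioi_mul_exp_neg_le hC₁ _
        _ = C₁ * Real.exp (-η) := by
            rw [mul_left_comm, ← Real.exp_add]; ring_nf
  rw [norm_mul] at h5
  rw [le_div_iff₀ (norm_pos_iff.mpr hne), mul_comm]
  exact h5

end Mertens

/-! ### Mertens estimates for prime ideals -/

section PrimeIdeals

open scoped Classical
open IsDedekindDomain UniqueFactorizationMonoid

variable {K : Type*} [Field K] [NumberField K]

variable (K) in
/-- The logarithm of the norm of a nonzero ideal. -/
noncomputable def logNorm (a : (Ideal (𝓞 K))⁰) : ℝ :=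
  Real.log (Ideal.absNorm (a : Ideal (𝓞 K)))

lemma one_le_absNorm (a : (Ideal (𝓞 K))⁰) : (1 : ℝ) ≤ Ideal.absNorm (a : Ideal (𝓞 K)) := by
  exact_mod_cast Nat.one_le_iff_ne_zero.mpr (Ideal.absNorm_ne_zero_of_nonZeroDivisors a)

lemma exp_logNorm (a : (Ideal (𝓞 K))⁰) :
    Real.exp (logNorm K a) = Ideal.absNorm (a : Ideal (𝓞 K)) :=
  Real.exp_log (zero_lt_one.trans_le (one_le_absNorm a))

lemma exp_neg_logNorm (a : (Ideal (𝓞 K))⁰) :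
    Real.exp (-logNorm K a) = (Ideal.absNorm (a : Ideal (𝓞 K)) : ℝ)⁻¹ := by
  rw [Real.exp_neg, exp_logNorm]

lemma logNorm_mul (a b : (Ideal (𝓞 K))⁰) : logNorm K (a * b) = logNorm K a + logNorm K b := by
  rw [logNorm, Submonoid.coe_mul, map_mul, Nat.cast_mul, Real.log_mul]
  · rfl
  · exact (zero_lt_one.trans_le (one_le_absNorm a)).ne'
  · exact (zero_lt_one.trans_le (one_le_absNorm b)).ne'

lemma isSize_logNorm : IsSize (logNorm K) where
  nonneg a := Real.log_nonneg (one_le_absNorm a)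
  finite X := by
    refine (finite_nonZeroDivisors_absNorm_le (Real.exp X)).subset fun a ha => ?_
    rw [Set.mem_ofPred_eq] at ha ⊢
    rw [← exp_logNorm]
    exact Real.exp_le_exp.mpr ha

variable (K) in
/-- The coprimality structure on nonzero ideals. -/
lemma hasCoprimeParts_ideal : HasCoprimeParts (Ideal (𝓞 K))⁰
    fun a b => IsRelPrime (a : Ideal (𝓞 K)) (b : Ideal (𝓞 K)) where
  exists_parts a b := by
    have ha : (a : Ideal (𝓞 K)) ≠ 0 := nonZeroDivisors.coe_ne_zero a
    have hb : (b : Ideal (𝓞 K)) ≠ 0 := nonZeroDivisors.coe_ne_zero b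
    obtain ⟨c, d, g, h, hc, hd⟩ := UniqueFactorizationMonoid.exists_reduced_factors
      (a : Ideal (𝓞 K)) ha b
    rw [← hc] at ha
    rw [← hd] at hb
    refine ⟨⟨g, mem_nonZeroDivisors_of_ne_zero (left_ne_zero_of_mul ha)⟩,
      ⟨c, mem_nonZeroDivisors_of_ne_zero (right_ne_zero_of_mul ha)⟩,
      ⟨d, mem_nonZeroDivisors_of_ne_zero (right_ne_zero_of_mul hb)⟩, ?_, ?_, h⟩
    · exact Subtype.ext hc.symm
    · exact Subtype.ext hd.symm
  symm h := h.symm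
  dvd_of_dvd_mul := by
    rintro ⟨c, hc⟩ ⟨d, hd⟩ ⟨x, hx⟩ h ⟨⟨y, hy⟩, hxy⟩
    have h1 : c ∣ x := h.dvd_of_dvd_mul_left ⟨y, congrArg Subtype.val hxy⟩
    obtain ⟨z, rfl⟩ := h1
    exact ⟨⟨z, mem_nonZeroDivisors_of_ne_zero
      (right_ne_zero_of_mul (nonZeroDivisors.ne_zero hx))⟩, rfl⟩
  antisymm := by
    rintro ⟨c, hc⟩ ⟨d, hd⟩ ⟨x, hx⟩ ⟨y, hy⟩
    refine Subtype.ext (dvd_antisymm ⟨x, congrArg Subtype.val hx⟩ ⟨y, congrArg Subtype.val hy⟩)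

variable (K) in
/-- The nonzero ideals form a cancellative monoid. -/
@[reducible]
noncomputable def cancelCommMonoidIdeal : CancelCommMonoid (Ideal (𝓞 K))⁰ :=
  { (inferInstance : CommMonoid (Ideal (𝓞 K))⁰) with
    mul_left_cancel := fun a b c h => by
      have h1 := congrArg Subtype.val h
      exact Subtype.ext (mul_left_cancel₀ (nonZeroDivisors.coe_ne_zero a) h1) }

/-- A nonzero prime ideal, as an element of the monoid of nonzero ideals. -/
def primeIdeal (v : HeightOneSpectrum (𝓞 K)) : (Ideal (𝓞 K))⁰ :=
  ⟨v.asIdeal, mem_nonZeroDivisors_of_ne_zero v.ne_bot⟩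

/-- The norm of a nonzero prime ideal. -/
noncomputable def nrm (v : HeightOneSpectrum (𝓞 K)) : ℕ := Ideal.absNorm v.asIdeal

/-- The prime power `v ^ (j + 1)`. -/
def primePow (i : HeightOneSpectrum (𝓞 K) × ℕ) : (Ideal (𝓞 K))⁰ :=
  primeIdeal i.1 ^ (i.2 + 1)

lemma two_le_nrm (v : HeightOneSpectrum (𝓞 K)) : 2 ≤ nrm v := by
  have h0 : nrm v ≠ 0 := Ideal.absNorm_ne_zero_of_nonZeroDivisors (primeIdeal v)
  have h1 : nrm v ≠ 1 := fun h => v.isPrime.ne_top (Ideal.absNorm_eq_one_iff.mp h)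
  omega

lemma absNorm_primePow (i : HeightOneSpectrum (𝓞 K) × ℕ) :
    Ideal.absNorm (primePow i : Ideal (𝓞 K)) = nrm i.1 ^ (i.2 + 1) := by
  rw [primePow, SubmonoidClass.coe_pow, map_pow]
  rfl

lemma primePow_injective : Function.Injective (primePow (K := K)) := by
  rintro ⟨v, i⟩ ⟨v', j⟩ h
  have h1 : v.asIdeal ^ (i + 1) = v'.asIdeal ^ (j + 1) := congrArg Subtype.val h
  have h2 : v = v' := by
    have h3 : v'.asIdeal ∣ v.asIdeal := by
      refine (Prime.dvd_of_dvd_pow v'.prime (n := i + 1)) ?_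
      rw [h1]
      exact dvd_pow_self _ (by omega)
    exact HeightOneSpectrum.ext ((v.isMaximal.eq_of_le v'.isPrime.ne_top (Ideal.dvd_iff_le.mp h3)))
  subst h2
  have h4 := congrArg Ideal.absNorm h1
  rw [map_pow, map_pow] at h4
  have := Nat.pow_right_injective (two_le_nrm v) h4
  simp only [Prod.mk.injEq, true_and]
  omega

lemma isSize_primePow : IsSize fun i : HeightOneSpectrum (𝓞 K) × ℕ => logNorm K (primePow i) where
  nonneg _ := isSize_logNorm.nonneg _
  finite X := (isSize_logNorm.finite X).preimage primePow_injective.injOn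

lemma primePow_dvd_iff (i : HeightOneSpectrum (𝓞 K) × ℕ) (a : (Ideal (𝓞 K))⁰) :
    primePow i ∣ a ↔ i.2 < (normalizedFactors (a : Ideal (𝓞 K))).count i.1.asIdeal := by
  have ha : (a : Ideal (𝓞 K)) ≠ 0 := nonZeroDivisors.coe_ne_zero a
  have h1 : primePow i ∣ a ↔ i.1.asIdeal ^ (i.2 + 1) ∣ (a : Ideal (𝓞 K)) := by
    constructor
    · rintro ⟨c, rfl⟩
      exact ⟨c, rfl⟩
    · rintro ⟨c, hc⟩
      exact ⟨⟨c, mem_nonZeroDivisors_of_ne_zero (right_ne_zero_of_mul (hc ▸ ha))⟩,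
        Subtype.ext hc⟩
  rw [h1, dvd_iff_normalizedFactors_le_normalizedFactors (pow_ne_zero _ i.1.ne_bot) ha,
    normalizedFactors_pow, normalizedFactors_irreducible i.1.prime.irreducible,
    ← Nat.succ_le_iff, Multiset.le_count_iff_replicate_le, normalize_eq, Multiset.nsmul_singleton]

lemma mem_normalizedFactors_isPrime {a P : Ideal (𝓞 K)} (h : P ∈ normalizedFactors a) :
    P.IsPrime ∧ P ≠ ⊥ :=
  ⟨Ideal.isPrime_of_prime (prime_of_normalized_factor P h),
    (prime_of_normalized_factor P h).ne_zero⟩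

/-- The finitely many prime powers dividing an ideal. -/
lemma finite_primePow_dvd (a : (Ideal (𝓞 K))⁰) : {i | primePow i ∣ a}.Finite := by
  refine (isSize_primePow.finite (logNorm K a)).subset ?_
  rintro i ⟨c, rfl⟩
  rw [Set.mem_ofPred_eq, logNorm_mul]
  linarith [isSize_logNorm.nonneg c]

lemma logNorm_eq_sum (a : (Ideal (𝓞 K))⁰) :
    logNorm K a = ∑ i ∈ (finite_primePow_dvd a).toFinset, Real.log (nrm i.1) := by
  have ha : (a : Ideal (𝓞 K)) ≠ 0 := nonZeroDivisors.coe_ne_zero a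
  set s := normalizedFactors (a : Ideal (𝓞 K)) with hs
  have h1 : logNorm K a = (s.map fun P => Real.log (Ideal.absNorm P)).sum := by
    have h2 : (s.map fun P => Real.log (Ideal.absNorm P)).sum =
        Real.log (s.map fun P => (Ideal.absNorm P : ℝ)).prod := by
      have : ∀ t : Multiset (Ideal (𝓞 K)), t ≤ s →
          (t.map fun P => Real.log (Ideal.absNorm P)).sum =
          Real.log (t.map fun P => (Ideal.absNorm P : ℝ)).prod ∧
          (t.map fun P => (Ideal.absNorm P : ℝ)).prod ≠ 0 := by
        intro t
        induction t using Multiset.induction with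
        | empty => simp
        | cons P t ih =>
          intro hle
          obtain ⟨h3, h4⟩ := ih ((Multiset.le_cons_self t P).trans hle)
          have h5 : P ∈ s := Multiset.mem_of_le hle (Multiset.mem_cons_self P t)
          have h6 : (Ideal.absNorm P : ℝ) ≠ 0 := by
            rw [Nat.cast_ne_zero]
            exact fun h => (mem_normalizedFactors_isPrime h5).2 (Ideal.absNorm_eq_zero_iff.mp h)
          simp only [Multiset.map_cons, Multiset.sum_cons, Multiset.prod_cons]
          rw [Real.log_mul h6 h4, h3]
          exact ⟨rfl, mul_ne_zero h6 h4⟩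
      exact (this s le_rfl).1
    rw [h2, logNorm]
    congr 1
    conv_lhs => rw [← normalize_eq (a : Ideal (𝓞 K)), ← prod_normalizedFactors_eq ha]
    rw [map_multiset_prod, Nat.cast_multiset_prod, Multiset.map_map]
    rfl
  rw [h1, Finset.sum_multiset_map_count, ← Finset.sum_attach]
  have h3 : ∀ x ∈ s.toFinset.attach, s.count x.1 • Real.log (Ideal.absNorm x.1) =
      ∑ j ∈ Finset.range (s.count x.1), Real.log (Ideal.absNorm x.1) := by
    intro x _
    rw [Finset.sum_const, Finset.card_range]
  rw [Finset.sum_congr rfl h3, Finset.sum_sigma']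
  have hP : ∀ x : s.toFinset, x.1.IsPrime ∧ x.1 ≠ ⊥ := fun x =>
    mem_normalizedFactors_isPrime (Multiset.mem_toFinset.mp x.2)
  refine Finset.sum_bij (fun x _ => (⟨x.1.1, (hP x.1).1, (hP x.1).2⟩, x.2)) ?_ ?_ ?_ ?_
  · intro x hx
    rw [Set.Finite.mem_toFinset, Set.mem_ofPred_eq, primePow_dvd_iff]
    simpa using hx
  · rintro ⟨⟨x, hx⟩, j⟩ _ ⟨⟨y, hy⟩, k⟩ _ h
    simp only [Prod.mk.injEq, HeightOneSpectrum.mk.injEq] at h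
    obtain ⟨rfl, rfl⟩ := h
    rfl
  · rintro ⟨v, j⟩ h
    rw [Set.Finite.mem_toFinset, Set.mem_ofPred_eq, primePow_dvd_iff] at h
    refine ⟨⟨⟨v.asIdeal, ?_⟩, j⟩, ?_, rfl⟩
    · rw [Multiset.mem_toFinset]
      exact Multiset.count_pos.mp (lt_of_le_of_lt (Nat.zero_le _) h)
    · simpa using h
  · intro x hx
    rfl

theorem isVonMangoldt_primePow :
    IsVonMangoldt (logNorm K) (primePow (K := K)) fun i => Real.log (nrm i.1) := by
  intro F hF
  let e : (Σ a : (Ideal (𝓞 K))⁰, {i : HeightOneSpectrum (𝓞 K) × ℕ // primePow i ∣ a}) ≃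
      (HeightOneSpectrum (𝓞 K) × ℕ) × (Ideal (𝓞 K))⁰ :=
    Equiv.ofBijective (fun x => (x.2.1, x.2.2.choose)) <| by
      constructor
      · rintro ⟨a, i, hi⟩ ⟨b, j, hj⟩ h
        simp only [Prod.mk.injEq] at h
        obtain ⟨rfl, h2⟩ := h
        have h3 : a = b := by rw [hi.choose_spec, hj.choose_spec, h2]
        subst h3
        rfl
      · rintro ⟨i, c⟩
        refine ⟨⟨primePow i * c, i, dvd_mul_right _ _⟩, ?_⟩
        simp only [Prod.mk.injEq, true_and]
        have h : primePow i ∣ primePow i * c := dvd_mul_right _ _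
        let := cancelCommMonoidIdeal K
        exact (mul_left_cancel h.choose_spec).symm
  have he : ∀ x, primePow (e x).1 * (e x).2 = x.1 := fun x => x.2.2.choose_spec.symm
  have hfin : ∀ a : (Ideal (𝓞 K))⁰, Finite {i : HeightOneSpectrum (𝓞 K) × ℕ // primePow i ∣ a} :=
    fun a => (finite_primePow_dvd a).to_subtype
  rw [← e.tsum_eq]
  simp only [he]
  rw [Summable.tsum_sigma']
  · refine tsum_congr fun a => ?_
    dsimp only
    rw [tsum_mul_right, logNorm_eq_sum a]
    congr 1
    have := hfin a
    rw [← Finset.tsum_subtype]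
    rw [Complex.ofReal_tsum]
    refine (Equiv.subtypeEquivRight fun i => ?_).tsum_eq
      (fun i : {i : HeightOneSpectrum (𝓞 K) × ℕ // primePow i ∣ a} =>
        ((Real.log (nrm i.1.1) : ℝ) : ℂ))
    simp
  · intro a
    have := hfin a
    exact Summable.of_finite
  · refine summable_of_hasFiniteSupport ?_
    have := hF.to_subtype
    refine (Set.toFinite (Set.range fun x : (Σ a : F.support,
      {i : HeightOneSpectrum (𝓞 K) × ℕ // primePow i ∣ (a : (Ideal (𝓞 K))⁰)}) =>
        (⟨x.1.1, x.2⟩ : (Σ a : (Ideal (𝓞 K))⁰,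
          {i : HeightOneSpectrum (𝓞 K) × ℕ // primePow i ∣ a})))).subset ?_
    rintro ⟨a, i⟩ h
    exact ⟨⟨⟨a, right_ne_zero_of_mul h⟩, i⟩, rfl⟩

end PrimeIdeals

section Chebyshev

open scoped Classical
open IsDedekindDomain UniqueFactorizationMonoid

variable {K : Type*} [Field K] [NumberField K]

lemma exists_prime_nrm_eq (v : HeightOneSpectrum (𝓞 K)) :
    ∃ p f : ℕ, p.Prime ∧ 0 < f ∧ nrm v = p ^ f ∧ (p : 𝓞 K) ∈ v.asIdeal := by
  have hfin : Finite (𝓞 K ⧸ v.asIdeal) := Ideal.finiteQuotientOfFreeOfNeBot _ v.ne_bot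
  have := Fintype.ofFinite (𝓞 K ⧸ v.asIdeal)
  have hmax := v.isMaximal
  let := Ideal.Quotient.field v.asIdeal
  obtain ⟨p, hp⟩ := CharP.exists (𝓞 K ⧸ v.asIdeal)
  obtain ⟨f, hpp, hf⟩ := FiniteField.card (𝓞 K ⧸ v.asIdeal) p
  refine ⟨p, f, hpp, f.2, ?_, ?_⟩
  · rw [nrm, Ideal.absNorm_apply, Submodule.cardQuot_apply, Nat.card_eq_fintype_card, hf]
  · rw [← Ideal.Quotient.eq_zero_iff_mem, map_natCast]
    exact CharP.cast_eq_zero _ p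

lemma heightOneSpectrum_isCoprime {v v' : HeightOneSpectrum (𝓞 K)} (h : v ≠ v') :
    IsCoprime v.asIdeal v'.asIdeal := by
  have := v.isMaximal
  have := v'.isMaximal
  exact Ideal.isCoprime_of_isMaximal fun heq => h (HeightOneSpectrum.ext heq)

/-- Distinct primes containing `p` have norms whose product is at most `p ^ n`. -/
lemma sum_log_nrm_le {p : ℕ} (hp : p ≠ 0) (S : Finset (HeightOneSpectrum (𝓞 K)))
    (hS : ∀ v ∈ S, (p : 𝓞 K) ∈ v.asIdeal) :
    ∑ v ∈ S, Real.log (nrm v) ≤ finrank ℚ K * Real.log p := by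
  have h1 : ∏ v ∈ S, v.asIdeal ∣ Ideal.span {(p : 𝓞 K)} := by
    refine Finset.prod_dvd_of_coprime (fun v _ v' _ h => heightOneSpectrum_isCoprime h) ?_
    intro v hv
    rw [Ideal.dvd_span_singleton]
    exact hS v hv
  have h2 := Nat.le_of_dvd (Nat.pos_of_ne_zero ?_) (map_dvd Ideal.absNorm h1)
  · rw [map_prod, Ideal.absNorm_span_natCast, RingOfIntegers.rank] at h2
    rw [← Real.log_prod, ← Real.log_pow]
    · refine Real.log_le_log ?_ ?_
      · exact Finset.prod_pos fun v _ => by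
          exact_mod_cast zero_lt_two.trans_le (two_le_nrm v)
      · exact_mod_cast h2
    · intro v _
      exact_mod_cast (zero_lt_two.trans_le (two_le_nrm v)).ne'
  · rw [Ideal.absNorm_span_natCast]
    exact pow_ne_zero _ hp

/-- Chebyshev's upper bound for prime ideals. -/
lemma sum_log_nrm_primePow_le (X : ℝ) :
    ∑ i ∈ (isSize_primePow (K := K).finite X).toFinset, Real.log (nrm i.1) ≤
      (finrank ℚ K * (Real.log 4 + 4)) * Real.exp X := by
  set s := (isSize_primePow (K := K).finite X).toFinset with hs
  have h1 : ∀ i ∈ s, nrm i.1 ^ (i.2 + 1) ∈ Finset.Ioc 0 ⌊Real.exp X⌋₊ := by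
    intro i hi
    rw [hs, Set.Finite.mem_toFinset, Set.mem_ofPred_eq] at hi
    rw [Finset.mem_Ioc]
    refine ⟨pow_pos (zero_lt_two.trans_le (two_le_nrm i.1)) _, Nat.le_floor ?_⟩
    rw [← absNorm_primePow, ← exp_logNorm]
    exact Real.exp_le_exp.mpr hi
  rw [← Finset.sum_fiberwise_of_maps_to h1, mul_assoc]
  refine le_trans ?_ (mul_le_mul_of_nonneg_left
    (Chebyshev.psi_le_const_mul_self (Real.exp_pos X).le) (Nat.cast_nonneg _))
  rw [Chebyshev.psi, Finset.mul_sum]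
  refine Finset.sum_le_sum fun m _ => ?_
  rcases (s.filter fun i => nrm i.1 ^ (i.2 + 1) = m).eq_empty_or_nonempty with h2 | ⟨i₀, hi₀⟩
  · rw [h2, Finset.sum_empty]
    exact mul_nonneg (Nat.cast_nonneg _) ArithmeticFunction.vonMangoldt_nonneg
  rw [Finset.mem_filter] at hi₀
  obtain ⟨p, f, hp, hf, hpf, -⟩ := exists_prime_nrm_eq i₀.1
  have hm : m = p ^ (f * (i₀.2 + 1)) := by rw [← hi₀.2, hpf, pow_mul]
  have hΛ : ArithmeticFunction.vonMangoldt m = Real.log p := by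
    rw [hm, ArithmeticFunction.vonMangoldt_apply_pow (by positivity),
      ArithmeticFunction.vonMangoldt_apply_prime hp]
  rw [hΛ]
  have hinj : Set.InjOn Prod.fst ((s.filter fun i => nrm i.1 ^ (i.2 + 1) = m : Finset _) :
      Set (HeightOneSpectrum (𝓞 K) × ℕ)) := by
    rintro ⟨v, i⟩ h ⟨v', j⟩ h' rfl
    simp only [Finset.coe_filter, Set.mem_ofPred_eq] at h h'
    have := Nat.pow_right_injective (two_le_nrm v) (h.2.trans h'.2.symm)
    simp only [Prod.mk.injEq, true_and]
    omega
  rw [← Finset.sum_image (f := fun v => Real.log (nrm v)) hinj]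
  refine sum_log_nrm_le hp.ne_zero _ fun v hv => ?_
  obtain ⟨i, hi, rfl⟩ := Finset.mem_image.mp hv
  rw [Finset.mem_filter] at hi
  obtain ⟨p', f', hp', hf', hpf', hmem⟩ := exists_prime_nrm_eq i.1
  have h3 : p' ∣ p := by
    refine hp'.dvd_of_dvd_pow (n := f * (i₀.2 + 1)) ?_
    rw [← hm, ← hi.2, hpf', ← pow_mul]
    exact dvd_pow_self _ (by positivity)
  rwa [← (Nat.prime_dvd_prime_iff_eq hp' hp).mp h3]

end Chebyshev

section MertensIdeals

open scoped Classical
open IsDedekindDomain UniqueFactorizationMonoid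

variable {K : Type*} [Field K] [NumberField K]

/-- A class group character, as a multiplicative function on ideals. -/
noncomputable def classChar (ψ : AddChar (Additive (ClassGroup (𝓞 K))) ℂ) :
    (Ideal (𝓞 K))⁰ →* ℂ where
  toFun a := ψ (Additive.ofMul (ClassGroup.mk0 a))
  map_one' := by simp
  map_mul' a b := by
    rw [map_mul, ofMul_mul, AddChar.map_add_eq_mul]

lemma smoothSum_classFunction (g : ClassGroup (𝓞 K) → ℂ) {w : ℝ → ℝ} {A : ℝ}
    (hA : ∀ x, w x ≠ 0 → x ∈ Set.Icc (-A) A) (τ : ℝ) :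
    smoothSum (logNorm K) (fun a => g (ClassGroup.mk0 a)) w τ =
      ∑ c, g c * ((∑' a : {a : (Ideal (𝓞 K))⁰ // ClassGroup.mk0 a = c},
        w (Real.log (Ideal.absNorm ((a : (Ideal (𝓞 K))⁰) : Ideal (𝓞 K))) - τ) : ℝ) : ℂ) := by
  have hsum : Summable fun a : (Ideal (𝓞 K))⁰ =>
      g (ClassGroup.mk0 a) * (w (logNorm K a - τ) : ℂ) := by
    refine summable_of_ne_finset_zero (s := (isSize_logNorm.finite (τ + A)).toFinset) fun a ha => ?_
    rw [Set.Finite.mem_toFinset, Set.mem_ofPred_eq, not_le] at ha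
    have : w (logNorm K a - τ) = 0 := by
      by_contra h
      linarith [(hA _ h).2]
    rw [this]
    simp
  let e := Equiv.sigmaFiberEquiv (fun a : (Ideal (𝓞 K))⁰ => ClassGroup.mk0 a)
  have hsum' : Summable fun x : (Σ c, {a : (Ideal (𝓞 K))⁰ // ClassGroup.mk0 a = c}) =>
      g (ClassGroup.mk0 (e x)) * (w (logNorm K (e x) - τ) : ℂ) := e.summable_iff.mpr hsum
  rw [smoothSum, ← e.tsum_eq, hsum'.tsum_sigma, tsum_fintype]
  refine Finset.sum_congr rfl fun c _ => ?_
  rw [Complex.ofReal_tsum, ← tsum_mul_left]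
  refine tsum_congr fun a => ?_
  change g (ClassGroup.mk0 a.1) * _ = _
  rw [a.2]
  rfl

variable (K) in
lemma exists_smoothSum_one_bound (w : ℝ → ℝ) (hw : ContDiff ℝ ∞ w) (hc : HasCompactSupport w) :
    ∃ κ C : ℝ, ((∀ x, 0 ≤ w x) → (∃ x, w x ≠ 0) → 0 < κ) ∧
      ∀ τ, ‖smoothSum (logNorm K) 1 w τ - (κ * Real.exp τ : ℝ)‖ ≤ C := by
  obtain ⟨κ, C, hκ, hC⟩ := exists_classSum_bound K hw hc
  obtain ⟨A, -, hA⟩ := exists_support_subset_Icc hc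
  have hh : (0 : ℝ) < Fintype.card (ClassGroup (𝓞 K)) := by exact_mod_cast Fintype.card_pos
  refine ⟨Fintype.card (ClassGroup (𝓞 K)) * κ, ∑ _c : ClassGroup (𝓞 K), C,
    fun h h' => mul_pos hh (hκ h h'), fun τ => ?_⟩
  have h1 := smoothSum_classFunction (K := K) (fun _ => 1) hA τ
  rw [show (1 : (Ideal (𝓞 K))⁰ → ℂ) = fun a => 1 from rfl, h1]
  have h2 : ((Fintype.card (ClassGroup (𝓞 K)) * κ * Real.exp τ : ℝ) : ℂ) =
      ∑ _c : ClassGroup (𝓞 K), ((κ * Real.exp τ : ℝ) : ℂ) := by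
    rw [Finset.sum_const, Finset.card_univ, nsmul_eq_mul]
    push_cast
    ring
  rw [h2, ← Finset.sum_sub_distrib]
  refine (norm_sum_le _ _).trans (Finset.sum_le_sum fun c _ => ?_)
  rw [one_mul, ← Complex.ofReal_sub, Complex.norm_real]
  exact hC c τ

lemma exists_smoothSum_classChar_bound {ψ : AddChar (Additive (ClassGroup (𝓞 K))) ℂ} (hψ : ψ ≠ 0)
    (w : ℝ → ℝ) (hw : ContDiff ℝ ∞ w) (hc : HasCompactSupport w) :
    ∃ C : ℝ, ∀ τ, ‖smoothSum (logNorm K) (classChar ψ) w τ‖ ≤ C := by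
  obtain ⟨κ, C, hκ, hC⟩ := exists_classSum_bound K hw hc
  obtain ⟨A, -, hA⟩ := exists_support_subset_Icc hc
  refine ⟨∑ _c : ClassGroup (𝓞 K), C, fun τ => ?_⟩
  have h1 := smoothSum_classFunction (K := K) (fun c => ψ (Additive.ofMul c)) hA τ
  rw [show ⇑(classChar ψ) = fun a => ψ (Additive.ofMul (ClassGroup.mk0 a)) from rfl, h1]
  have h2 : ∑ c : ClassGroup (𝓞 K), ψ (Additive.ofMul c) * ((κ * Real.exp τ : ℝ) : ℂ) = 0 := by
    rw [← Finset.sum_mul, Additive.ofMul.sum_comp (fun c => ψ c),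
      AddChar.sum_eq_zero_iff_ne_zero.mpr hψ, zero_mul]
  rw [← sub_zero (∑ c, _), ← h2, ← Finset.sum_sub_distrib]
  refine (norm_sum_le _ _).trans (Finset.sum_le_sum fun c _ => ?_)
  rw [← mul_sub, norm_mul, AddChar.norm_apply, one_mul, ← Complex.ofReal_sub, Complex.norm_real]
  exact hC c τ

lemma exists_bump : ∃ w : ℝ → ℝ, ContDiff ℝ ∞ w ∧ HasCompactSupport w ∧ (∀ x, 0 ≤ w x) ∧
    ∃ x, w x ≠ 0 := by
  let f : ContDiffBump (0 : ℝ) := default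
  exact ⟨f, f.contDiff, f.hasCompactSupport, fun x => f.nonneg, 0, by
    rw [f.one_of_mem_closedBall (Metric.mem_closedBall_self f.rIn_pos.le)]
    exact one_ne_zero⟩

variable (K) in
/-- Mertens' first theorem for prime ideals. -/
theorem exists_abs_mertens_le : ∃ C, ∀ X, 0 ≤ X →
    |∑ i ∈ (isSize_primePow (K := K).finite X).toFinset,
      Real.log (nrm i.1) * Real.exp (-logNorm K (primePow i)) - X| ≤ C := by
  obtain ⟨w, hw, hwc, hw0, hwne⟩ := exists_bump
  exact exists_abs_sum_vonMangoldt_sub_le isSize_logNorm logNorm_mul isSize_primePow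
    isVonMangoldt_primePow (fun i => Real.log_nonneg (by
      exact_mod_cast (one_le_two.trans (two_le_nrm i.1)))) sum_log_nrm_primePow_le
    (exists_smoothSum_one_bound K) hw hwc hw0 hwne

lemma exists_norm_mertens_classChar_le {ψ : AddChar (Additive (ClassGroup (𝓞 K))) ℂ} (hψ : ψ ≠ 0) :
    ∃ C, ∀ X, ‖∑ i ∈ (isSize_primePow (K := K).finite X).toFinset,
      (Real.log (nrm i.1) : ℂ) * classChar ψ (primePow i) *
        (Real.exp (-logNorm K (primePow i)) : ℂ)‖ ≤ C := by
  obtain ⟨w, hw, hwc, hw0, hwne⟩ := exists_bump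
  have hφ : ∀ a, ‖classChar ψ a‖ = 1 := fun a => AddChar.norm_apply ψ _
  refine exists_norm_sum_vonMangoldt_mul_le isSize_logNorm logNorm_mul isSize_primePow
    isVonMangoldt_primePow (fun i => Real.log_nonneg (by
      exact_mod_cast (one_le_two.trans (two_le_nrm i.1)))) sum_log_nrm_primePow_le
    hφ (exists_smoothSum_classChar_bound hψ) hw hwc ?_
  let := cancelCommMonoidIdeal K
  exact laplace_smoothSum_ne_zero (hasCoprimeParts_ideal K) isSize_logNorm logNorm_mul
    (classChar ψ) hφ (exists_smoothSum_one_bound K) (exists_smoothSum_classChar_bound hψ) hw hwc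
    hw0 hwne

variable (K) in
/-- Mertens' first theorem for powers of prime ideals that are principal. -/
theorem exists_abs_mertens_principal_le : ∃ C, ∀ X, 0 ≤ X →
    |∑ i ∈ (isSize_primePow (K := K).finite X).toFinset with ClassGroup.mk0 (primePow i) = 1,
      Real.log (nrm i.1) * Real.exp (-logNorm K (primePow i)) - X / classNumber K| ≤ C := by
  obtain ⟨C₁, hC₁⟩ := exists_abs_mertens_le K
  have hψ : ∀ ψ : AddChar (Additive (ClassGroup (𝓞 K))) ℂ, ∃ C, ∀ X, 0 ≤ X →
      ‖(∑ i ∈ (isSize_primePow (K := K).finite X).toFinset,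
        (Real.log (nrm i.1) : ℂ) * classChar ψ (primePow i) *
          (Real.exp (-logNorm K (primePow i)) : ℂ)) - (if ψ = 0 then (X : ℂ) else 0)‖ ≤ C := by
    intro ψ
    split_ifs with h
    · refine ⟨C₁, fun X hX => ?_⟩
      have : ∀ i, classChar ψ (primePow (K := K) i) = 1 := fun i => by
        rw [h]
        rfl
      simp only [this, mul_one]
      refine le_of_eq_of_le ?_ (hC₁ X hX)
      rw [← Real.norm_eq_abs, ← Complex.norm_real]
      push_cast
      rfl
    · obtain ⟨C, hC⟩ := exists_norm_mertens_classChar_le h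
      exact ⟨C, fun X _ => by rw [sub_zero]; exact hC X⟩
  choose C hC using hψ
  have hh : (0 : ℝ) < classNumber K := by exact_mod_cast Fintype.card_pos
  refine ⟨(∑ ψ, C ψ) / classNumber K, fun X hX => ?_⟩
  set s := (isSize_primePow (K := K).finite X).toFinset with hs
  have horth : ∀ i : HeightOneSpectrum (𝓞 K) × ℕ, ∑ ψ : AddChar (Additive (ClassGroup (𝓞 K))) ℂ,
      classChar ψ (primePow i) =
        if ClassGroup.mk0 (primePow i) = 1 then (classNumber K : ℂ) else 0 := by
    intro i
    have := AddChar.sum_apply_eq_ite (Additive.ofMul (ClassGroup.mk0 (primePow i)))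
    simp only [ofMul_eq_zero] at this
    rwa [show Fintype.card (Additive (ClassGroup (𝓞 K))) = classNumber K from
      Fintype.card_congr Additive.toMul] at this
  have key : ((classNumber K * ((∑ i ∈ s with ClassGroup.mk0 (primePow i) = 1,
      Real.log (nrm i.1) * Real.exp (-logNorm K (primePow i))) - X / classNumber K) : ℝ) : ℂ) =
      ∑ ψ, ((∑ i ∈ s, (Real.log (nrm i.1) : ℂ) * classChar ψ (primePow i) *
          (Real.exp (-logNorm K (primePow i)) : ℂ)) - (if ψ = 0 then (X : ℂ) else 0)) := by
    rw [Finset.sum_sub_distrib, Finset.sum_comm, Finset.sum_ite_eq' Finset.univ, if_pos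
      (Finset.mem_univ _), mul_sub, mul_div_cancel₀ _ hh.ne', Complex.ofReal_sub]
    congr 1
    rw [Finset.sum_filter, Finset.mul_sum, Complex.ofReal_sum]
    refine Finset.sum_congr rfl fun i _ => ?_
    rw [← Finset.sum_mul, ← Finset.mul_sum, horth]
    split_ifs
    · push_cast
      ring
    · simp
  rw [le_div_iff₀ hh, mul_comm, ← abs_of_pos hh, ← abs_mul, abs_of_pos hh, ← Real.norm_eq_abs,
    ← Complex.norm_real, key]
  exact (norm_sum_le _ _).trans (Finset.sum_le_sum fun ψ _ => hC ψ X hX)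

end MertensIdeals

/-! ### Counting ideals and principal primes -/

section Counting

open scoped Classical
open IsDedekindDomain UniqueFactorizationMonoid Filter

lemma summable_of_fiber_le {ι : Type*} {f : ι → ℝ} (hf : ∀ i, 0 ≤ f i) (κ : ι → ℕ) {b : ℕ → ℝ}
    (hb : Summable b) (h : ∀ k, ∀ s : Finset ι, (∀ i ∈ s, κ i = k) → ∑ i ∈ s, f i ≤ b k) :
    Summable f := by
  have hb0 : ∀ k, 0 ≤ b k := fun k => by simpa using h k ∅ (by simp)
  refine summable_of_sum_le hf (c := ∑' k, b k) fun u => ?_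
  rw [← Finset.sum_fiberwise_of_maps_to (g := κ) (t := u.image κ)
    (fun i hi => Finset.mem_image_of_mem _ hi)]
  refine le_trans (Finset.sum_le_sum fun k _ => h k _ fun i hi => (Finset.mem_filter.mp hi).2) ?_
  exact hb.sum_le_tsum _ fun k _ => hb0 k

variable (K : Type*) [Field K] [NumberField K]

/-- The nonzero ideals of norm at most `y`. -/
noncomputable def idealsLE (y : ℝ) : Finset (Ideal (𝓞 K))⁰ :=
  (finite_nonZeroDivisors_absNorm_le y).toFinset

variable {K} in
@[simp]
lemma mem_idealsLE {y : ℝ} {a : (Ideal (𝓞 K))⁰} :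
    a ∈ idealsLE K y ↔ (Ideal.absNorm (a : Ideal (𝓞 K)) : ℝ) ≤ y := by
  simp [idealsLE]

lemma primeIdeal_injective : Function.Injective (primeIdeal (K := K)) := fun _ _ h =>
  HeightOneSpectrum.ext (congrArg Subtype.val h)

/-- The nonzero primes of norm at most `y`. -/
noncomputable def primesLE (y : ℝ) : Finset (HeightOneSpectrum (𝓞 K)) :=
  (((idealsLE K y).finite_toSet).preimage (primeIdeal_injective K).injOn).toFinset

variable {K} in
@[simp]
lemma mem_primesLE {y : ℝ} {v : HeightOneSpectrum (𝓞 K)} :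
    v ∈ primesLE K y ↔ (nrm v : ℝ) ≤ y := by
  simp [primesLE, nrm, primeIdeal]

lemma idealsLE_mono {y y' : ℝ} (h : y ≤ y') : idealsLE K y ⊆ idealsLE K y' := fun a ha => by
  rw [mem_idealsLE] at ha ⊢
  exact ha.trans h

lemma exists_card_idealsLE : ∃ c C : ℝ, 0 < c ∧ 0 < C ∧ ∀ y, 1 ≤ y →
    c * y ≤ (idealsLE K y).card ∧ ((idealsLE K y).card : ℝ) ≤ C * y := by
  have hlim := NumberField.Ideal.tendsto_norm_le_div_atTop₀ K
  have hcard : ∀ s : ℝ, Nat.card {I : (Ideal (𝓞 K))⁰ //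
      (Ideal.absNorm (I : Ideal (𝓞 K)) : ℝ) ≤ s} = (idealsLE K s).card := fun s =>
    Nat.subtype_card _ fun a => mem_idealsLE
  set ρ := (2 ^ InfinitePlace.nrRealPlaces K * (2 * Real.pi) ^ InfinitePlace.nrComplexPlaces K *
    Units.regulator K * classNumber K : ℝ) / (Units.torsionOrder K * √|discr K|) with hρ
  have hρ0 : 0 < ρ := by
    have h1 : (0 : ℝ) < classNumber K := by exact_mod_cast Fintype.card_pos
    have h2 : (0 : ℝ) < Units.torsionOrder K := by
      exact_mod_cast (Units.torsionOrder_pos K)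
    have h3 : (0 : ℝ) < |(discr K : ℝ)| := by
      rw [abs_pos]
      exact_mod_cast discr_ne_zero K
    have := Units.regulator_pos K
    positivity
  obtain ⟨Y, hY⟩ := eventually_atTop.mp ((hlim.eventually_const_le (half_lt_self hρ0)).and
    (hlim.eventually_le_const (show ρ < 2 * ρ by linarith)))
  simp only [hcard] at hY
  set Z := max Y 1
  have hZ1 : 1 ≤ Z := le_max_right _ _
  have hZ : ∀ y, Z ≤ y → ρ / 2 * y ≤ (idealsLE K y).card ∧
      ((idealsLE K y).card : ℝ) ≤ 2 * ρ * y := fun y hy => by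
    have hy0 : 0 < y := by linarith
    have := hY y ((le_max_left _ _).trans hy)
    rwa [le_div_iff₀ hy0, div_le_iff₀ hy0] at this
  refine ⟨min (ρ / 2) (1 / Z), 2 * ρ * Z, by positivity, by positivity, fun y hy => ?_⟩
  rcases le_or_gt Z y with h | h
  · obtain ⟨h1, h2⟩ := hZ y h
    refine ⟨le_trans ?_ h1, h2.trans ?_⟩
    · gcongr
      exact min_le_left _ _
    · rw [mul_assoc (2 * ρ)]
      gcongr
      exact le_mul_of_one_le_left (by linarith) hZ1
  · constructor
    · calc min (ρ / 2) (1 / Z) * y ≤ 1 / Z * Z := by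
            gcongr
            exact min_le_right _ _
        _ = 1 := by field_simp
        _ ≤ _ := by
          have : (1 : (Ideal (𝓞 K))⁰) ∈ idealsLE K y := by simpa using hy
          exact_mod_cast Finset.card_pos.mpr ⟨_, this⟩
    · calc ((idealsLE K y).card : ℝ) ≤ (idealsLE K Z).card := by
            exact_mod_cast Finset.card_le_card (idealsLE_mono K h.le)
        _ ≤ 2 * ρ * Z := (hZ Z le_rfl).2
        _ ≤ 2 * ρ * Z * y := le_mul_of_one_le_right (by positivity) hy

lemma summable_absNorm_rpow {s : ℝ} (hs : 1 < s) :
    Summable fun a : (Ideal (𝓞 K))⁰ => (Ideal.absNorm (a : Ideal (𝓞 K)) : ℝ) ^ (-s) := by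
  obtain ⟨c₀, C, -, hC0, hC⟩ := exists_card_idealsLE K
  refine summable_of_fiber_le (fun a => by positivity) (fun a => ⌊logNorm K a⌋₊)
    (b := fun k => C * Real.exp 1 * (Real.exp (-(s - 1))) ^ k) ?_ fun k u hu => ?_
  · exact (summable_geometric_of_lt_one (Real.exp_pos _).le
      ((Real.exp_lt_exp.mpr (by linarith)).trans_eq Real.exp_zero)).mul_left _
  · have h1 : u ⊆ idealsLE K (Real.exp (k + 1)) := fun a ha => by
      rw [mem_idealsLE, ← exp_logNorm]
      have := Nat.lt_floor_add_one (logNorm K a)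
      rw [hu a ha] at this
      exact Real.exp_le_exp.mpr this.le
    have h2 : ∀ a ∈ u, (Ideal.absNorm (a : Ideal (𝓞 K)) : ℝ) ^ (-s) ≤ Real.exp (-s * k) := by
      intro a ha
      rw [← exp_logNorm, ← Real.exp_mul]
      have := Nat.floor_le (isSize_logNorm.nonneg a)
      rw [hu a ha] at this
      exact Real.exp_le_exp.mpr (by nlinarith)
    calc ∑ a ∈ u, (Ideal.absNorm (a : Ideal (𝓞 K)) : ℝ) ^ (-s) ≤ u.card • Real.exp (-s * k) :=
          Finset.sum_le_card_nsmul _ _ _ h2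
      _ ≤ (C * Real.exp (k + 1)) * Real.exp (-s * k) := by
          rw [nsmul_eq_mul]
          gcongr
          refine le_trans ?_ (hC _ (Real.one_le_exp (by positivity))).2
          exact_mod_cast Finset.card_le_card h1
      _ = _ := by
          rw [← Real.exp_nat_mul, mul_assoc, mul_assoc, ← Real.exp_add, ← Real.exp_add]
          ring_nf

lemma exists_sum_inv_absNorm_ge : ∃ c, 0 < c ∧ ∀ y, 1 ≤ y →
    c * Real.log y ≤ ∑ a ∈ idealsLE K y, (Ideal.absNorm (a : Ideal (𝓞 K)) : ℝ)⁻¹ := by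
  obtain ⟨c, C₀, hc0, -, hc⟩ := exists_card_idealsLE K
  refine ⟨c / 2, by positivity, fun y hy => ?_⟩
  set Y := ⌊y⌋₊
  have h1 : ∀ a ∈ idealsLE K y, ∑ k ∈ Finset.Icc 1 Y,
      (if Ideal.absNorm (a : Ideal (𝓞 K)) ≤ k then ((k : ℝ)⁻¹ - ((k : ℝ) + 1)⁻¹) else 0) ≤
        (Ideal.absNorm (a : Ideal (𝓞 K)) : ℝ)⁻¹ := by
    intro a ha
    rw [mem_idealsLE] at ha
    have hNY : Ideal.absNorm (a : Ideal (𝓞 K)) ≤ Y := Nat.le_floor ha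
    set N := Ideal.absNorm (a : Ideal (𝓞 K))
    have hN1 : 1 ≤ N := by exact_mod_cast one_le_absNorm a
    rw [← Finset.sum_filter]
    have : (Finset.Icc 1 Y).filter (fun k => N ≤ k) = Finset.Ico N (Y + 1) := by
      ext k
      simp only [Finset.mem_filter, Finset.mem_Icc, Finset.mem_Ico]
      omega
    rw [this]
    have h2 : ∑ k ∈ Finset.Ico N (Y + 1), ((k : ℝ)⁻¹ - ((k : ℝ) + 1)⁻¹) =
        (N : ℝ)⁻¹ - ((Y + 1 : ℕ) : ℝ)⁻¹ := by
      have := Finset.sum_Ico_sub (fun k : ℕ => (k : ℝ)⁻¹) (show N ≤ Y + 1 by omega)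
      rw [← neg_inj, ← Finset.sum_neg_distrib, neg_sub]
      rw [← this]
      refine Finset.sum_congr rfl fun k _ => ?_
      push_cast
      ring
    rw [h2]
    have : (0 : ℝ) ≤ ((Y + 1 : ℕ) : ℝ)⁻¹ := by positivity
    linarith
  refine le_trans ?_ (Finset.sum_le_sum h1)
  rw [Finset.sum_comm]
  have h3 : ∀ k ∈ Finset.Icc 1 Y, c / 2 * (k : ℝ)⁻¹ ≤ ∑ a ∈ idealsLE K y,
      (if Ideal.absNorm (a : Ideal (𝓞 K)) ≤ k then ((k : ℝ)⁻¹ - ((k : ℝ) + 1)⁻¹) else 0) := by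
    intro k hk
    rw [Finset.mem_Icc] at hk
    have hk1 : (1 : ℝ) ≤ k := by exact_mod_cast hk.1
    have hky : (k : ℝ) ≤ y := (Nat.cast_le.mpr hk.2).trans (Nat.floor_le (by linarith))
    rw [← Finset.sum_filter]
    have : (idealsLE K y).filter (fun a : (Ideal (𝓞 K))⁰ => Ideal.absNorm (a : Ideal (𝓞 K)) ≤ k) =
        idealsLE K k := by
      ext a
      simp only [Finset.mem_filter, mem_idealsLE, Nat.cast_le]
      refine ⟨fun h => h.2, fun h => ⟨le_trans ?_ hky, h⟩⟩
      exact_mod_cast h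
    rw [this, Finset.sum_const, nsmul_eq_mul]
    have h4 := (hc k hk1).1
    have h5 : (k : ℝ)⁻¹ - ((k : ℝ) + 1)⁻¹ = 1 / (k * (k + 1)) := by
      field_simp
      ring
    rw [h5]
    calc c / 2 * (k : ℝ)⁻¹ ≤ c * k * (1 / (k * (k + 1))) := by
          rw [div_mul_eq_mul_div, mul_one_div, div_le_div_iff₀ two_pos (by positivity)]
          have : (k : ℝ)⁻¹ * k = 1 := inv_mul_cancel₀ (by positivity)
          calc c * (k : ℝ)⁻¹ * (k * (k + 1)) = c * ((k : ℝ)⁻¹ * k) * (k + 1) := by ring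
            _ ≤ c * k * 2 := by rw [this]; nlinarith
      _ ≤ _ := by gcongr
  refine le_trans ?_ (Finset.sum_le_sum h3)
  rw [← Finset.mul_sum]
  gcongr
  have h6 := log_add_one_le_harmonic Y
  rw [harmonic_eq_sum_Icc] at h6
  push_cast at h6
  refine le_trans (Real.log_le_log (by linarith) ?_) h6
  exact (Nat.lt_floor_add_one y).le

end Counting

section PrimeSums

open scoped Classical
open IsDedekindDomain UniqueFactorizationMonoid Filter

variable (K : Type*) [Field K] [NumberField K]

lemma one_lt_nrm {K : Type*} [Field K] [NumberField K] (v : HeightOneSpectrum (𝓞 K)) :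
    (1 : ℝ) < nrm v := by
  exact_mod_cast two_le_nrm v

lemma logNorm_primePow_zero {K : Type*} [Field K] [NumberField K] (v : HeightOneSpectrum (𝓞 K)) :
    logNorm K (primePow (v, 0)) = Real.log (nrm v) := by
  simp [logNorm, absNorm_primePow]

lemma primesLE_product_eq (X : ℝ) : primesLE K (Real.exp X) ×ˢ ({0} : Finset ℕ) =
    {i ∈ (isSize_primePow (K := K).finite X).toFinset | i.2 = 0} := by
  ext ⟨v, j⟩
  rw [Finset.mem_product, mem_primesLE, Finset.mem_singleton, Finset.mem_filter,
    Set.Finite.mem_toFinset, Set.mem_ofPred_eq]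
  refine and_congr_left fun hj => ?_
  obtain rfl : j = 0 := hj
  rw [logNorm_primePow_zero, Real.log_le_iff_le_exp (zero_lt_one.trans (one_lt_nrm v))]

lemma sum_log_nrm_primesLE_le (X : ℝ) : ∑ v ∈ primesLE K (Real.exp X), Real.log (nrm v) ≤
    (finrank ℚ K * (Real.log 4 + 4)) * Real.exp X := by
  refine le_trans ?_ (sum_log_nrm_primePow_le X)
  have h := Finset.sum_product (primesLE K (Real.exp X)) ({0} : Finset ℕ)
    (fun i : HeightOneSpectrum (𝓞 K) × ℕ => Real.log (nrm i.1))
  simp only [Finset.sum_singleton] at h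
  rw [← h, primesLE_product_eq]
  refine Finset.sum_le_sum_of_subset_of_nonneg (Finset.filter_subset _ _) ?_
  exact fun i _ _ => Real.log_nonneg (one_lt_nrm _).le

lemma summable_inv_nrm_mul_log :
    Summable fun v : HeightOneSpectrum (𝓞 K) => ((nrm v : ℝ) * Real.log (nrm v))⁻¹ := by
  set C : ℝ := finrank ℚ K * (Real.log 4 + 4)
  have hlog2 := Real.log_two_gt_d9
  have hlog : ∀ v : HeightOneSpectrum (𝓞 K), Real.log 2 ≤ Real.log (nrm v) := fun v =>
    Real.log_le_log two_pos (by exact_mod_cast two_le_nrm v)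
  refine summable_of_fiber_le (fun v => ?_) (fun v => ⌊Real.log (nrm v)⌋₊)
    (b := fun k => C * Real.exp 1 * 9 * (1 / ((k + 1 : ℕ) : ℝ) ^ 2)) ?_ fun k s hs => ?_
  · have := hlog v
    have : 0 < Real.log (nrm v) := by linarith
    positivity
  · exact (((summable_nat_add_iff 1).mpr
      (Real.summable_one_div_nat_pow.mpr one_lt_two))).mul_left _
  · have h1 : s ⊆ primesLE K (Real.exp (k + 1)) := fun v hv => by
      rw [mem_primesLE, ← Real.log_le_iff_le_exp (zero_lt_one.trans (one_lt_nrm v))]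
      have := Nat.lt_floor_add_one (Real.log (nrm v))
      rw [hs v hv] at this
      exact this.le
    have h2 : ∀ v ∈ s, ((nrm v : ℝ) * Real.log (nrm v))⁻¹ ≤
        Real.exp (-k) * 9 * (1 / ((k + 1 : ℕ) : ℝ) ^ 2) * Real.log (nrm v) := by
      intro v hv
      have h3 := Nat.floor_le ((by linarith [hlog v] : (0 : ℝ) ≤ Real.log (nrm v)))
      rw [hs v hv] at h3
      have h4 : ((k : ℝ) + 1) / 3 ≤ Real.log (nrm v) := by
        rcases Nat.eq_zero_or_pos k with rfl | hk
        · have := hlog v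
          push_cast
          linarith
        · have : (1 : ℝ) ≤ k := by exact_mod_cast hk
          linarith
      have h5 : Real.exp k ≤ nrm v :=
        (Real.le_log_iff_exp_le (zero_lt_one.trans (one_lt_nrm v))).mp h3
      have h6 : (0 : ℝ) < ((k : ℝ) + 1) / 3 := by positivity
      set l := Real.log (nrm v)
      have hl : 0 < l := by linarith
      have h7 : 9 * (1 / ((k + 1 : ℕ) : ℝ) ^ 2) = ((((k : ℝ) + 1) / 3) ^ 2)⁻¹ := by
        push_cast
        field_simp
        norm_num
      rw [mul_assoc (Real.exp _), h7, Real.exp_neg]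
      calc ((nrm v : ℝ) * l)⁻¹ = (nrm v : ℝ)⁻¹ * (l ^ 2)⁻¹ * l := by
            field_simp
        _ ≤ _ := by gcongr
    have hC0 : 0 ≤ C := by
      have := Real.log_nonneg (show (1 : ℝ) ≤ 4 by norm_num)
      positivity
    refine (Finset.sum_le_sum h2).trans ?_
    rw [← Finset.mul_sum]
    calc Real.exp (-k) * 9 * (1 / ((k + 1 : ℕ) : ℝ) ^ 2) * ∑ v ∈ s, Real.log (nrm v)
        ≤ Real.exp (-k) * 9 * (1 / ((k + 1 : ℕ) : ℝ) ^ 2) * (C * Real.exp (k + 1)) := by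
          gcongr
          refine le_trans ?_ (sum_log_nrm_primesLE_le K _)
          exact Finset.sum_le_sum_of_subset_of_nonneg h1
            fun v _ _ => Real.log_nonneg (one_lt_nrm v).le
      _ = C * (Real.exp (-k) * Real.exp (k + 1)) * 9 * (1 / ((k + 1 : ℕ) : ℝ) ^ 2) := by ring
      _ = _ := by
          rw [← Real.exp_add]
          ring_nf

lemma summable_nrm_rpow {s : ℝ} (hs : 1 < s) :
    Summable fun v : HeightOneSpectrum (𝓞 K) => (nrm v : ℝ) ^ (-s) := by
  have h := (summable_absNorm_rpow K hs).comp_injective (primeIdeal_injective K)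
  refine h.congr fun v => ?_
  simp only [Function.comp_apply, nrm, primeIdeal]

lemma summable_higher_primePow : Summable fun i : HeightOneSpectrum (𝓞 K) × ℕ =>
    if i.2 = 0 then 0 else Real.log (nrm i.1) * Real.exp (-logNorm K (primePow i)) := by
  have h := (summable_nrm_rpow K (s := 3 / 2) (by norm_num)).mul_of_nonneg
    (g := fun j : ℕ => 4 * (1 / 2 : ℝ) ^ j) (summable_geometric_two.mul_left 4)
    (fun _ => by positivity) (fun _ => by positivity)
  refine h.of_nonneg_of_le (fun i => ?_) fun i => ?_
  · have := Real.log_nonneg (one_lt_nrm i.1).le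
    split_ifs <;> positivity
  · obtain ⟨v, j⟩ := i
    rcases j with _ | j
    · simp only [↓reduceIte]
      positivity
    · simp only [Nat.add_eq_zero_iff, one_ne_zero, and_false, ↓reduceIte]
      rw [exp_neg_logNorm, absNorm_primePow]
      have hN := two_le_nrm v
      have hN2 : (2 : ℝ) ≤ nrm v := by exact_mod_cast hN
      set N : ℝ := (nrm v : ℝ)
      have hN0 : 0 < N := by linarith
      have h1 : Real.log N ≤ N ^ (1 / 2 : ℝ) / (1 / 2) := Real.log_le_rpow_div hN0.le (by norm_num)
      have h2 : (((nrm v) ^ (j + 1 + 1) : ℕ) : ℝ)⁻¹ ≤ N ^ (-2 : ℝ) * (1 / 2) ^ j := by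
        push_cast
        rw [Real.rpow_neg hN0.le, one_div, inv_pow, ← mul_inv, Real.rpow_two]
        apply inv_anti₀ (by positivity)
        calc N ^ 2 * 2 ^ j ≤ N ^ 2 * N ^ j := by gcongr
          _ = _ := by ring
      calc Real.log N * (((nrm v) ^ (j + 1 + 1) : ℕ) : ℝ)⁻¹
          ≤ (N ^ (1 / 2 : ℝ) / (1 / 2)) * (N ^ (-2 : ℝ) * (1 / 2) ^ j) := by gcongr
        _ = (N ^ (1 / 2 : ℝ) * N ^ (-2 : ℝ)) * (4 * (1 / 2) ^ (j + 1)) := by ring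
        _ = _ := by
          rw [← Real.rpow_add hN0]
          norm_num

/-- Mertens' estimate for principal primes. -/
lemma exists_abs_sum_principal_le : ∃ C, ∀ y, 1 ≤ y →
    |∑ v ∈ primesLE K y with ClassGroup.mk0 (primeIdeal v) = 1, Real.log (nrm v) / nrm v
      - Real.log y / classNumber K| ≤ C := by
  obtain ⟨C, hC⟩ := exists_abs_mertens_principal_le K
  have hsum := summable_higher_primePow K
  have hnn : ∀ i : HeightOneSpectrum (𝓞 K) × ℕ, 0 ≤ (if i.2 = 0 then 0 else
      Real.log (nrm i.1) * Real.exp (-logNorm K (primePow i))) := fun i => by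
    have := Real.log_nonneg (one_lt_nrm i.1).le
    split_ifs <;> positivity
  refine ⟨C + ∑' i : HeightOneSpectrum (𝓞 K) × ℕ, (if i.2 = 0 then 0 else
    Real.log (nrm i.1) * Real.exp (-logNorm K (primePow i))), fun y hy => ?_⟩
  have h := hC (Real.log y) (Real.log_nonneg hy)
  set S := (isSize_primePow (K := K).finite (Real.log y)).toFinset with hS
  set p : HeightOneSpectrum (𝓞 K) × ℕ → Prop := fun i => ClassGroup.mk0 (primePow i) = 1
  set t : HeightOneSpectrum (𝓞 K) × ℕ → ℝ :=
    fun i => Real.log (nrm i.1) * Real.exp (-logNorm K (primePow i))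
  have h1 : ∑ v ∈ primesLE K y with ClassGroup.mk0 (primeIdeal v) = 1,
      Real.log (nrm v) / nrm v = ∑ i ∈ S with i.2 = 0, if p i then t i else 0 := by
    rw [hS, ← primesLE_product_eq, Real.exp_log (by linarith), Finset.sum_product,
      Finset.sum_filter]
    refine Finset.sum_congr rfl fun v _ => ?_
    have e : primePow (v, 0) = primeIdeal v := by simp [primePow]
    simp only [Finset.sum_singleton, p, t, e]
    rw [exp_neg_logNorm, div_eq_mul_inv]
    simp only [nrm, primeIdeal]
  have h2 : ∑ i ∈ S with p i, t i = (∑ i ∈ S with i.2 = 0, if p i then t i else 0) +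
      ∑ i ∈ S with ¬ i.2 = 0, if p i then t i else 0 := by
    rw [Finset.sum_filter, Finset.sum_filter_add_sum_filter_not]
  have h3 : 0 ≤ ∑ i ∈ S with ¬ i.2 = 0, if p i then t i else 0 := by
    refine Finset.sum_nonneg fun i _ => ?_
    have := Real.log_nonneg (one_lt_nrm i.1).le
    split_ifs <;> positivity
  have h4 : (∑ i ∈ S with ¬ i.2 = 0, if p i then t i else 0) ≤
      ∑' i : HeightOneSpectrum (𝓞 K) × ℕ, (if i.2 = 0 then 0 else t i) := by
    refine le_trans (Finset.sum_le_sum fun i hi => ?_)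
      (hsum.sum_le_tsum {i ∈ S | ¬ i.2 = 0} fun i _ => hnn i)
    rw [if_neg (Finset.mem_filter.mp hi).2]
    split_ifs
    · exact le_rfl
    · have := Real.log_nonneg (one_lt_nrm i.1).le
      positivity
  rw [h2, ← h1] at h
  rw [abs_le] at h ⊢
  constructor <;> linarith [h.1, h.2]

/-- A lower bound of Chebyshev type for principal primes. -/
lemma exists_card_principal_ge : ∃ B : ℝ, 1 ≤ B ∧ ∀ y, B < y → y / (B * Real.log y) ≤
    ({v ∈ primesLE K y | ClassGroup.mk0 (primeIdeal v) = 1 ∧ y / B < nrm v}.card : ℝ) := by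
  obtain ⟨C, hC⟩ := exists_abs_sum_principal_le K
  have hC0 : 0 ≤ C := (abs_nonneg _).trans (hC 1 le_rfl)
  have hh : (0 : ℝ) < classNumber K := by exact_mod_cast Fintype.card_pos
  set B := Real.exp (classNumber K * (2 * C + 1)) with hB
  have hB1 : 1 ≤ B := Real.one_le_exp (by positivity)
  refine ⟨B, hB1, fun y hy => ?_⟩
  have hy0 : 0 < y := by linarith
  have hlog : 0 < Real.log y := Real.log_pos (by linarith)
  have hyB : 1 ≤ y / B := by
    rw [le_div_iff₀ (by linarith)]
    linarith
  have h1 := (abs_le.mp (hC y (by linarith))).1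
  have h2 := (abs_le.mp (hC (y / B) hyB)).2
  have h3 : Real.log (y / B) = Real.log y - classNumber K * (2 * C + 1) := by
    rw [Real.log_div hy0.ne' (by positivity), hB, Real.log_exp]
  have h4 : Real.log (y / B) / classNumber K = Real.log y / classNumber K - (2 * C + 1) := by
    rw [h3]
    field_simp
  set P := {v ∈ primesLE K y | ClassGroup.mk0 (primeIdeal v) = 1} with hP
  have h5 : {v ∈ P | (nrm v : ℝ) ≤ y / B} =
      {v ∈ primesLE K (y / B) | ClassGroup.mk0 (primeIdeal v) = 1} := by
    ext v
    simp only [hP, Finset.mem_filter, mem_primesLE]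
    constructor
    · tauto
    · rintro ⟨h, h'⟩
      exact ⟨⟨h.trans (div_le_self hy0.le hB1), h'⟩, h⟩
  have h6 := Finset.sum_filter_add_sum_filter_not P (fun v => (nrm v : ℝ) ≤ y / B)
    (fun v => Real.log (nrm v) / nrm v)
  rw [h5] at h6
  have h7 : {v ∈ P | ¬ (nrm v : ℝ) ≤ y / B} =
      {v ∈ primesLE K y | ClassGroup.mk0 (primeIdeal v) = 1 ∧ y / B < nrm v} := by
    rw [hP, Finset.filter_filter]
    simp only [not_le]
  rw [h7] at h6
  have h8 : ∑ v ∈ primesLE K y with (ClassGroup.mk0 (primeIdeal v) = 1 ∧ y / B < nrm v),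
      Real.log (nrm v) / nrm v ≤ ({v ∈ primesLE K y | ClassGroup.mk0 (primeIdeal v) = 1 ∧
        y / B < nrm v}.card : ℝ) * (Real.log y / (y / B)) := by
    rw [← nsmul_eq_mul]
    refine Finset.sum_le_card_nsmul _ _ _ fun v hv => ?_
    simp only [Finset.mem_filter, mem_primesLE] at hv
    have := one_lt_nrm v
    gcongr
    · exact hv.1
    · exact hv.2.2.le
  have h9 : 1 ≤ ({v ∈ primesLE K y | ClassGroup.mk0 (primeIdeal v) = 1 ∧
        y / B < nrm v}.card : ℝ) * (Real.log y / (y / B)) := by linarith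
  rw [div_le_iff₀ (by positivity)]
  rw [div_div_eq_mul_div, ← mul_div_assoc, le_div_iff₀ hy0] at h9
  linarith

end PrimeSums

/-! ### The Selberg sieve -/

section Selberg

variable {ι : Type*} [DecidableEq ι]

lemma sum_Icc_neg_one_pow_card (S T : Finset ι) :
    ∑ D ∈ Finset.Icc T S, (-1 : ℝ) ^ D.card = if T = S then (-1) ^ T.card else 0 := by
  by_cases hTS : T ⊆ S
  · rw [Finset.Icc_eq_image_powerset hTS, Finset.sum_image]
    · have h1 : ∀ E ∈ (S \ T).powerset, (-1 : ℝ) ^ (T ∪ E).card =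
          (-1) ^ T.card * ((-1 : ℤ) ^ E.card : ℤ) := fun E hE => by
        rw [Finset.card_union_of_disjoint, pow_add]
        · push_cast
          rfl
        · exact Finset.disjoint_of_subset_right (Finset.mem_powerset.mp hE) Finset.disjoint_sdiff
      rw [Finset.sum_congr rfl h1, ← Finset.mul_sum, ← Int.cast_sum,
        Finset.sum_powerset_neg_one_pow_card]
      by_cases h : T = S
      · simp [h]
      · have : S \ T ≠ ∅ := fun h' => h (hTS.antisymm (Finset.sdiff_eq_empty_iff_subset.mp h'))
        simp [h, this]
    · intro E hE E' hE' h
      rw [Finset.mem_coe, Finset.mem_powerset] at hE hE'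
      have e : ∀ F ⊆ S \ T, (T ∪ F) \ T = F := fun F hF => by
        rw [Finset.union_sdiff_left]
        exact Finset.sdiff_eq_self_of_disjoint
          (Finset.disjoint_of_subset_left hF Finset.sdiff_disjoint)
      rw [← e E hE, ← e E' hE']
      exact congrArg (· \ T) h
  · rw [Finset.Icc_eq_empty (by simpa using hTS), Finset.sum_empty, if_neg]
    rintro rfl
    exact hTS subset_rfl

variable {𝓕 : Finset (Finset ι)} {g : ι → ℝ}

/-- The weight `∏ g / (1 - g)` of the Selberg sieve. -/
noncomputable def sieveWeight (g : ι → ℝ) (D : Finset ι) : ℝ := ∏ i ∈ D, g i / (1 - g i)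

lemma sieveWeight_pos (hg0 : ∀ i, 0 < g i) (hg1 : ∀ i, g i < 1) (D : Finset ι) :
    0 < sieveWeight g D :=
  Finset.prod_pos fun i _ => div_pos (hg0 i) (sub_pos.mpr (hg1 i))

lemma inv_prod_eq_sum (hg0 : ∀ i, 0 < g i) (hg1 : ∀ i, g i < 1) (D : Finset ι) :
    (∏ i ∈ D, g i)⁻¹ = ∑ T ∈ D.powerset, (sieveWeight g T)⁻¹ := by
  simp only [sieveWeight, ← Finset.prod_inv_distrib]
  rw [← Finset.prod_one_add]
  refine Finset.prod_congr rfl fun i _ => ?_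
  have h0 := (hg0 i).ne'
  have h1 := (sub_pos.mpr (hg1 i)).ne'
  field_simp
  ring

/-- The coefficient `λ_D g(D)` of the Selberg sieve. -/
noncomputable def sieveCoeff (𝓕 : Finset (Finset ι)) (g : ι → ℝ) (D : Finset ι) : ℝ :=
  (-1) ^ D.card / (∑ T ∈ 𝓕, sieveWeight g T) * ∑ S ∈ 𝓕 with D ⊆ S, sieveWeight g S

lemma abs_sieveCoeff_le (hg0 : ∀ i, 0 < g i) (hg1 : ∀ i, g i < 1) (D : Finset ι) :
    |sieveCoeff 𝓕 g D| ≤ 1 := by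
  have h0 : ∀ s : Finset (Finset ι), 0 ≤ ∑ T ∈ s, sieveWeight g T := fun s =>
    Finset.sum_nonneg fun T _ => (sieveWeight_pos hg0 hg1 T).le
  rw [sieveCoeff, abs_mul, abs_div, abs_pow, abs_neg, abs_one, one_pow, abs_of_nonneg (h0 _),
    abs_of_nonneg (h0 _), one_div, inv_mul_eq_div]
  refine div_le_one_of_le₀ ?_ (h0 _)
  exact Finset.sum_le_sum_of_subset_of_nonneg (Finset.filter_subset _ _)
    fun T _ _ => (sieveWeight_pos hg0 hg1 T).le

lemma sum_sieveCoeff (h𝓕 : ∀ D ∈ 𝓕, ∀ E ⊆ D, E ∈ 𝓕) {T : Finset ι} (hT : T ∈ 𝓕) :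
    ∑ D ∈ 𝓕 with T ⊆ D, sieveCoeff 𝓕 g D =
      (-1) ^ T.card * sieveWeight g T / ∑ T ∈ 𝓕, sieveWeight g T := by
  set G := ∑ T ∈ 𝓕, sieveWeight g T
  simp only [sieveCoeff, Finset.mul_sum]
  rw [Finset.sum_comm' (s' := fun S => Finset.Icc T S) (t' := 𝓕)]
  · have h1 : ∀ S ∈ 𝓕, ∑ D ∈ Finset.Icc T S, (-1) ^ D.card / G * sieveWeight g S =
        if T = S then (-1) ^ T.card / G * sieveWeight g S else 0 := by
      intro S _
      rw [← Finset.sum_mul, ← Finset.sum_div, sum_Icc_neg_one_pow_card]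
      split_ifs <;> simp
    rw [Finset.sum_congr rfl h1, Finset.sum_ite_eq, if_pos hT]
    ring
  · intro D S
    simp only [Finset.mem_filter, Finset.mem_Icc]
    constructor
    · tauto
    · rintro ⟨⟨h1, h2⟩, h3⟩
      exact ⟨⟨h𝓕 S h3 D h2, h1⟩, h3, h2⟩

lemma sum_sieveCoeff_mul_div (hg0 : ∀ i, 0 < g i) (hg1 : ∀ i, g i < 1)
    (h𝓕 : ∀ D ∈ 𝓕, ∀ E ⊆ D, E ∈ 𝓕) (hne : 𝓕.Nonempty) :
    ∑ D₁ ∈ 𝓕, ∑ D₂ ∈ 𝓕, sieveCoeff 𝓕 g D₁ * sieveCoeff 𝓕 g D₂ / ∏ i ∈ D₁ ∩ D₂, g i =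
      (∑ T ∈ 𝓕, sieveWeight g T)⁻¹ := by
  have hG : 0 < ∑ T ∈ 𝓕, sieveWeight g T :=
    Finset.sum_pos (fun T _ => sieveWeight_pos hg0 hg1 T) hne
  set G := ∑ T ∈ 𝓕, sieveWeight g T with hGdef
  have h1 : ∀ D₁ ∈ 𝓕, ∀ D₂, sieveCoeff 𝓕 g D₁ * sieveCoeff 𝓕 g D₂ / ∏ i ∈ D₁ ∩ D₂, g i =
      ∑ T ∈ 𝓕, (sieveWeight g T)⁻¹ * ((if T ⊆ D₁ then sieveCoeff 𝓕 g D₁ else 0) *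
        (if T ⊆ D₂ then sieveCoeff 𝓕 g D₂ else 0)) := by
    intro D₁ hD₁ D₂
    rw [div_eq_mul_inv, inv_prod_eq_sum hg0 hg1, Finset.mul_sum]
    have h2 : (D₁ ∩ D₂).powerset = {T ∈ 𝓕 | T ⊆ D₁ ∧ T ⊆ D₂} := by
      ext T
      simp only [Finset.mem_powerset, Finset.subset_inter_iff, Finset.mem_filter]
      exact ⟨fun h => ⟨h𝓕 _ hD₁ _ h.1, h⟩, fun h => h.2⟩
    rw [h2, Finset.sum_filter]
    refine Finset.sum_congr rfl fun T _ => ?_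
    by_cases h3 : T ⊆ D₁ <;> by_cases h4 : T ⊆ D₂ <;> simp [h3, h4, mul_comm]
  rw [Finset.sum_congr rfl fun D₁ hD₁ => Finset.sum_congr rfl fun D₂ _ => h1 D₁ hD₁ D₂]
  rw [Finset.sum_congr rfl fun D₁ _ => Finset.sum_comm, Finset.sum_comm]
  have h5 : ∀ T ∈ 𝓕, ∑ D₁ ∈ 𝓕, ∑ D₂ ∈ 𝓕, (sieveWeight g T)⁻¹ *
      ((if T ⊆ D₁ then sieveCoeff 𝓕 g D₁ else 0) * (if T ⊆ D₂ then sieveCoeff 𝓕 g D₂ else 0)) =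
      sieveWeight g T / G ^ 2 := by
    intro T hT
    simp only [← Finset.mul_sum, ← Finset.sum_mul]
    rw [← Finset.sum_filter, sum_sieveCoeff h𝓕 hT, ← hGdef]
    have h6 := (sieveWeight_pos hg0 hg1 T).ne'
    have h7 : ((-1 : ℝ) ^ T.card) * (-1) ^ T.card = 1 := by
      rw [← mul_pow]
      simp
    field_simp
    linear_combination h7
  rw [Finset.sum_congr rfl h5, ← Finset.sum_div, ← hGdef]
  field_simp

/-- **The Selberg upper bound sieve**, with a crude error term. -/
theorem selberg_sieve {α : Type*} (A U : Finset α) (hU : U ⊆ A) (bad : ι → α → Prop)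
    [∀ a, DecidablePred fun D : Finset ι => ∀ i ∈ D, bad i a]
    [∀ D : Finset ι, DecidablePred fun a => ∀ i ∈ D, bad i a]
    (X : ℝ) (hg0 : ∀ i, 0 < g i) (hg1 : ∀ i, g i < 1)
    (h𝓕 : ∀ D ∈ 𝓕, ∀ E ⊆ D, E ∈ 𝓕) (h𝓕e : ∅ ∈ 𝓕)
    (hUbad : ∀ a ∈ U, ∀ D ∈ 𝓕, ∀ i ∈ D, ¬ bad i a) :
    (U.card : ℝ) ≤ X / (∑ T ∈ 𝓕, sieveWeight g T) + ∑ D₁ ∈ 𝓕, ∑ D₂ ∈ 𝓕,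
      |({a ∈ A | ∀ i ∈ D₁ ∪ D₂, bad i a}.card : ℝ) - X * ∏ i ∈ D₁ ∪ D₂, g i| /
        ((∏ i ∈ D₁, g i) * ∏ i ∈ D₂, g i) := by
  have hp : ∀ D : Finset ι, 0 < ∏ i ∈ D, g i := fun D => Finset.prod_pos fun i _ => hg0 i
  set c : Finset ι → ℝ := fun D => sieveCoeff 𝓕 g D / ∏ i ∈ D, g i with hc
  have hG : 0 < ∑ T ∈ 𝓕, sieveWeight g T :=
    Finset.sum_pos (fun T _ => sieveWeight_pos hg0 hg1 T) ⟨_, h𝓕e⟩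
  have hc0 : c ∅ = 1 := by
    simp [hc, sieveCoeff, hG.ne']
  have h1 : (U.card : ℝ) ≤ ∑ a ∈ A, (∑ D ∈ 𝓕 with ∀ i ∈ D, bad i a, c D) ^ 2 := by
    have h2 : ∀ a ∈ U, (1 : ℝ) = (∑ D ∈ 𝓕 with ∀ i ∈ D, bad i a, c D) ^ 2 := by
      intro a ha
      have h3 : {D ∈ 𝓕 | ∀ i ∈ D, bad i a} = {∅} := by
        ext D
        simp only [Finset.mem_filter, Finset.mem_singleton]
        constructor
        · rintro ⟨h4, h5⟩
          exact Finset.eq_empty_of_forall_notMem fun i hi => hUbad a ha D h4 i hi (h5 i hi)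
        · rintro rfl
          exact ⟨h𝓕e, by simp⟩
      rw [h3, Finset.sum_singleton, hc0, one_pow]
    rw [Finset.card_eq_sum_ones]
    push_cast
    rw [Finset.sum_congr rfl h2]
    exact Finset.sum_le_sum_of_subset_of_nonneg hU fun a _ _ => sq_nonneg _
  have h2 : ∑ a ∈ A, (∑ D ∈ 𝓕 with ∀ i ∈ D, bad i a, c D) ^ 2 = ∑ D₁ ∈ 𝓕, ∑ D₂ ∈ 𝓕,
      c D₁ * c D₂ * ({a ∈ A | ∀ i ∈ D₁ ∪ D₂, bad i a}.card : ℝ) := by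
    have h3 : ∀ a ∈ A, (∑ D ∈ 𝓕 with ∀ i ∈ D, bad i a, c D) ^ 2 = ∑ D₁ ∈ 𝓕, ∑ D₂ ∈ 𝓕,
        if (∀ i ∈ D₁ ∪ D₂, bad i a) then c D₁ * c D₂ else 0 := by
      intro a _
      rw [sq, Finset.sum_filter, Finset.sum_mul_sum]
      refine Finset.sum_congr rfl fun D₁ _ => Finset.sum_congr rfl fun D₂ _ => ?_
      have : (∀ i ∈ D₁ ∪ D₂, bad i a) ↔ (∀ i ∈ D₁, bad i a) ∧ ∀ i ∈ D₂, bad i a := by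
        simp only [Finset.mem_union]
        exact ⟨fun h => ⟨fun i hi => h i (.inl hi), fun i hi => h i (.inr hi)⟩,
          fun h i hi => hi.elim (h.1 i) (h.2 i)⟩
      by_cases h5 : ∀ i ∈ D₁, bad i a
      · by_cases h6 : ∀ i ∈ D₂, bad i a
        · rw [if_pos h5, if_pos h6, if_pos (this.mpr ⟨h5, h6⟩)]
        · rw [if_neg h6, mul_zero, if_neg fun h => h6 (this.mp h).2]
      · rw [if_neg h5, zero_mul, if_neg fun h => h5 (this.mp h).1]
    rw [Finset.sum_congr rfl h3, Finset.sum_comm]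
    refine Finset.sum_congr rfl fun D₁ _ => ?_
    rw [Finset.sum_comm]
    refine Finset.sum_congr rfl fun D₂ _ => ?_
    rw [← Finset.sum_filter, Finset.sum_const, nsmul_eq_mul, mul_comm]
  have h3 : X / (∑ T ∈ 𝓕, sieveWeight g T) =
      ∑ D₁ ∈ 𝓕, ∑ D₂ ∈ 𝓕, c D₁ * c D₂ * (X * ∏ i ∈ D₁ ∪ D₂, g i) := by
    rw [div_eq_mul_inv, ← sum_sieveCoeff_mul_div hg0 hg1 h𝓕 ⟨_, h𝓕e⟩, Finset.mul_sum]
    refine Finset.sum_congr rfl fun D₁ _ => ?_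
    rw [Finset.mul_sum]
    refine Finset.sum_congr rfl fun D₂ _ => ?_
    have h4 := Finset.prod_union_inter (s₁ := D₁) (s₂ := D₂) (f := g)
    have h5 := (hp D₁).ne'
    have h6 := (hp D₂).ne'
    have h7 := (hp (D₁ ∩ D₂)).ne'
    simp only [hc]
    field_simp
    linear_combination -(sieveCoeff 𝓕 g D₁ * sieveCoeff 𝓕 g D₂ * X) * h4
  refine h1.trans (h2.le.trans ?_)
  rw [h3, ← Finset.sum_add_distrib]
  refine Finset.sum_le_sum fun D₁ _ => ?_
  rw [← Finset.sum_add_distrib]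
  refine Finset.sum_le_sum fun D₂ _ => ?_
  rw [← sub_le_iff_le_add', ← mul_sub]
  refine (le_abs_self _).trans ?_
  rw [abs_mul, div_eq_inv_mul]
  gcongr
  simp only [hc]
  rw [abs_mul, abs_div, abs_div, abs_of_pos (hp D₁), abs_of_pos (hp D₂), div_mul_div_comm,
    div_eq_mul_inv]
  have h8 := mul_le_mul (abs_sieveCoeff_le (𝓕 := 𝓕) hg0 hg1 D₁)
    (abs_sieveCoeff_le (𝓕 := 𝓕) hg0 hg1 D₂) (abs_nonneg _) zero_le_one
  rw [one_mul] at h8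
  exact mul_le_of_le_one_left (inv_nonneg.mpr (mul_pos (hp _) (hp _)).le) h8

end Selberg

/-! ### Counting in boxes -/

section Box

open scoped Classical
open IsDedekindDomain UniqueFactorizationMonoid Filter

variable (K : Type*) [Field K] [NumberField K]

/-- The integers all of whose coordinates in the fixed integral basis lie in `[a, c)`. -/
noncomputable def box (a c : ℤ) : Finset (𝓞 K) :=
  (Fintype.piFinset fun _ => Finset.Ico a c).map
    (RingOfIntegers.basis K).equivFun.symm.toEquiv.toEmbedding

variable {K}

lemma mem_box {a c : ℤ} {α : 𝓞 K} : α ∈ box K a c ↔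
    ∀ i, a ≤ (RingOfIntegers.basis K).repr α i ∧ (RingOfIntegers.basis K).repr α i < c := by
  simp only [box, Finset.mem_map_equiv, Fintype.mem_piFinset, Finset.mem_Ico]
  rfl

variable (K) in
lemma card_box (a : ℤ) (m : ℕ) : (box K a (a + m)).card = m ^ finrank ℚ K := by
  rw [box, Finset.card_map, Fintype.card_piFinset, Finset.prod_const, Int.card_Ico,
    ← RingOfIntegers.rank K, Finset.card_univ, ← finrank_eq_card_chooseBasisIndex]
  congr 1
  omega

/-- Representatives of residue classes with small coordinates. -/
lemma exists_mem_box_sub_mem (D : Finset (HeightOneSpectrum (𝓞 K)))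
    (x : HeightOneSpectrum (𝓞 K) → 𝓞 K) :
    ∃ r ∈ box K 0 ((∏ v ∈ D, nrm v : ℕ) : ℤ), ∀ v ∈ D, r - x v ∈ v.asIdeal := by
  obtain ⟨r, hr⟩ := Ideal.exists_forall_sub_mem_ideal (I := fun v : D => v.1.asIdeal)
    (fun _ _ h => heightOneSpectrum_isCoprime fun h' => h (Subtype.ext h')) fun v => x v
  set m : ℕ := ∏ v ∈ D, nrm v with hm
  have hm0 : 0 < m := Finset.prod_pos fun v _ => by linarith [two_le_nrm v]
  set b := RingOfIntegers.basis K
  have hmem : ∀ v ∈ D, (m : 𝓞 K) ∈ v.asIdeal := fun v hv => by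
    have : (nrm v : 𝓞 K) ∣ m :=
      Nat.cast_dvd_cast (Finset.dvd_prod_of_mem nrm hv)
    exact Ideal.mem_of_dvd _ this (Ideal.absNorm_mem _)
  refine ⟨b.equivFun.symm fun i => b.repr r i % m, ?_, fun v hv => ?_⟩
  · rw [mem_box]
    intro i
    have h1 : b.repr (b.equivFun.symm fun i => b.repr r i % m) i = b.repr r i % m := by
      rw [← b.equivFun_apply, LinearEquiv.apply_symm_apply]
    rw [h1]
    exact ⟨Int.emod_nonneg _ (by omega), Int.emod_lt_of_pos _ (by omega)⟩
  · have h2 : r - (b.equivFun.symm fun i => b.repr r i % m) =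
        (m : 𝓞 K) * b.equivFun.symm fun i => b.repr r i / m := by
      have : r = b.equivFun.symm fun i => b.repr r i := by
        rw [eq_comm, LinearEquiv.symm_apply_eq]
        rfl
      nth_rewrite 1 [this]
      rw [← map_sub, ← nsmul_eq_mul, ← map_nsmul]
      congr 1
      ext i
      simp only [Pi.sub_apply, Pi.smul_apply, nsmul_eq_mul]
      linarith [Int.mul_ediv_add_emod (b.repr r i) m]
    have h3 : (b.equivFun.symm fun i => b.repr r i % m) - x v = (r - x v) -
        (m : 𝓞 K) * b.equivFun.symm fun i => b.repr r i / m := by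
      rw [← h2]
      ring
    rw [h3]
    exact v.asIdeal.sub_mem (hr ⟨v, hv⟩) (Ideal.mul_mem_right _ _ (hmem v hv))

lemma card_quotient (v : HeightOneSpectrum (𝓞 K)) : Nat.card (𝓞 K ⧸ v.asIdeal) = nrm v := rfl

lemma finite_quotient (v : HeightOneSpectrum (𝓞 K)) : Finite (𝓞 K ⧸ v.asIdeal) :=
  Nat.finite_of_card_ne_zero (by rw [card_quotient]; linarith [two_le_nrm v])

/-- The number of elements of a box whose residue classes satisfy `α ∈ v` or `α + h ∈ v`
for every `v` in a finite set of primes. -/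
lemma abs_card_box_sub_le (L : ℕ) (h : 𝓞 K) (D : Finset (HeightOneSpectrum (𝓞 K)))
    (hD : ∀ v ∈ D, h ∉ v.asIdeal) :
    |({α ∈ box K (-L) L | ∀ v ∈ D, α ∈ v.asIdeal ∨ α + h ∈ v.asIdeal}.card : ℝ) -
      (2 * L) ^ finrank ℚ K * ∏ v ∈ D, (2 / nrm v : ℝ)| ≤
      (2 * L + (∏ v ∈ D, nrm v : ℕ)) ^ finrank ℚ K - (2 * L) ^ finrank ℚ K := by
  set n := finrank ℚ K
  set m : ℕ := ∏ v ∈ D, nrm v with hm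
  set Φ : 𝓞 K → Prop := fun α => ∀ v ∈ D, α ∈ v.asIdeal ∨ α + h ∈ v.asIdeal with hΦ
  have hfin : ∀ v : HeightOneSpectrum (𝓞 K), Fintype (𝓞 K ⧸ v.asIdeal) := fun v =>
    have := finite_quotient v
    Fintype.ofFinite _
  have hYcard : Fintype.card ((v : D) → 𝓞 K ⧸ v.1.asIdeal) = m := by
    rw [Fintype.card_pi, hm, ← Finset.prod_coe_sort D]
    refine Finset.prod_congr rfl fun v _ => ?_
    rw [← card_quotient, Nat.card_eq_fintype_card]
  have ht : ∀ y : ((v : D) → 𝓞 K ⧸ v.1.asIdeal), ∃ r ∈ box K 0 (m : ℤ),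
      ∀ v : D, Ideal.Quotient.mk v.1.asIdeal r = y v := by
    intro y
    obtain ⟨r, hr, hr'⟩ := exists_mem_box_sub_mem D fun v =>
      if hv : v ∈ D then (Ideal.Quotient.mk_surjective (y ⟨v, hv⟩)).choose else 0
    refine ⟨r, hr, fun v => ?_⟩
    have := hr' v v.2
    rw [dif_pos v.2] at this
    rw [Ideal.Quotient.mk_eq_mk_iff_sub_mem r _ |>.mpr this]
    exact (Ideal.Quotient.mk_surjective (y ⟨v, v.2⟩)).choose_spec
  choose t ht htv using ht
  have hcount : ∀ β : 𝓞 K,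
      (Finset.univ.filter fun y : ((v : D) → 𝓞 K ⧸ v.1.asIdeal) => Φ (β + t y)).card =
        2 ^ D.card := by
    intro β
    have h1 : (Finset.univ.filter fun y : ((v : D) → 𝓞 K ⧸ v.1.asIdeal) => Φ (β + t y)) =
        Fintype.piFinset fun v : D =>
        {-(Ideal.Quotient.mk v.1.asIdeal β), -(Ideal.Quotient.mk v.1.asIdeal (β + h))} := by
      ext y
      simp only [Finset.mem_filter, Finset.mem_univ, true_and, Fintype.mem_piFinset, hΦ,
        Finset.mem_insert, Finset.mem_singleton]
      rw [← Subtype.forall (p := fun v => v ∈ D)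
        (q := fun v => β + t y ∈ v.1.asIdeal ∨ β + t y + h ∈ v.1.asIdeal)]
      refine forall_congr' fun v => ?_
      rw [← Ideal.Quotient.eq_zero_iff_mem, ← Ideal.Quotient.eq_zero_iff_mem, ← htv y v,
        eq_neg_iff_add_eq_zero, eq_neg_iff_add_eq_zero, ← map_add, ← map_add,
        add_comm β, ← add_assoc]
    rw [h1, Fintype.card_piFinset]
    have h2 : ∀ v : D, ({-(Ideal.Quotient.mk v.1.asIdeal β),
        -(Ideal.Quotient.mk v.1.asIdeal (β + h))} : Finset (𝓞 K ⧸ v.1.asIdeal)).card = 2 := by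
      intro v
      rw [Finset.card_pair]
      intro h3
      rw [neg_inj, map_add, left_eq_add, Ideal.Quotient.eq_zero_iff_mem] at h3
      exact hD v v.2 h3
    rw [Finset.prod_congr rfl fun v _ => h2 v, Finset.prod_const, Finset.card_univ,
      Fintype.card_coe]
  have hcL : (box K (-L) L).card = (2 * L) ^ n := by
    have := card_box K (-L) (2 * L)
    rwa [show (-L + (2 * L : ℕ) : ℤ) = L by push_cast; ring] at this
  have hcB : (box K (-L) (L + m)).card = (2 * L + m) ^ n := by
    have := card_box K (-L) (2 * L + m)
    rwa [show (-L + (2 * L + m : ℕ) : ℤ) = L + m by push_cast; ring] at this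
  set E : ℝ := (2 * L + m) ^ n - (2 * L) ^ n with hE
  set A := {α ∈ box K (-L) L | Φ α} with hA
  have hsub : box K (-L) L ⊆ box K (-L) (L + m) := fun α hα => by
    rw [mem_box] at hα ⊢
    exact fun i => ⟨(hα i).1, by have := (hα i).2; omega⟩
  have hmain : ∀ y : ((v : D) → 𝓞 K ⧸ v.1.asIdeal),
      |({β ∈ box K (-L) L | Φ (β + t y)}.card : ℝ) - A.card| ≤ E := by
    intro y
    set S := (box K (-L) L).map (addRightEmbedding (t y)) with hS
    have hSsub : S ⊆ box K (-L) (L + m) := fun α hα => by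
      rw [hS, Finset.mem_map] at hα
      obtain ⟨β, hβ, rfl⟩ := hα
      have h1 := ht y
      rw [mem_box] at hβ h1 ⊢
      intro i
      have h2 := hβ i
      have h3 := h1 i
      simp only [addRightEmbedding_apply, map_add, Finsupp.add_apply]
      omega
    have hScard : S.card = (2 * L) ^ n := by rw [hS, Finset.card_map, hcL]
    have hB : {β ∈ box K (-L) L | Φ (β + t y)}.card = {α ∈ S | Φ α}.card := by
      rw [hS, Finset.filter_map, Finset.card_map]
      rfl
    have key : ∀ S₁ S₂ : Finset (𝓞 K), S₁ ⊆ box K (-L) (L + m) → S₂ ⊆ box K (-L) (L + m) →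
        S₂.card = (2 * L) ^ n → ({α ∈ S₁ | Φ α}.card : ℝ) ≤ {α ∈ S₂ | Φ α}.card + E := by
      intro S₁ S₂ h₁ h₂ hc
      have h3 : {α ∈ S₁ | Φ α} ⊆ {α ∈ S₂ | Φ α} ∪ (box K (-L) (L + m) \ S₂) := fun α hα => by
        rw [Finset.mem_filter] at hα
        rw [Finset.mem_union, Finset.mem_filter, Finset.mem_sdiff]
        by_cases h4 : α ∈ S₂
        · exact .inl ⟨h4, hα.2⟩
        · exact .inr ⟨h₁ hα.1, h4⟩
      have h4 := (Finset.card_le_card h3).trans (Finset.card_union_le _ _)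
      have h5 := Finset.card_sdiff_add_card_eq_card h₂
      rw [hc, hcB] at h5
      have h5' : ((box K (-L) (L + m) \ S₂).card : ℝ) = E := by
        rw [hE, eq_sub_iff_add_eq]
        exact_mod_cast h5
      rw [← h5']
      exact_mod_cast h4
    rw [hB, abs_sub_le_iff]
    constructor
    · have := key S (box K (-L) L) hSsub hsub hcL
      linarith
    · have := key (box K (-L) L) S hsub hSsub hScard
      linarith
  have hdouble : ∑ y : ((v : D) → 𝓞 K ⧸ v.1.asIdeal), ({β ∈ box K (-L) L | Φ (β + t y)}.card : ℝ) =
      2 ^ D.card * (2 * L) ^ n := by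
    have h1 : ∑ y : ((v : D) → 𝓞 K ⧸ v.1.asIdeal), {β ∈ box K (-L) L | Φ (β + t y)}.card =
        ∑ β ∈ box K (-L) L,
          (Finset.univ.filter fun y : ((v : D) → 𝓞 K ⧸ v.1.asIdeal) => Φ (β + t y)).card := by
      simp only [Finset.card_filter]
      exact Finset.sum_comm
    rw [Finset.sum_congr rfl fun β _ => hcount β, Finset.sum_const, hcL, smul_eq_mul] at h1
    rw [mul_comm]
    exact_mod_cast h1
  have hm0 : (0 : ℝ) < m := by
    exact_mod_cast Finset.prod_pos fun v (_ : v ∈ D) => by linarith [two_le_nrm v]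
  have hprod : ∏ v ∈ D, (2 / nrm v : ℝ) = 2 ^ D.card / m := by
    rw [Finset.prod_div_distrib, Finset.prod_const, hm]
    push_cast
    rfl
  have hsum : |∑ y : ((v : D) → 𝓞 K ⧸ v.1.asIdeal),
      (({β ∈ box K (-L) L | Φ (β + t y)}.card : ℝ) - A.card)| ≤ m * E := by
    refine (Finset.abs_sum_le_sum_abs _ _).trans ?_
    refine (Finset.sum_le_card_nsmul _ _ _ fun y _ => hmain y).trans ?_
    rw [Finset.card_univ, hYcard, nsmul_eq_mul]
  rw [Finset.sum_sub_distrib, hdouble, Finset.sum_const, Finset.card_univ, hYcard,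
    nsmul_eq_mul] at hsum
  rw [hprod, abs_sub_comm]
  rw [← mul_le_mul_iff_right₀ hm0]
  refine le_of_eq_of_le ?_ hsum
  rw [← abs_of_pos hm0, ← abs_mul, abs_of_pos hm0]
  congr 1
  field_simp

end Box

/-! ### The main term of the sieve -/

section SieveSums

open scoped Classical
open IsDedekindDomain UniqueFactorizationMonoid Filter

lemma sum_le_sum_of_injOn {α β : Type*} {s : Finset α} {t : Finset β} (e : α → β)
    {f : α → ℝ} {g : β → ℝ} (hmap : ∀ a ∈ s, e a ∈ t) (hinj : Set.InjOn e s)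
    (hfg : ∀ a ∈ s, f a = g (e a)) (hg : ∀ b ∈ t, 0 ≤ g b) : ∑ a ∈ s, f a ≤ ∑ b ∈ t, g b := by
  rw [Finset.sum_congr rfl hfg, ← Finset.sum_image (g := e) hinj]
  exact Finset.sum_le_sum_of_subset_of_nonneg (Finset.image_subset_iff.mpr hmap)
    fun b hb _ => hg b hb

variable {K : Type*} [Field K] [NumberField K]

/-- The norm of a product of distinct primes. -/
noncomputable def setNorm (D : Finset (HeightOneSpectrum (𝓞 K))) : ℝ := ∏ v ∈ D, (nrm v : ℝ)

lemma one_le_setNorm (D : Finset (HeightOneSpectrum (𝓞 K))) : 1 ≤ setNorm D :=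
  Finset.one_le_prod fun v _ => (one_lt_nrm v).le

lemma setNorm_pos (D : Finset (HeightOneSpectrum (𝓞 K))) : 0 < setNorm D :=
  zero_lt_one.trans_le (one_le_setNorm D)

lemma setNorm_union {D E : Finset (HeightOneSpectrum (𝓞 K))} (h : Disjoint D E) :
    setNorm (D ∪ E) = setNorm D * setNorm E :=
  Finset.prod_union h

lemma setNorm_mono {D E : Finset (HeightOneSpectrum (𝓞 K))} (h : D ⊆ E) :
    setNorm D ≤ setNorm E := by
  rw [← Finset.union_sdiff_of_subset h, setNorm_union Finset.disjoint_sdiff]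
  exact le_mul_of_one_le_right (setNorm_pos D).le (one_le_setNorm _)

lemma nrm_le_setNorm {D : Finset (HeightOneSpectrum (𝓞 K))} {v : HeightOneSpectrum (𝓞 K)}
    (hv : v ∈ D) : (nrm v : ℝ) ≤ setNorm D := by
  have := setNorm_mono (Finset.singleton_subset_iff.mpr hv)
  rwa [setNorm, Finset.prod_singleton] at this

/-- The sets of primes outside `B` with product of norms at most `z`. -/
noncomputable def sieveFamily (B : Finset (HeightOneSpectrum (𝓞 K))) (z : ℝ) :
    Finset (Finset (HeightOneSpectrum (𝓞 K))) :=
  {D ∈ (primesLE K z \ B).powerset | setNorm D ≤ z}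

lemma mem_sieveFamily {B D : Finset (HeightOneSpectrum (𝓞 K))} {z : ℝ} :
    D ∈ sieveFamily B z ↔ Disjoint D B ∧ setNorm D ≤ z := by
  rw [sieveFamily, Finset.mem_filter, Finset.mem_powerset, Finset.subset_sdiff]
  constructor
  · tauto
  · exact fun h => ⟨⟨fun v hv => mem_primesLE.mpr ((nrm_le_setNorm hv).trans h.2), h.1⟩, h.2⟩

variable (K) in
lemma exists_sum_inv_setNorm_sq_le : ∃ C : ℝ, 0 < C ∧
    ∀ P : Finset (HeightOneSpectrum (𝓞 K)), ∑ D ∈ P.powerset, (setNorm D ^ 2)⁻¹ ≤ C := by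
  have hs := summable_nrm_rpow K (s := 2) one_lt_two
  refine ⟨Real.exp (∑' v : HeightOneSpectrum (𝓞 K), (nrm v : ℝ) ^ (-2 : ℝ)), Real.exp_pos _,
    fun P => ?_⟩
  have h1 : ∑ D ∈ P.powerset, (setNorm D ^ 2)⁻¹ = ∏ v ∈ P, (1 + (nrm v : ℝ) ^ (-2 : ℝ)) := by
    rw [Finset.prod_one_add]
    refine Finset.sum_congr rfl fun D _ => ?_
    rw [setNorm, ← Finset.prod_pow, ← Finset.prod_inv_distrib]
    refine Finset.prod_congr rfl fun v _ => ?_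
    rw [Real.rpow_neg (Nat.cast_nonneg _), Real.rpow_two]
  rw [h1]
  refine (Real.prod_one_add_le_exp_sum _ fun v => by positivity).trans ?_
  exact Real.exp_le_exp.mpr (hs.sum_le_tsum _ fun v _ => by positivity)

variable (K) in
lemma exists_card_sieveFamily_le : ∃ C : ℝ, 0 < C ∧
    ∀ (B : Finset (HeightOneSpectrum (𝓞 K))) (z : ℝ), ((sieveFamily B z).card : ℝ) ≤ C * z ^ 2 := by
  obtain ⟨C, hC0, hC⟩ := exists_sum_inv_setNorm_sq_le K
  refine ⟨C, hC0, fun B z => ?_⟩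
  have h1 : ∀ D ∈ sieveFamily B z, (1 : ℝ) ≤ (setNorm D ^ 2)⁻¹ * z ^ 2 := fun D hD => by
    have := (mem_sieveFamily.mp hD).2
    have h0 := setNorm_pos D
    rw [inv_mul_eq_div, one_le_div (by positivity)]
    gcongr
  calc ((sieveFamily B z).card : ℝ) = ∑ D ∈ sieveFamily B z, (1 : ℝ) := by simp
    _ ≤ ∑ D ∈ sieveFamily B z, (setNorm D ^ 2)⁻¹ * z ^ 2 := Finset.sum_le_sum h1
    _ ≤ ∑ D ∈ (primesLE K z \ B).powerset, (setNorm D ^ 2)⁻¹ * z ^ 2 :=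
        Finset.sum_le_sum_of_subset_of_nonneg (Finset.filter_subset _ _)
          fun D _ _ => by positivity
    _ ≤ C * z ^ 2 := by
        rw [← Finset.sum_mul]
        gcongr
        exact hC _

variable (K) in
lemma exists_sq_sum_inv_setNorm_le : ∃ C : ℝ, 0 < C ∧
    ∀ (B : Finset (HeightOneSpectrum (𝓞 K))) (y : ℝ),
      (∑ D ∈ sieveFamily B y, (setNorm D)⁻¹) ^ 2 ≤
        C * ∑ S ∈ sieveFamily B (y ^ 2), 2 ^ S.card * (setNorm S)⁻¹ := by
  obtain ⟨C, hC0, hC⟩ := exists_sum_inv_setNorm_sq_le K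
  refine ⟨C, hC0, fun B y => ?_⟩
  set P := primesLE K y
  rw [sq, Finset.sum_mul_sum, ← Finset.sum_product']
  have h1 : ∑ S ∈ sieveFamily B (y ^ 2), 2 ^ S.card * (setNorm S)⁻¹ =
      ∑ q ∈ (sieveFamily B (y ^ 2)).sigma fun S => S.powerset, (setNorm q.1)⁻¹ := by
    rw [Finset.sum_sigma]
    refine Finset.sum_congr rfl fun S _ => ?_
    dsimp only
    rw [Finset.sum_const, Finset.card_powerset, nsmul_eq_mul]
    push_cast
    rfl
  rw [h1]
  refine le_trans ?_ (mul_le_mul_of_nonneg_right (hC P)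
    (Finset.sum_nonneg fun q _ => inv_nonneg.mpr (setNorm_pos _).le))
  rw [Finset.sum_mul_sum, ← Finset.sum_product']
  have h2 : ∀ D₁ D₂ : Finset (HeightOneSpectrum (𝓞 K)),
      setNorm D₁ * setNorm D₂ = setNorm (D₁ ∩ D₂) ^ 2 * setNorm (symmDiff D₁ D₂) := by
    intro D₁ D₂
    have e1 : setNorm D₁ = setNorm (D₁ \ D₂) * setNorm (D₁ ∩ D₂) := by
      rw [← setNorm_union (Finset.disjoint_sdiff_inter _ _), Finset.sdiff_union_inter]
    have e2 : setNorm D₂ = setNorm (D₂ \ D₁) * setNorm (D₁ ∩ D₂) := by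
      rw [Finset.inter_comm, ← setNorm_union (Finset.disjoint_sdiff_inter _ _),
        Finset.sdiff_union_inter]
    have e3 : setNorm (symmDiff D₁ D₂) = setNorm (D₁ \ D₂) * setNorm (D₂ \ D₁) :=
      setNorm_union disjoint_sdiff_sdiff
    rw [e1, e2, e3]
    ring
  refine sum_le_sum_of_injOn (fun p => (p.1 ∩ p.2, ⟨symmDiff p.1 p.2, p.1 \ p.2⟩)) ?_ ?_ ?_ ?_
  · rintro ⟨D₁, D₂⟩ hD
    simp only [Finset.mem_product, mem_sieveFamily] at hD
    simp only [Finset.mem_product, Finset.mem_powerset, Finset.mem_sigma, mem_sieveFamily]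
    obtain ⟨⟨hB₁, hy₁⟩, hB₂, hy₂⟩ := hD
    refine ⟨fun v hv => ?_, ⟨?_, ?_⟩, ?_⟩
    · exact mem_primesLE.mpr ((nrm_le_setNorm (Finset.mem_inter.mp hv).1).trans hy₁)
    · refine Finset.disjoint_of_subset_left ?_ (Finset.disjoint_union_left.mpr ⟨hB₁, hB₂⟩)
      exact symmDiff_le_sup
    · have h3 := h2 D₁ D₂
      have h4 := one_le_setNorm (D₁ ∩ D₂)
      have h5 := setNorm_pos (symmDiff D₁ D₂)
      calc setNorm (symmDiff D₁ D₂) ≤ setNorm (D₁ ∩ D₂) ^ 2 * setNorm (symmDiff D₁ D₂) :=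
            le_mul_of_one_le_left h5.le (one_le_pow₀ h4)
        _ = setNorm D₁ * setNorm D₂ := h3.symm
        _ ≤ y * y := mul_le_mul hy₁ hy₂ (setNorm_pos _).le ((setNorm_pos _).le.trans hy₁)
        _ = y ^ 2 := (sq y).symm
    · exact le_sup_left
  · rintro ⟨D₁, D₂⟩ - ⟨E₁, E₂⟩ - h
    simp only [Prod.mk.injEq, Sigma.mk.injEq, heq_eq_eq] at h
    obtain ⟨h3, h4, h5⟩ := h
    have h6 : D₁ = E₁ := by
      rw [← Finset.sdiff_union_inter D₁ D₂, ← Finset.sdiff_union_inter E₁ E₂, h3, h5]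
    subst h6
    rw [symmDiff_right_inj] at h4
    rw [h4]
  · rintro ⟨D₁, D₂⟩ -
    dsimp only
    rw [← mul_inv, ← mul_inv, h2]
  · rintro ⟨D, S⟩ -
    have := setNorm_pos S.1
    positivity

lemma exists_eq_sq_mul_prod (a : Ideal (𝓞 K)) (ha : a ≠ 0) :
    ∃ (m : Ideal (𝓞 K)) (D : Finset (HeightOneSpectrum (𝓞 K))),
      a = m ^ 2 * ∏ v ∈ D, v.asIdeal := by
  induction a using UniqueFactorizationMonoid.induction_on_prime with
  | h₁ => exact absurd rfl ha
  | h₂ x hx =>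
    refine ⟨1, ∅, ?_⟩
    rw [one_pow, Finset.prod_empty, one_mul,
      ← Ideal.isUnit_iff.mp hx |>.trans Ideal.one_eq_top.symm]
  | h₃ a p ha0 hp ih =>
    obtain ⟨m, D, hD⟩ := ih ha0
    let v : HeightOneSpectrum (𝓞 K) := ⟨p, Ideal.isPrime_of_prime hp, hp.ne_zero⟩
    by_cases hv : v ∈ D
    · refine ⟨m * p, D.erase v, ?_⟩
      rw [hD, ← Finset.mul_prod_erase D _ hv]
      simp only [v]
      ring
    · refine ⟨m, insert v D, ?_⟩
      rw [hD, Finset.prod_insert hv]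
      simp only [v]
      ring

lemma absNorm_prod (D : Finset (HeightOneSpectrum (𝓞 K))) :
    (Ideal.absNorm (∏ v ∈ D, v.asIdeal) : ℝ) = setNorm D := by
  rw [map_prod, setNorm]
  push_cast
  rfl

variable (K) in
lemma exists_log_le_sum_inv_setNorm : ∃ c : ℝ, 0 < c ∧
    ∀ (B : Finset (HeightOneSpectrum (𝓞 K))) (y : ℝ), 1 ≤ y →
      c * Real.log y ≤ (∏ v ∈ B, (1 + (nrm v : ℝ)⁻¹)) * ∑ D ∈ sieveFamily B y, (setNorm D)⁻¹ := by
  obtain ⟨c, hc0, hc⟩ := exists_sum_inv_absNorm_ge K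
  have hs := summable_absNorm_rpow K (s := 2) one_lt_two
  set κ := ∑' a : (Ideal (𝓞 K))⁰, (Ideal.absNorm (a : Ideal (𝓞 K)) : ℝ) ^ (-2 : ℝ)
  have hκ : 0 < κ := by
    refine hs.tsum_pos (fun a => by positivity) 1 ?_
    simp
  refine ⟨c / κ, by positivity, fun B y hy => ?_⟩
  rw [div_mul_eq_mul_div, div_le_iff₀ hκ]
  refine (hc y hy).trans ?_
  have hdec : ∀ a : (Ideal (𝓞 K))⁰, ∃ (m : (Ideal (𝓞 K))⁰)
      (D : Finset (HeightOneSpectrum (𝓞 K))),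
      (a : Ideal (𝓞 K)) = (m : Ideal (𝓞 K)) ^ 2 * ∏ v ∈ D, v.asIdeal := fun a => by
    have ha := nonZeroDivisors.coe_ne_zero a
    obtain ⟨m, D, h⟩ := exists_eq_sq_mul_prod (a : Ideal (𝓞 K)) ha
    have hm : m ≠ 0 := by
      rintro rfl
      rw [h] at ha
      simp at ha
    exact ⟨⟨m, mem_nonZeroDivisors_of_ne_zero hm⟩, D, h⟩
  choose m D hmD using hdec
  have hnorm : ∀ a : (Ideal (𝓞 K))⁰, (Ideal.absNorm (a : Ideal (𝓞 K)) : ℝ) =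
      (Ideal.absNorm (m a : Ideal (𝓞 K)) : ℝ) ^ 2 * (setNorm (D a ∩ B) * setNorm (D a \ B)) := by
    intro a
    rw [← setNorm_union (Finset.disjoint_sdiff_inter _ _).symm, Finset.union_comm,
      Finset.sdiff_union_inter, ← absNorm_prod]
    conv_lhs => rw [hmD a]
    push_cast [map_mul, map_pow]
    rfl
  have hB : ∏ v ∈ B, (1 + (nrm v : ℝ)⁻¹) = ∑ E ∈ B.powerset, (setNorm E)⁻¹ := by
    rw [Finset.prod_one_add]
    simp only [setNorm, Finset.prod_inv_distrib]
  have hle : ∑ a ∈ idealsLE K y, (Ideal.absNorm (a : Ideal (𝓞 K)) : ℝ)⁻¹ ≤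
      (∑ b ∈ idealsLE K y, ((Ideal.absNorm (b : Ideal (𝓞 K)) : ℝ) ^ 2)⁻¹) *
        ((∑ E ∈ B.powerset, (setNorm E)⁻¹) * ∑ D ∈ sieveFamily B y, (setNorm D)⁻¹) := by
    rw [Finset.sum_mul_sum, ← Finset.sum_product', Finset.sum_mul_sum, ← Finset.sum_product']
    refine sum_le_sum_of_injOn (fun a => (m a, (D a ∩ B, D a \ B))) ?_ ?_ ?_ ?_
    · intro a ha
      rw [mem_idealsLE] at ha
      simp only [Finset.mem_product, mem_idealsLE, Finset.mem_powerset, mem_sieveFamily]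
      have h1 := one_le_absNorm (m a)
      have h2 := one_le_setNorm (D a ∩ B)
      have h3 := one_le_setNorm (D a \ B)
      rw [hnorm a] at ha
      refine ⟨?_, Finset.inter_subset_right, Finset.sdiff_disjoint, ?_⟩
      · refine le_trans ?_ ha
        calc (Ideal.absNorm (m a : Ideal (𝓞 K)) : ℝ)
            ≤ (Ideal.absNorm (m a : Ideal (𝓞 K)) : ℝ) ^ 2 := le_self_pow₀ h1 two_ne_zero
          _ ≤ _ := le_mul_of_one_le_right (by positivity) (one_le_mul_of_one_le_of_one_le h2 h3)
      · refine le_trans ?_ ha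
        rw [← mul_assoc]
        exact le_mul_of_one_le_left (by linarith)
          (one_le_mul_of_one_le_of_one_le (one_le_pow₀ h1) h2)
    · intro a _ b _ h
      simp only [Prod.mk.injEq] at h
      obtain ⟨h1, h2, h3⟩ := h
      have h4 : D a = D b := by
        rw [← Finset.sdiff_union_inter (D a) B, ← Finset.sdiff_union_inter (D b) B, h2, h3]
      exact Subtype.ext (by rw [hmD a, hmD b, h1, h4])
    · intro a _
      dsimp only
      rw [hnorm a, mul_inv, mul_inv]
    · rintro ⟨a, E, D⟩ -
      have h1 := setNorm_pos E
      have h2 := setNorm_pos D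
      positivity
  refine hle.trans ?_
  rw [← hB, mul_comm]
  have hnn : 0 ≤ ∑ D ∈ sieveFamily B y, (setNorm D)⁻¹ :=
    Finset.sum_nonneg fun D _ => inv_nonneg.mpr (setNorm_pos D).le
  gcongr
  have h5 : ∀ b ∈ idealsLE K y, ((Ideal.absNorm (b : Ideal (𝓞 K)) : ℝ) ^ 2)⁻¹ =
      (Ideal.absNorm (b : Ideal (𝓞 K)) : ℝ) ^ (-2 : ℝ) := fun b _ => by
    rw [Real.rpow_neg (Nat.cast_nonneg _), Real.rpow_two]
  rw [Finset.sum_congr rfl h5]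
  exact hs.sum_le_tsum _ fun a _ => by positivity

end SieveSums

section SieveBound

open scoped Classical
open IsDedekindDomain UniqueFactorizationMonoid Filter

lemma one_add_pow_le_one_add {u : ℝ} (h0 : 0 ≤ u) (h1 : u ≤ 1) (n : ℕ) :
    (1 + u) ^ n ≤ 1 + (2 ^ n - 1) * u := by
  induction n with
  | zero => simp
  | succ n ih =>
    have h2 : (1 : ℝ) ≤ 2 ^ n := one_le_pow₀ one_le_two
    calc (1 + u) ^ (n + 1) = (1 + u) ^ n * (1 + u) := pow_succ _ _
      _ ≤ (1 + (2 ^ n - 1) * u) * (1 + u) := by gcongr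
      _ ≤ 1 + (2 ^ (n + 1) - 1) * u := by
        rw [pow_succ]
        nlinarith [mul_nonneg (mul_nonneg (sub_nonneg.mpr h2) h0) (sub_nonneg.mpr h1)]

lemma add_pow_sub_pow_le {s t : ℝ} (hs : 0 < s) (h0 : 0 ≤ t) (h1 : t ≤ s) (n : ℕ) :
    (s + t) ^ n - s ^ n ≤ (2 * s) ^ n * (t / s) := by
  have h2 := one_add_pow_le_one_add (div_nonneg h0 hs.le) ((div_le_one hs).mpr h1) n
  have h3 : (s + t) ^ n = s ^ n * (1 + t / s) ^ n := by
    rw [← mul_pow]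
    congr 1
    field_simp
  rw [h3, mul_pow]
  have h4 : 0 < s ^ n := pow_pos hs n
  have h5 : 0 ≤ t / s := div_nonneg h0 hs.le
  nlinarith [mul_le_mul_of_nonneg_left h2 h4.le, mul_nonneg h4.le h5]

variable (K : Type*) [Field K] [NumberField K]

/-- The number of `α` in a box such that neither `α` nor `α + h` has a small prime factor. -/
theorem exists_sieve_bound : ∃ C : ℝ, 0 < C ∧ ∀ (L : ℕ), 2 ≤ L → ∀ (h : 𝓞 K)
    (S : Finset (HeightOneSpectrum (𝓞 K))), (∀ v : HeightOneSpectrum (𝓞 K), h ∈ v.asIdeal → v ∈ S) →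
    ∀ U ⊆ box K (-L) L, (∀ α ∈ U, ∀ v : HeightOneSpectrum (𝓞 K),
      (nrm v : ℝ) ≤ (L : ℝ) ^ (1 / 16 : ℝ) → α ∉ v.asIdeal ∧ α + h ∉ v.asIdeal) →
    (U.card : ℝ) ≤ C * (L : ℝ) ^ finrank ℚ K / Real.log L ^ 2 *
      (∏ v ∈ S, (1 + (nrm v : ℝ)⁻¹)) ^ 2 := by
  obtain ⟨κ, hκ0, hκ⟩ := exists_sq_sum_inv_setNorm_le K
  obtain ⟨c, hc0, hc⟩ := exists_log_le_sum_inv_setNorm K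
  obtain ⟨C₂, hC₂0, hC₂⟩ := exists_card_sieveFamily_le K
  set n := finrank ℚ K
  set Q₂ : ℝ := ∏ v ∈ primesLE K 2, (1 + (nrm v : ℝ)⁻¹) with hQ₂
  have hQpos : ∀ s : Finset (HeightOneSpectrum (𝓞 K)), 1 ≤ ∏ v ∈ s, (1 + (nrm v : ℝ)⁻¹) :=
    fun s => Finset.one_le_prod fun v _ => by
      have : (0 : ℝ) ≤ (nrm v : ℝ)⁻¹ := by positivity
      linarith
  have hQ₂1 := hQpos (primesLE K 2)
  rw [← hQ₂] at hQ₂1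
  refine ⟨2 ^ n * κ * Q₂ ^ 2 * 1024 / c ^ 2 + C₂ ^ 2 * 4 ^ n * 8, by positivity, ?_⟩
  intro L hL h S hS U hU hUv
  have hL2 : (2 : ℝ) ≤ L := by exact_mod_cast hL
  have hL0 : (0 : ℝ) < L := by linarith
  have hlog : 0 < Real.log L := Real.log_pos (by linarith)
  set B := S ∪ primesLE K 2 with hB
  set Q : ℝ := ∏ v ∈ S, (1 + (nrm v : ℝ)⁻¹) with hQ
  have hQ1 : 1 ≤ Q := hQpos S
  set z : ℝ := (L : ℝ) ^ (1 / 16 : ℝ) with hz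
  set y : ℝ := (L : ℝ) ^ (1 / 32 : ℝ) with hy
  have hyz : y ^ 2 = z := by
    rw [hy, hz, ← Real.rpow_natCast, ← Real.rpow_mul hL0.le]
    norm_num
  have hz8 : z ^ 8 = (L : ℝ) ^ (1 / 2 : ℝ) := by
    rw [hz, ← Real.rpow_natCast, ← Real.rpow_mul hL0.le]
    norm_num
  have hy1 : 1 ≤ y := Real.one_le_rpow (by linarith) (by norm_num)
  have hz1 : 1 ≤ z := Real.one_le_rpow (by linarith) (by norm_num)
  have hz0 : 0 < z := by linarith
  have hlogy : Real.log y = Real.log L / 32 := by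
    rw [hy, Real.log_rpow hL0]
    ring
  set g : HeightOneSpectrum (𝓞 K) → ℝ := fun v => if nrm v = 2 then 1 / 2 else 2 / nrm v with hg
  have hg0 : ∀ v, 0 < g v := fun v => by
    have := one_lt_nrm v
    simp only [hg]
    split_ifs <;> positivity
  have hg1 : ∀ v, g v < 1 := fun v => by
    simp only [hg]
    split_ifs with h2
    · norm_num
    · have h3 := two_le_nrm v
      have h4 : (2 : ℝ) < nrm v := by exact_mod_cast (by omega : 2 < nrm v)
      rw [div_lt_one (by linarith)]
      exact h4
  have hginv : ∀ v, (nrm v : ℝ)⁻¹ ≤ g v := fun v => by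
    have := one_lt_nrm v
    simp only [hg]
    split_ifs with h2
    · rw [h2]
      norm_num
    · rw [inv_eq_one_div]
      gcongr
      norm_num
  set 𝓕 := sieveFamily B z with h𝓕
  have hgood : ∀ D ∈ 𝓕, ∀ v ∈ D, g v = 2 / nrm v ∧ h ∉ v.asIdeal := fun D hD v hv => by
    have h1 := Finset.disjoint_left.mp (mem_sieveFamily.mp hD).1 hv
    rw [hB, Finset.mem_union, mem_primesLE, not_or] at h1
    refine ⟨?_, fun h2 => h1.1 (hS v h2)⟩
    simp only [hg]
    rw [if_neg]
    intro h2
    exact h1.2 (by rw [h2]; norm_num)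
  have hprodinv : ∀ D ∈ 𝓕, (∏ v ∈ D, g v)⁻¹ ≤ z := fun D hD => by
    refine le_trans ?_ (mem_sieveFamily.mp hD).2
    rw [← Finset.prod_inv_distrib, setNorm]
    refine Finset.prod_le_prod (fun v _ => inv_nonneg.mpr (hg0 v).le) fun v _ => ?_
    exact inv_le_of_inv_le₀ (by linarith [one_lt_nrm v]) (hginv v)
  have h𝓕down : ∀ D ∈ 𝓕, ∀ E ⊆ D, E ∈ 𝓕 := fun D hD E hE => by
    rw [h𝓕, mem_sieveFamily] at hD ⊢
    exact ⟨Finset.disjoint_of_subset_left hE hD.1, (setNorm_mono hE).trans hD.2⟩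
  have h𝓕e : ∅ ∈ 𝓕 := by
    rw [h𝓕, mem_sieveFamily]
    exact ⟨Finset.disjoint_empty_left _, by simpa [setNorm] using hz1⟩
  have hsieve := selberg_sieve (𝓕 := 𝓕) (g := g) (box K (-L) L) U hU
    (fun v α => α ∈ v.asIdeal ∨ α + h ∈ v.asIdeal) ((2 * L : ℝ) ^ n) hg0 hg1 h𝓕down h𝓕e
    (fun α hα D hD v hv => by
      have h1 : (nrm v : ℝ) ≤ z := (nrm_le_setNorm hv).trans (mem_sieveFamily.mp hD).2
      have h2 := hUv α hα v h1
      tauto)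
  set G := ∑ T ∈ 𝓕, sieveWeight g T with hG
  have hG1 : c ^ 2 * Real.log L ^ 2 / (1024 * κ * (Q * Q₂) ^ 2) ≤ G := by
    have h1 : ∑ D ∈ 𝓕, 2 ^ D.card * (setNorm D)⁻¹ ≤ G := by
      refine Finset.sum_le_sum fun D hD => ?_
      rw [sieveWeight, setNorm, ← Finset.prod_inv_distrib, ← Finset.prod_const,
        ← Finset.prod_mul_distrib]
      refine Finset.prod_le_prod (fun v _ => by positivity) fun v hv => ?_
      rw [← div_eq_mul_inv, ← (hgood D hD v hv).1]
      rw [le_div_iff₀ (sub_pos.mpr (hg1 v))]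
      nlinarith [hg0 v, hg1 v]
    have h2 := hκ B y
    rw [hyz, ← h𝓕] at h2
    have h3 := hc B y hy1
    have h4 : ∏ v ∈ B, (1 + (nrm v : ℝ)⁻¹) ≤ Q * Q₂ := by
      rw [hB, hQ, hQ₂, ← Finset.prod_union_inter]
      exact le_mul_of_one_le_right (zero_le_one.trans (hQpos _)) (hQpos _)
    set T := ∑ D ∈ sieveFamily B y, (setNorm D)⁻¹
    have hT : 0 ≤ T := Finset.sum_nonneg fun D _ => inv_nonneg.mpr (setNorm_pos D).le
    have h5 : c * (Real.log L / 32) ≤ Q * Q₂ * T := by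
      rw [← hlogy]
      exact h3.trans (mul_le_mul_of_nonneg_right h4 hT)
    have h6 : T ^ 2 ≤ κ * G := h2.trans (mul_le_mul_of_nonneg_left h1 hκ0.le)
    rw [div_le_iff₀ (by positivity)]
    have h7 : (c * (Real.log L / 32)) ^ 2 ≤ (Q * Q₂ * T) ^ 2 := by gcongr
    have h8 : (Q * Q₂) ^ 2 * T ^ 2 ≤ (Q * Q₂) ^ 2 * (κ * G) := by gcongr
    nlinarith
  have hmain : (2 * L : ℝ) ^ n / G ≤
      2 ^ n * κ * Q₂ ^ 2 * 1024 / c ^ 2 * (L : ℝ) ^ n / Real.log L ^ 2 * Q ^ 2 := by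
    calc (2 * L : ℝ) ^ n / G
        ≤ (2 * L : ℝ) ^ n / (c ^ 2 * Real.log L ^ 2 / (1024 * κ * (Q * Q₂) ^ 2)) := by gcongr
      _ = _ := by
        rw [mul_pow]
        field_simp
  set E : ℝ := (2 * L + z ^ 2) ^ n - (2 * L) ^ n with hE
  have hz2L : z ^ 2 ≤ 2 * L := by
    have : z ^ 2 ≤ z ^ 8 := pow_le_pow_right₀ hz1 (by norm_num)
    have h2 : (L : ℝ) ^ (1 / 2 : ℝ) ≤ (L : ℝ) ^ (1 : ℝ) :=
      Real.rpow_le_rpow_of_exponent_le (by linarith) (by norm_num)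
    rw [Real.rpow_one] at h2
    linarith
  have hE0 : 0 ≤ E := by
    rw [hE, sub_nonneg]
    gcongr
    linarith [sq_nonneg z]
  have hterm : ∀ D₁ ∈ 𝓕, ∀ D₂ ∈ 𝓕, |(({α ∈ box K (-L) L | ∀ v ∈ D₁ ∪ D₂,
      α ∈ v.asIdeal ∨ α + h ∈ v.asIdeal}.card : ℝ)) - (2 * L : ℝ) ^ n * ∏ v ∈ D₁ ∪ D₂, g v| /
        ((∏ v ∈ D₁, g v) * ∏ v ∈ D₂, g v) ≤ z ^ 2 * E := by
    intro D₁ hD₁ D₂ hD₂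
    have hgu : ∀ v ∈ D₁ ∪ D₂, g v = 2 / nrm v ∧ h ∉ v.asIdeal := fun v hv =>
      (Finset.mem_union.mp hv).elim (hgood D₁ hD₁ v) (hgood D₂ hD₂ v)
    have h1 := abs_card_box_sub_le L h (D₁ ∪ D₂) fun v hv => (hgu v hv).2
    rw [← Finset.prod_congr rfl fun v hv => (hgu v hv).1] at h1
    have h2 : ((∏ v ∈ D₁ ∪ D₂, nrm v : ℕ) : ℝ) ≤ z ^ 2 := by
      have e1 : ((∏ v ∈ D₁ ∪ D₂, nrm v : ℕ) : ℝ) = setNorm (D₁ ∪ D₂) := by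
        rw [setNorm]
        push_cast
        rfl
      have e2 : setNorm (D₁ ∪ D₂) * setNorm (D₁ ∩ D₂) = setNorm D₁ * setNorm D₂ :=
        Finset.prod_union_inter
      rw [e1]
      calc setNorm (D₁ ∪ D₂) ≤ setNorm (D₁ ∪ D₂) * setNorm (D₁ ∩ D₂) :=
            le_mul_of_one_le_right (setNorm_pos _).le (one_le_setNorm _)
        _ = setNorm D₁ * setNorm D₂ := e2
        _ ≤ z * z := mul_le_mul (mem_sieveFamily.mp hD₁).2 (mem_sieveFamily.mp hD₂).2
            (setNorm_pos _).le hz0.le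
        _ = z ^ 2 := (sq z).symm
    have h3 : (2 * L + ((∏ v ∈ D₁ ∪ D₂, nrm v : ℕ) : ℝ)) ^ n - (2 * L : ℝ) ^ n ≤ E := by
      rw [hE]
      gcongr
    rw [div_eq_inv_mul, mul_inv, sq]
    have h4 : 0 < ∏ v ∈ D₁, g v := Finset.prod_pos fun v _ => hg0 v
    have h5 : 0 < ∏ v ∈ D₂, g v := Finset.prod_pos fun v _ => hg0 v
    refine mul_le_mul ?_ (h1.trans h3) (abs_nonneg _) (by positivity)
    exact mul_le_mul (hprodinv D₁ hD₁) (hprodinv D₂ hD₂) (by positivity) hz0.le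
  have herr := Finset.sum_le_sum fun D₁ hD₁ => Finset.sum_le_sum fun D₂ hD₂ => hterm D₁ hD₁ D₂ hD₂
  simp only [Finset.sum_const, nsmul_eq_mul] at herr
  have herr2 : (𝓕.card : ℝ) * (𝓕.card * (z ^ 2 * E)) ≤
      C₂ ^ 2 * 4 ^ n * 8 * (L : ℝ) ^ n / Real.log L ^ 2 * Q ^ 2 := by
    have h1 : (𝓕.card : ℝ) ≤ C₂ * z ^ 2 := hC₂ B z
    have h2 : E ≤ (2 * (2 * L)) ^ n * (z ^ 2 / (2 * L)) :=
      add_pow_sub_pow_le (by positivity) (by positivity) hz2L n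
    have h3 : Real.log L ^ 2 ≤ 16 * (L : ℝ) ^ (1 / 2 : ℝ) := by
      have e1 := Real.log_le_rpow_div hL0.le (show (0 : ℝ) < 1 / 4 by norm_num)
      calc Real.log L ^ 2 ≤ ((L : ℝ) ^ (1 / 4 : ℝ) / (1 / 4)) ^ 2 := by gcongr
        _ = 16 * ((L : ℝ) ^ (1 / 4 : ℝ)) ^ 2 := by ring
        _ = _ := by
          rw [← Real.rpow_natCast, ← Real.rpow_mul hL0.le]
          norm_num
    have h4 : (L : ℝ) ^ (1 / 2 : ℝ) * (L : ℝ) ^ (1 / 2 : ℝ) = L := by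
      rw [← Real.rpow_add hL0]
      norm_num
    set s : ℝ := (L : ℝ) ^ (1 / 2 : ℝ)
    have hs : 0 < s := Real.rpow_pos_of_pos hL0 _
    calc (𝓕.card : ℝ) * (𝓕.card * (z ^ 2 * E))
        ≤ (C₂ * z ^ 2) * ((C₂ * z ^ 2) * (z ^ 2 * ((2 * (2 * L)) ^ n * (z ^ 2 / (2 * L))))) := by
          gcongr
      _ = C₂ ^ 2 * (2 * (2 * L)) ^ n * (z ^ 8 / (2 * L)) := by ring
      _ = C₂ ^ 2 * 4 ^ n * (L : ℝ) ^ n * (1 / 2 * (1 / s)) := by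
          rw [hz8, ← mul_assoc, mul_pow, ← h4]
          norm_num
          field_simp
      _ ≤ C₂ ^ 2 * 4 ^ n * (L : ℝ) ^ n * (1 / 2 * (16 / Real.log L ^ 2)) := by
          gcongr _ * (_ * ?_)
          rw [div_le_div_iff₀ hs (by positivity)]
          linarith
      _ = C₂ ^ 2 * 4 ^ n * 8 * (L : ℝ) ^ n / Real.log L ^ 2 * 1 := by ring
      _ ≤ _ := by
          gcongr
          exact one_le_pow₀ hQ1
  calc (U.card : ℝ) ≤ _ := hsieve
    _ ≤ 2 ^ n * κ * Q₂ ^ 2 * 1024 / c ^ 2 * (L : ℝ) ^ n / Real.log L ^ 2 * Q ^ 2 +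
        C₂ ^ 2 * 4 ^ n * 8 * (L : ℝ) ^ n / Real.log L ^ 2 * Q ^ 2 :=
      add_le_add hmain (herr.trans herr2)
    _ = _ := by ring

end SieveBound

/-! ### Romanov's averaging lemma -/

section RomanovAverage

open scoped Classical
open IsDedekindDomain UniqueFactorizationMonoid Filter

variable {K : Type*} [Field K] [NumberField K]

lemma abs_norm_le_house_pow (α : K) : |(Algebra.norm ℚ α : ℝ)| ≤ house α ^ finrank ℚ K := by
  have σ : K →+* ℂ := Classical.arbitrary _
  have h := norm_norm_le_norm_mul_house_pow α σ
  rw [← Rat.norm_cast_real, Real.norm_eq_abs] at h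
  refine h.trans ?_
  calc ‖σ α‖ * house α ^ (finrank ℚ K - 1) ≤ house α * house α ^ (finrank ℚ K - 1) := by
        gcongr
        · exact pow_nonneg (house_nonneg _) _
        · exact norm_embedding_le_house α σ
    _ = house α ^ finrank ℚ K := by
        rw [← pow_succ', Nat.sub_add_cancel finrank_pos]

lemma absNorm_span_le_house_pow (α : 𝓞 K) :
    (Ideal.absNorm (Ideal.span {α}) : ℝ) ≤ house (α : K) ^ finrank ℚ K := by
  refine le_trans (le_of_eq ?_) (abs_norm_le_house_pow (α : K))
  rw [Ideal.absNorm_span_singleton, ← Algebra.coe_norm_int, Nat.cast_natAbs]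
  push_cast
  rfl

/-- Distinct primes containing `α` have norms whose product is at most `house α ^ n`. -/
lemma sum_log_nrm_le_house {α : 𝓞 K} (hα : α ≠ 0) (S : Finset (HeightOneSpectrum (𝓞 K)))
    (hS : ∀ v ∈ S, α ∈ v.asIdeal) :
    ∑ v ∈ S, Real.log (nrm v) ≤ finrank ℚ K * Real.log (house (α : K)) := by
  have h1 : ∏ v ∈ S, v.asIdeal ∣ Ideal.span {α} := by
    refine Finset.prod_dvd_of_coprime (fun v _ v' _ h => heightOneSpectrum_isCoprime h) ?_
    intro v hv
    rw [Ideal.dvd_span_singleton]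
    exact hS v hv
  have h0 : Ideal.absNorm (Ideal.span {α}) ≠ 0 := by
    rw [Ne, Ideal.absNorm_eq_zero_iff, Ideal.span_singleton_eq_bot]
    exact hα
  have h2 := Nat.le_of_dvd (Nat.pos_of_ne_zero h0) (map_dvd Ideal.absNorm h1)
  rw [map_prod] at h2
  rw [← Real.log_prod, ← Real.log_pow]
  · refine Real.log_le_log ?_ (le_trans ?_ (absNorm_span_le_house_pow α))
    · exact Finset.prod_pos fun v _ => by
        exact_mod_cast zero_lt_two.trans_le (two_le_nrm v)
    · exact_mod_cast h2
  · intro v _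
    exact_mod_cast (zero_lt_two.trans_le (two_le_nrm v)).ne'

lemma finite_setOf_mem_asIdeal {α : 𝓞 K} (hα : α ≠ 0) :
    {v : HeightOneSpectrum (𝓞 K) | α ∈ v.asIdeal}.Finite := by
  have := Ideal.finite_factors (I := Ideal.span {α}) (by simpa using hα)
  simpa only [Ideal.dvd_span_singleton] using this

/-- The multiplicative order of `ξ` modulo `v`, or `0` if it has none. -/
noncomputable def ordAt (ξ : 𝓞 K) (v : HeightOneSpectrum (𝓞 K)) : ℕ :=
  orderOf (Ideal.Quotient.mk v.asIdeal ξ)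

lemma ordAt_dvd_iff (ξ : 𝓞 K) (v : HeightOneSpectrum (𝓞 K)) (m : ℕ) :
    ordAt ξ v ∣ m ↔ ξ ^ m - 1 ∈ v.asIdeal := by
  rw [ordAt, orderOf_dvd_iff_pow_eq_one, ← map_pow, ← map_one (Ideal.Quotient.mk v.asIdeal),
    Ideal.Quotient.eq]

lemma pow_sub_one_ne_zero {ξ : 𝓞 K} (hξ : ¬ IsUnit ξ) {m : ℕ} (hm : m ≠ 0) : ξ ^ m - 1 ≠ 0 := by
  intro h
  exact hξ (IsUnit.of_pow_eq_one (sub_eq_zero.mp h) hm)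

lemma exists_card_ordAt_le (ξ : 𝓞 K) (hξ0 : ξ ≠ 0) (hξ : ¬ IsUnit ξ) :
    ∃ C : ℝ, 0 ≤ C ∧ ∀ d : ℕ, d ≠ 0 → ∀ S : Finset (HeightOneSpectrum (𝓞 K)),
      (∀ v ∈ S, ordAt ξ v = d) → (S.card : ℝ) ≤ C * d := by
  set H := house (ξ : K) with hH
  have hH1 : 1 ≤ H := one_le_house_of_isIntegral ξ.isIntegral_coe (by simpa using hξ0)
  have hl2 := Real.log_pos one_lt_two
  refine ⟨finrank ℚ K * (Real.log 2 + Real.log H) / Real.log 2, ?_, ?_⟩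
  · have := Real.log_nonneg hH1
    positivity
  intro d hd S hS
  have h0 := pow_sub_one_ne_zero hξ hd
  have h1 := sum_log_nrm_le_house h0 S fun v hv => (ordAt_dvd_iff ξ v d).mp (by rw [hS v hv])
  have h2 : (S.card : ℝ) * Real.log 2 ≤ ∑ v ∈ S, Real.log (nrm v) := by
    rw [← nsmul_eq_mul]
    refine Finset.card_nsmul_le_sum _ _ _ fun v _ => Real.log_le_log two_pos ?_
    exact_mod_cast two_le_nrm v
  have hhouse : house ((ξ ^ d - 1 : 𝓞 K) : K) ≤ 2 * H ^ d := by
    have h3 := house_add_le ((ξ : K) ^ d) ((-1 : ℤ) : K)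
    rw [house_intCast] at h3
    have h4 := house_pow_le (ξ : K) d
    have h5 := one_le_pow₀ hH1 (n := d)
    have h6 : ((ξ ^ d - 1 : 𝓞 K) : K) = (ξ : K) ^ d + ((-1 : ℤ) : K) := by
      push_cast
      ring
    rw [h6]
    norm_num at h3 ⊢
    linarith
  have hpos : 0 < house ((ξ ^ d - 1 : 𝓞 K) : K) :=
    zero_lt_one.trans_le (one_le_house_of_isIntegral (RingOfIntegers.isIntegral_coe _)
      (RingOfIntegers.coe_ne_zero_iff.mpr h0))
  have h7 := Real.log_le_log hpos hhouse
  rw [Real.log_mul two_ne_zero (by positivity), Real.log_pow] at h7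
  have hd1 : (1 : ℝ) ≤ d := by exact_mod_cast Nat.one_le_iff_ne_zero.mpr hd
  rw [div_mul_eq_mul_div, le_div_iff₀ hl2]
  calc (S.card : ℝ) * Real.log 2 ≤ finrank ℚ K * (Real.log 2 + d * Real.log H) :=
        h2.trans (h1.trans (by gcongr))
    _ ≤ finrank ℚ K * (d * Real.log 2 + d * Real.log H) := by
        gcongr
        nlinarith
    _ = _ := by ring

lemma summable_inv_nrm_mul_log_ordAt (ξ : 𝓞 K) (hξ0 : ξ ≠ 0) (hξ : ¬ IsUnit ξ) :
    Summable fun v : HeightOneSpectrum (𝓞 K) => ((nrm v : ℝ) * Real.log (ordAt ξ v))⁻¹ := by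
  obtain ⟨C, hC0, hC⟩ := exists_card_ordAt_le ξ hξ0 hξ
  have hl2 := Real.log_pos one_lt_two
  have hs2 : Summable fun v : HeightOneSpectrum (𝓞 K) =>
      if 2 ≤ ordAt ξ v ∧ ordAt ξ v ^ 4 < nrm v then (nrm v : ℝ)⁻¹ else 0 := by
    refine summable_of_fiber_le (fun v => by positivity) (ordAt ξ)
      (b := fun d => C * ((d : ℝ) ^ 3)⁻¹)
      ((Real.summable_nat_pow_inv.mpr (by norm_num)).mul_left C) ?_
    intro d s hs
    by_cases hd : 2 ≤ d
    · have hd0 : (0 : ℝ) < d := by exact_mod_cast zero_lt_two.trans_le hd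
      calc _ ≤ ∑ v ∈ s, ((d : ℝ) ^ 4)⁻¹ := by
            refine Finset.sum_le_sum fun v hv => ?_
            rw [hs v hv]
            split_ifs with h
            · gcongr
              exact_mod_cast h.2.le
            · positivity
        _ = s.card * ((d : ℝ) ^ 4)⁻¹ := by rw [Finset.sum_const, nsmul_eq_mul]
        _ ≤ C * d * ((d : ℝ) ^ 4)⁻¹ := by
            gcongr
            exact hC d (by omega) s hs
        _ = C * ((d : ℝ) ^ 3)⁻¹ := by
            field_simp
    · rw [Finset.sum_eq_zero]
      · positivity
      · intro v hv
        rw [hs v hv, if_neg fun h => hd h.1]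
  refine Summable.of_nonneg_of_le (fun v => ?_) (fun v => ?_)
    (((summable_inv_nrm_mul_log K).mul_left 4).add (hs2.mul_left (Real.log 2)⁻¹))
  · have := Real.log_natCast_nonneg (ordAt ξ v)
    positivity
  have hN := one_lt_nrm v
  have hlN := Real.log_pos hN
  rcases lt_or_ge (ordAt ξ v) 2 with h | h
  · have h1 : Real.log (ordAt ξ v) = 0 := by
      interval_cases ordAt ξ v <;> simp
    rw [h1, mul_zero, inv_zero]
    positivity
  have hlo : Real.log 2 ≤ Real.log (ordAt ξ v) :=
    Real.log_le_log two_pos (by exact_mod_cast h)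
  rcases lt_or_ge (ordAt ξ v ^ 4) (nrm v) with h4 | h4
  · rw [if_pos ⟨h, h4⟩]
    have h5 : ((nrm v : ℝ) * Real.log (ordAt ξ v))⁻¹ ≤ (Real.log 2)⁻¹ * (nrm v : ℝ)⁻¹ := by
      rw [mul_inv, mul_comm]
      gcongr
    refine h5.trans (le_add_of_nonneg_left ?_)
    positivity
  · rw [if_neg fun h' => absurd h'.2 (not_lt.mpr h4), mul_zero, add_zero]
    have h5 : Real.log (nrm v) ≤ 4 * Real.log (ordAt ξ v) := by
      have := Real.log_le_log (zero_lt_one.trans hN) (show (nrm v : ℝ) ≤ (ordAt ξ v : ℝ) ^ 4 by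
        exact_mod_cast h4)
      rw [Real.log_pow] at this
      exact_mod_cast this
    have h6 : 0 < Real.log (ordAt ξ v) := hl2.trans_le hlo
    rw [← div_eq_mul_inv, le_div_iff₀ (by positivity), inv_mul_le_iff₀ (by positivity)]
    nlinarith

/-- Convexity of the exponential: a sub-probability weighted exponential of a sum. -/
lemma exp_sum_mul_le {ι : Type*} (s : Finset ι) (p t : ι → ℝ) (hp : ∀ i ∈ s, 0 ≤ p i)
    (hs : ∑ i ∈ s, p i ≤ 1) :
    Real.exp (∑ i ∈ s, p i * t i) ≤ 1 + ∑ i ∈ s, p i * Real.exp (t i) := by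
  have h := convexOn_exp.map_add_sum_le (t := s) (w := p) (p := t) (v := 1 - ∑ i ∈ s, p i) (q := 0)
    hp (by ring) (fun _ _ => Set.mem_univ _) (by linarith) (Set.mem_univ _)
  simp only [smul_eq_mul, mul_zero, zero_add, Real.exp_zero, mul_one] at h
  have := Finset.sum_nonneg hp
  linarith

/-- Romanov's averaging lemma. -/
theorem exists_romanov_average (ξ : 𝓞 K) (hξ0 : ξ ≠ 0) (hξ : ¬ IsUnit ξ) :
    ∃ C : ℝ, 0 < C ∧ ∀ (M : ℕ) (S : ℕ → Finset (HeightOneSpectrum (𝓞 K))),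
      (∀ m, ∀ v ∈ S m, ξ ^ (m + 1) - 1 ∈ v.asIdeal) →
        ∑ m ∈ Finset.range M, ∏ v ∈ S m, (1 + 3 * (nrm v : ℝ)⁻¹) ≤ C * M := by
  set p : HeightOneSpectrum (𝓞 K) → ℝ :=
    fun v => 6 * ((nrm v : ℝ) * Real.log (ordAt ξ v))⁻¹ with hp
  have hp0 : ∀ v, 0 ≤ p v := fun v => by
    have := Real.log_natCast_nonneg (ordAt ξ v)
    positivity
  have hsum : Summable p := (summable_inv_nrm_mul_log_ordAt ξ hξ0 hξ).mul_left 6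
  obtain ⟨F₁, hF₁⟩ := summable_iff_vanishing_norm.mp hsum 1 one_pos
  have hξ1 : ξ - 1 ≠ 0 := by simpa using pow_sub_one_ne_zero hξ one_ne_zero
  set F := F₁ ∪ (finite_setOf_mem_asIdeal hξ1).toFinset with hF
  set A := ∏ v ∈ F, (1 + 3 * (nrm v : ℝ)⁻¹) with hA
  have hfac : ∀ v : HeightOneSpectrum (𝓞 K), 1 ≤ 1 + 3 * (nrm v : ℝ)⁻¹ := fun v =>
    le_add_of_nonneg_right (by positivity)
  have hA1 : 1 ≤ A := Finset.one_le_prod fun v _ => hfac v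
  refine ⟨A * 2, by positivity, fun M S hS => ?_⟩
  set T : ℕ → Finset (HeightOneSpectrum (𝓞 K)) := fun m => S m \ F with hT
  have hTW : ∀ s : Finset (HeightOneSpectrum (𝓞 K)), Disjoint s F → ∑ v ∈ s, p v ≤ 1 := by
    intro s hs
    have := hF₁ s (hs.mono_right Finset.subset_union_left)
    exact (le_abs_self _).trans this.le
  have hTord : ∀ m, ∀ v ∈ T m, ordAt ξ v ∣ m + 1 ∧ 2 ≤ ordAt ξ v := by
    intro m v hv
    rw [hT, Finset.mem_sdiff, hF, Finset.mem_union, not_or, Set.Finite.mem_toFinset] at hv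
    have h1 := (ordAt_dvd_iff ξ v (m + 1)).mpr (hS m v hv.1)
    refine ⟨h1, ?_⟩
    have h2 : ordAt ξ v ≠ 0 := fun h => by rw [h] at h1; simp at h1
    have h3 : ordAt ξ v ≠ 1 := fun h => by
      have := (ordAt_dvd_iff ξ v 1).mp (by rw [h])
      rw [pow_one] at this
      exact hv.2.2 this
    omega
  have hprod : ∀ m, ∏ v ∈ S m, (1 + 3 * (nrm v : ℝ)⁻¹) ≤
      A * (1 + ∑ v ∈ T m, p v * Real.sqrt (ordAt ξ v)) := by
    intro m
    calc _ ≤ ∏ v ∈ F ∪ T m, (1 + 3 * (nrm v : ℝ)⁻¹) := by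
          refine Finset.prod_le_prod_of_subset_of_one_le ?_ ?_ ?_
          · intro v hv
            rw [Finset.mem_union, hT, Finset.mem_sdiff]
            tauto
          · exact fun v _ => zero_le_one.trans (hfac v)
          · exact fun v _ _ => hfac v
      _ = A * ∏ v ∈ T m, (1 + 3 * (nrm v : ℝ)⁻¹) :=
          Finset.prod_union Finset.disjoint_sdiff
      _ ≤ A * Real.exp (∑ v ∈ T m, 3 * (nrm v : ℝ)⁻¹) := by
          gcongr
          rw [Real.exp_sum]
          exact Finset.prod_le_prod (fun v _ => by positivity) fun v _ => by
            rw [add_comm]; exact Real.add_one_le_exp _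
      _ = A * Real.exp (∑ v ∈ T m, p v * (Real.log (ordAt ξ v) / 2)) := by
          congr 2
          refine Finset.sum_congr rfl fun v hv => ?_
          have h1 : (1 : ℝ) < ordAt ξ v := by exact_mod_cast (hTord m v hv).2
          have h2 := Real.log_pos h1
          have h3 := one_lt_nrm v
          rw [hp]
          field_simp
          norm_num
      _ ≤ A * (1 + ∑ v ∈ T m, p v * Real.exp (Real.log (ordAt ξ v) / 2)) := by
          gcongr
          exact exp_sum_mul_le _ _ _ (fun v _ => hp0 v) (hTW _ Finset.sdiff_disjoint)
      _ = _ := by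
          congr 2
          refine Finset.sum_congr rfl fun v hv => ?_
          have h1 : (0 : ℝ) < ordAt ξ v := by
            exact_mod_cast zero_lt_two.trans_le (hTord m v hv).2
          rw [Real.exp_half, Real.exp_log h1]
  set W := (Finset.range M).biUnion T with hW
  have hWF : Disjoint W F := by
    rw [hW, Finset.disjoint_biUnion_left]
    exact fun m _ => Finset.sdiff_disjoint
  have hdouble : ∑ m ∈ Finset.range M, ∑ v ∈ T m, p v * Real.sqrt (ordAt ξ v) ≤ M := by
    calc _ ≤ ∑ m ∈ Finset.range M, ∑ v ∈ W,
          if ordAt ξ v ∣ m + 1 then p v * Real.sqrt (ordAt ξ v) else 0 := by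
          refine Finset.sum_le_sum fun m hm => ?_
          rw [← Finset.sum_filter]
          refine Finset.sum_le_sum_of_subset_of_nonneg (fun v hv => ?_) fun v _ _ =>
            mul_nonneg (hp0 v) (Real.sqrt_nonneg _)
          rw [Finset.mem_filter, hW, Finset.mem_biUnion]
          exact ⟨⟨m, hm, hv⟩, (hTord m v hv).1⟩
      _ = ∑ v ∈ W, (M / ordAt ξ v : ℕ) * (p v * Real.sqrt (ordAt ξ v)) := by
          rw [Finset.sum_comm]
          refine Finset.sum_congr rfl fun v _ => ?_
          rw [← Finset.sum_filter, Finset.sum_const, Nat.card_multiples, nsmul_eq_mul]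
      _ ≤ ∑ v ∈ W, M * p v := by
          refine Finset.sum_le_sum fun v hv => ?_
          obtain ⟨m, _, hv⟩ := Finset.mem_biUnion.mp hv
          have h1 : (1 : ℝ) ≤ ordAt ξ v := by
            exact_mod_cast one_le_two.trans (hTord m v hv).2
          calc ((M / ordAt ξ v : ℕ) : ℝ) * (p v * Real.sqrt (ordAt ξ v))
              ≤ ((M : ℝ) / ordAt ξ v) * (p v * ordAt ξ v) := by
                have := hp0 v
                gcongr
                · exact Nat.cast_div_le
                · exact Real.sqrt_le_self_iff.mpr (Or.inr h1)
            _ = M * p v := by field_simp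
      _ = M * ∑ v ∈ W, p v := by rw [Finset.mul_sum]
      _ ≤ M * 1 := by gcongr; exact hTW W hWF
      _ = M := mul_one _
  calc _ ≤ ∑ m ∈ Finset.range M, A * (1 + ∑ v ∈ T m, p v * Real.sqrt (ordAt ξ v)) :=
        Finset.sum_le_sum fun m _ => hprod m
    _ = A * (M + ∑ m ∈ Finset.range M, ∑ v ∈ T m, p v * Real.sqrt (ordAt ξ v)) := by
        rw [← Finset.mul_sum, Finset.sum_add_distrib, Finset.sum_const, Finset.card_range,
          nsmul_eq_mul, mul_one]
    _ ≤ A * (M + M) := by gcongr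
    _ = A * 2 * M := by ring

end RomanovAverage

/-! ### Second moments and prime elements -/

section SecondMoment

open scoped Classical

/-- Cauchy-Schwarz for the fibres of a map. -/
lemma card_sq_le_card_image_mul {α β : Type*} (s : Finset α) (f : α → β) :
    (s.card : ℝ) ^ 2 ≤ (s.image f).card * ∑ x ∈ s, ((s.filter fun y => f y = f x).card : ℝ) := by
  have h1 : (s.card : ℝ) = ∑ b ∈ s.image f, ((s.filter fun y => f y = b).card : ℝ) := by
    exact_mod_cast Finset.card_eq_sum_card_image f s
  have h2 : ∑ x ∈ s, ((s.filter fun y => f y = f x).card : ℝ) =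
      ∑ b ∈ s.image f, ((s.filter fun y => f y = b).card : ℝ) ^ 2 := by
    rw [← Finset.sum_fiberwise_of_maps_to fun x hx => Finset.mem_image_of_mem f hx]
    refine Finset.sum_congr rfl fun b _ => ?_
    rw [sq, ← nsmul_eq_mul, ← Finset.sum_const]
    refine Finset.sum_congr rfl fun x hx => ?_
    rw [(Finset.mem_filter.mp hx).2]
  rw [h2]
  nth_rewrite 1 [h1]
  exact sq_sum_le_card_mul_sum_sq

variable {A : Type*} [AddCommGroup A]

lemma card_filter_add_neg (s : Finset A) (h : A) :
    (s.filter fun a => a + -h ∈ s).card = (s.filter fun a => a + h ∈ s).card := by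
  refine Finset.card_bij (fun a _ => a + -h) ?_ ?_ ?_
  · intro a ha
    rw [Finset.mem_filter] at ha ⊢
    exact ⟨ha.2, by simpa using ha.1⟩
  · intro a _ b _ hab
    exact add_right_cancel hab
  · intro b hb
    rw [Finset.mem_filter] at hb
    exact ⟨b + h, Finset.mem_filter.mpr ⟨hb.2, by simpa using hb.1⟩, by simp⟩

/-- The second moment bound for sums of a set and a sequence. -/
lemma second_moment_bound (s : Finset A) (g : ℕ → A) (M : ℕ) (P : ℕ → ℝ) (hP : ∀ m, 0 ≤ P m)
    (hU : ∀ j m, j + m + 1 < M →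
      ((s.filter fun a => a + (g (j + m + 1) - g j) ∈ s).card : ℝ) ≤ P m) :
    ((s.card : ℝ) * M) ^ 2 ≤
      ((s ×ˢ Finset.range M).image fun x => x.1 + g x.2).card *
        (s.card * M + 2 * M * ∑ m ∈ Finset.range M, P m) := by
  have h0 := card_sq_le_card_image_mul (s ×ˢ Finset.range M) fun x : A × ℕ => x.1 + g x.2
  rw [Finset.card_product, Finset.card_range, Nat.cast_mul] at h0
  refine h0.trans (mul_le_mul_of_nonneg_left ?_ (by positivity))
  set N : ℕ → ℕ → ℝ := fun j k => ((s.filter fun a => a + (g j - g k) ∈ s).card : ℝ) with hN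
  have h1 : ∀ x : A × ℕ,
      (((s ×ˢ Finset.range M).filter fun y => y.1 + g y.2 = x.1 + g x.2).card : ℝ)
      ≤ ∑ k ∈ Finset.range M, if x.1 + (g x.2 - g k) ∈ s then 1 else 0 := by
    intro x
    rw [← Finset.sum_filter, Finset.sum_const, nsmul_eq_mul, mul_one, Nat.cast_le]
    refine Finset.card_le_card_of_injOn Prod.snd ?_ ?_
    · intro y hy
      rw [Finset.mem_coe, Finset.mem_filter, Finset.mem_product] at hy
      rw [Finset.mem_coe, Finset.mem_filter]
      refine ⟨hy.1.2, ?_⟩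
      rw [← add_sub_assoc, ← hy.2, add_sub_cancel_right]
      exact hy.1.1
    · intro y hy z hz hyz
      rw [Finset.mem_coe, Finset.mem_filter] at hy hz
      refine Prod.ext ?_ hyz
      have := hy.2.trans hz.2.symm
      rw [hyz] at this
      exact add_right_cancel this
  have h2 : ∀ j ∈ Finset.range M, ∀ k ∈ Finset.range M,
      N j k ≤ (if j = k then (s.card : ℝ) else 0) +
      ∑ m ∈ Finset.range M, ((if j = k + m + 1 then P m else 0) +
        if k = j + m + 1 then P m else 0) := by
    intro j hj k hk
    rw [Finset.mem_range] at hj hk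
    have hnn : ∀ m ∈ Finset.range M, 0 ≤ (if j = k + m + 1 then P m else 0) +
        if k = j + m + 1 then P m else 0 := fun m _ => by
      have := hP m
      positivity
    rcases lt_trichotomy j k with h | h | h
    · obtain ⟨m, rfl⟩ := Nat.exists_eq_add_of_lt h
      have h3 : N j (j + m + 1) ≤ P m := by
        rw [hN]
        simp only
        rw [← neg_sub, card_filter_add_neg]
        exact hU j m hk
      rw [if_neg h.ne, zero_add]
      refine h3.trans (le_trans ?_ (Finset.single_le_sum hnn (Finset.mem_range.mpr
        (show m < M by omega))))
      rw [if_neg (by omega), zero_add, if_pos rfl]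
    · subst h
      rw [if_pos rfl]
      refine le_trans ?_ (le_add_of_nonneg_right (Finset.sum_nonneg hnn))
      exact Nat.cast_le.mpr (Finset.card_filter_le _ _)
    · obtain ⟨m, rfl⟩ := Nat.exists_eq_add_of_lt h
      rw [if_neg h.ne', zero_add]
      refine (hU k m hj).trans (le_trans ?_ (Finset.single_le_sum hnn (Finset.mem_range.mpr
        (show m < M by omega))))
      rw [if_pos rfl, if_neg (by omega), add_zero]
  have h4 : ∀ (m j : ℕ), ∑ k ∈ Finset.range M, (if k = j then P m else 0) ≤ P m := by
    intro m j
    rw [Finset.sum_ite_eq']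
    split_ifs
    · exact le_rfl
    · exact hP m
  calc _ ≤ ∑ x ∈ s ×ˢ Finset.range M, ∑ k ∈ Finset.range M,
        (if x.1 + (g x.2 - g k) ∈ s then (1 : ℝ) else 0) := Finset.sum_le_sum fun x _ => h1 x
    _ = ∑ j ∈ Finset.range M, ∑ k ∈ Finset.range M, N j k := by
        rw [Finset.sum_product, Finset.sum_comm]
        refine Finset.sum_congr rfl fun j _ => ?_
        rw [Finset.sum_comm]
        refine Finset.sum_congr rfl fun k _ => ?_
        rw [← Finset.sum_filter, Finset.sum_const, nsmul_eq_mul, mul_one]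
    _ ≤ ∑ j ∈ Finset.range M, ∑ k ∈ Finset.range M, ((if j = k then (s.card : ℝ) else 0) +
          ∑ m ∈ Finset.range M, ((if j = k + m + 1 then P m else 0) +
            if k = j + m + 1 then P m else 0)) :=
        Finset.sum_le_sum fun j hj => Finset.sum_le_sum fun k hk => h2 j hj k hk
    _ = ∑ j ∈ Finset.range M, ∑ k ∈ Finset.range M, (if j = k then (s.card : ℝ) else 0) +
          (∑ m ∈ Finset.range M, ∑ k ∈ Finset.range M, ∑ j ∈ Finset.range M,
              (if j = k + m + 1 then P m else 0) +
            ∑ m ∈ Finset.range M, ∑ j ∈ Finset.range M, ∑ k ∈ Finset.range M,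
              (if k = j + m + 1 then P m else 0)) := by
        simp only [Finset.sum_add_distrib]
        congr 2
        · rw [Finset.sum_comm]
          simp_rw [Finset.sum_comm (s := Finset.range M) (t := Finset.range M)
            (f := fun j m => if j = _ + m + 1 then P m else 0)]
          rw [Finset.sum_comm]
        · simp_rw [Finset.sum_comm (s := Finset.range M) (t := Finset.range M)
            (f := fun k m => if k = _ + m + 1 then P m else 0)]
          rw [Finset.sum_comm]
    _ ≤ s.card * M + (∑ m ∈ Finset.range M, M * P m + ∑ m ∈ Finset.range M, M * P m) := by
        gcongr with m _ m _
        · simp only [Finset.sum_ite_eq, Finset.mem_range]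
          rw [← Finset.sum_filter, Finset.sum_const, nsmul_eq_mul, mul_comm]
          gcongr
          exact (Finset.card_filter_le _ _).trans (Finset.card_range M).le
        · refine (Finset.sum_le_card_nsmul _ _ _ fun k _ => h4 m _).trans ?_
          rw [Finset.card_range, nsmul_eq_mul]
        · refine (Finset.sum_le_card_nsmul _ _ _ fun k _ => h4 m _).trans ?_
          rw [Finset.card_range, nsmul_eq_mul]
    _ = _ := by
        rw [← Finset.mul_sum]
        ring

end SecondMoment

section PrimeElements

open scoped Classical
open IsDedekindDomain UniqueFactorizationMonoid Filter

variable {K : Type*} [Field K] [NumberField K]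

lemma house_le_norm_mixedEmbedding (α : K) : house α ≤ ‖mixedEmbedding K α‖ := by
  rw [house, pi_norm_le_iff_of_nonneg (norm_nonneg _)]
  intro φ
  have h := normAtPlace_le_norm (InfinitePlace.mk φ) (mixedEmbedding K α)
  rwa [normAtPlace_apply, InfinitePlace.apply] at h

variable (K) in
/-- A principal prime has a generator of small house. -/
lemma exists_generator_house_le : ∃ R : ℝ, 1 ≤ R ∧ ∀ v : HeightOneSpectrum (𝓞 K),
    ClassGroup.mk0 (primeIdeal v) = 1 → ∃ π : 𝓞 K, Ideal.span {π} = v.asIdeal ∧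
      house (π : K) ≤ R * (nrm v : ℝ) ^ ((finrank ℚ K : ℝ)⁻¹) := by
  obtain ⟨R, hR0, hR⟩ := exists_unit_smul_norm_le K
  refine ⟨max R 1, le_max_right _ _, fun v hv => ?_⟩
  rw [primeIdeal, ClassGroup.mk0_eq_one_iff] at hv
  obtain ⟨γ, hγ⟩ := hv.principal
  change v.asIdeal = Ideal.span {γ} at hγ
  have hnorm : mixedEmbedding.norm (mixedEmbedding K (γ : K)) = nrm v := by
    rw [norm_eq_norm, nrm, hγ, Ideal.absNorm_span_singleton, ← Algebra.coe_norm_int,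
      Nat.cast_natAbs]
    push_cast
    rfl
  have hN : (0 : ℝ) < nrm v := zero_lt_one.trans (one_lt_nrm v)
  obtain ⟨u, hu⟩ := hR (mixedEmbedding K (γ : K)) (by rw [hnorm]; exact hN.ne')
  rw [hnorm, unitSMul_smul, ← map_mul] at hu
  refine ⟨u * γ, ?_, ?_⟩
  · rw [hγ, Ideal.span_singleton_mul_left_unit u.isUnit]
  · refine le_trans (le_trans ?_ hu) ?_
    · exact house_le_norm_mixedEmbedding _
    · gcongr
      exact le_max_left _ _

lemma asIdeal_eq_span_of_mem {π : 𝓞 K} {v v' : HeightOneSpectrum (𝓞 K)}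
    (h : Ideal.span {π} = v.asIdeal) (h' : π ∈ v'.asIdeal) : v' = v := by
  have h1 : v.asIdeal ≤ v'.asIdeal := by
    rw [← h, Ideal.span_singleton_le_iff_mem]
    exact h'
  exact (HeightOneSpectrum.ext (v.isMaximal.eq_of_le v'.isPrime.ne_top h1)).symm

variable (K) in
/-- Many prime elements of small house that avoid all primes of small norm. -/
lemma exists_primeElements : ∃ c : ℝ, 0 < c ∧ ∀ᶠ x : ℝ in atTop, ∃ Q : Finset (𝓞 K),
    (∀ π ∈ Q, Prime π ∧ house (π : K) ≤ x) ∧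
    (∀ π ∈ Q, ∀ v : HeightOneSpectrum (𝓞 K), (nrm v : ℝ) ≤ c * x → π ∉ v.asIdeal) ∧
    c * x ^ finrank ℚ K / Real.log x ≤ Q.card := by
  obtain ⟨R, hR1, hR⟩ := exists_generator_house_le K
  obtain ⟨B, hB1, hB⟩ := exists_card_principal_ge K
  choose! γ hγ using hR
  set n := finrank ℚ K with hn
  have hn0 : 0 < n := finrank_pos
  have hn1 : (1 : ℝ) ≤ n := by exact_mod_cast hn0
  refine ⟨(R ^ n * B * n)⁻¹, by positivity, ?_⟩
  filter_upwards [eventually_gt_atTop (R * B), eventually_gt_atTop 1] with x hx hx1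
  have hxR : B < x / R := by rwa [lt_div_iff₀' (by positivity)]
  have hxR1 : 1 < x / R := hB1.trans_lt hxR
  have hy : B < (x / R) ^ n := hxR.trans_le (le_self_pow₀ hxR1.le hn0.ne')
  have hcard := hB _ hy
  set T := {v ∈ primesLE K ((x / R) ^ n) | ClassGroup.mk0 (primeIdeal v) = 1 ∧
    (x / R) ^ n / B < nrm v} with hT
  have hTm : ∀ v ∈ T, (nrm v : ℝ) ≤ (x / R) ^ n ∧ ClassGroup.mk0 (primeIdeal v) = 1 ∧
      (x / R) ^ n / B < nrm v := fun v hv => by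
    rw [hT, Finset.mem_filter, mem_primesLE] at hv
    exact hv
  have hinj : Set.InjOn γ T := by
    intro v hv v' hv' h
    have h1 := (hγ v (hTm v hv).2.1).1
    have h2 := (hγ v' (hTm v' hv').2.1).1
    rw [h, h2] at h1
    exact (HeightOneSpectrum.ext h1).symm
  refine ⟨T.image γ, ?_, ?_, ?_⟩
  · intro π hπ
    obtain ⟨v, hv, rfl⟩ := Finset.mem_image.mp hπ
    obtain ⟨h1, h2⟩ := hγ v (hTm v hv).2.1
    constructor
    · rw [← Ideal.span_singleton_prime, h1]
      · exact v.isPrime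
      · intro h0
        rw [h0, Ideal.span_singleton_eq_bot.mpr rfl] at h1
        exact v.ne_bot h1.symm
    · refine h2.trans ?_
      calc R * (nrm v : ℝ) ^ ((n : ℝ)⁻¹) ≤ R * ((x / R) ^ n) ^ ((n : ℝ)⁻¹) := by
            gcongr
            exact (hTm v hv).1
        _ = R * (x / R) := by
            rw [Real.pow_rpow_inv_natCast (by positivity) hn0.ne']
        _ = x := by field_simp
  · intro π hπ v' hv' hmem
    obtain ⟨v, hv, rfl⟩ := Finset.mem_image.mp hπ
    obtain rfl := asIdeal_eq_span_of_mem (hγ v (hTm v hv).2.1).1 hmem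
    refine absurd (hTm v' hv).2.2 (not_lt.mpr (hv'.trans ?_))
    have h1 : x ≤ x ^ n := le_self_pow₀ hx1.le hn0.ne'
    calc (R ^ n * B * n)⁻¹ * x ≤ (R ^ n * B * 1)⁻¹ * x ^ n := by gcongr
      _ = (x / R) ^ n / B := by
        rw [div_pow]
        field_simp
  · rw [Finset.card_image_of_injOn hinj]
    refine le_trans ?_ hcard
    have h1 : 0 < Real.log (x / R) := Real.log_pos hxR1
    have h2 : Real.log (x / R) ≤ Real.log x :=
      Real.log_le_log (by positivity) (div_le_self (by positivity) hR1)
    calc (R ^ n * B * n)⁻¹ * x ^ n / Real.log x = x ^ n / R ^ n / (B * (n * Real.log x)) := by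
          field_simp
      _ ≤ x ^ n / R ^ n / (B * (n * Real.log (x / R))) := by gcongr
      _ = _ := by
          rw [Real.log_pow, div_pow]

variable (K) in
lemma exists_house_mem_box : ∃ C : ℝ, 1 ≤ C ∧ ∀ (x : ℝ) (α : 𝓞 K) (L : ℕ), house (α : K) ≤ x →
    C * x < L → α ∈ box K (-L) L := by
  obtain ⟨C, hC⟩ : ∃ C : ℝ, ∀ (α : 𝓞 K) (i : K →+* ℂ),
      ‖(((integralBasis K).reindex (equivReindex K).symm).repr α i : ℂ)‖ ≤
        C * house (algebraMap (𝓞 K) K α) := ⟨_, house.basis_repr_norm_le_const_mul_house K⟩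
  refine ⟨max C 1, le_max_right _ _, fun x α L hx hL => ?_⟩
  rw [mem_box]
  intro i
  have h1 := hC α ((equivReindex K).symm i)
  rw [Basis.repr_reindex_apply, Equiv.symm_symm, Equiv.apply_symm_apply,
    integralBasis_repr_apply] at h1
  have h2 : C * house (algebraMap (𝓞 K) K α) ≤ max C 1 * x :=
    mul_le_mul (le_max_left _ _) hx (house_nonneg _) (by positivity)
  have h3 : |(((RingOfIntegers.basis K).repr α i : ℤ) : ℝ)| < L := by
    refine lt_of_le_of_lt (le_trans ?_ (h1.trans h2)) hL
    simp
  rw [abs_lt] at h3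
  exact ⟨by exact_mod_cast h3.1.le, by exact_mod_cast h3.2⟩

variable (K) in
lemma finite_house_le (x : ℝ) : {α : 𝓞 K | house (α : K) ≤ x}.Finite := by
  obtain ⟨C, -, hC⟩ := exists_house_mem_box K
  obtain ⟨L, hL⟩ := exists_nat_gt (C * x)
  exact (box K (-L) L).finite_toSet.subset fun α hα => hC x α L hα hL

variable (K) in
lemma exists_card_house_le : ∃ C : ℝ, 0 < C ∧ ∀ x : ℝ, 1 ≤ x →
    (Nat.card {α : 𝓞 K // house (α : K) ≤ x} : ℝ) ≤ C * x ^ finrank ℚ K := by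
  obtain ⟨C, hC1, hC⟩ := exists_house_mem_box K
  refine ⟨(4 * C) ^ finrank ℚ K, by positivity, fun x hx => ?_⟩
  set L := ⌊C * x⌋₊ + 1 with hL
  have hCx : 1 ≤ C * x := one_le_mul_of_one_le_of_one_le hC1 hx
  have hL1 : C * x < L := by rw [hL]; push_cast; exact Nat.lt_floor_add_one _
  have hL2 : (L : ℝ) ≤ 2 * (C * x) := by
    rw [hL]
    push_cast
    linarith [Nat.floor_le (zero_le_one.trans hCx)]
  have h1 : Nat.card {α : 𝓞 K // house (α : K) ≤ x} ≤ (2 * L) ^ finrank ℚ K := by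
    have h2 := Nat.card_mono (box K (-L) L).finite_toSet
      (fun α (hα : α ∈ {α : 𝓞 K | house (α : K) ≤ x}) => hC x α L hα hL1)
    have h3 := card_box K (-L) (2 * L)
    rw [show (-(L : ℤ) + (2 * L : ℕ)) = L by push_cast; ring] at h3
    rw [← h3]
    rw [Nat.card_coe_set_eq (box K (-L) L : Set (𝓞 K)), Set.ncard_coe_finset] at h2
    exact h2
  calc (Nat.card {α : 𝓞 K // house (α : K) ≤ x} : ℝ) ≤ (2 * L : ℝ) ^ finrank ℚ K := by
        exact_mod_cast h1
    _ ≤ (2 * (2 * (C * x))) ^ finrank ℚ K := by gcongr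
    _ = _ := by rw [← mul_pow]; ring

end PrimeElements

/-! ### Counting representations -/

section Representations

open scoped Classical
open IsDedekindDomain UniqueFactorizationMonoid Filter

variable {K : Type*} [Field K] [NumberField K]

/-- The primes containing a nonzero `α` (junk value `∅` when `α = 0`). -/
noncomputable def primesOver (α : 𝓞 K) : Finset (HeightOneSpectrum (𝓞 K)) :=
  if h : α = 0 then ∅ else (finite_setOf_mem_asIdeal h).toFinset

lemma mem_primesOver {α : 𝓞 K} (h : α ≠ 0) {v : HeightOneSpectrum (𝓞 K)} :
    v ∈ primesOver α ↔ α ∈ v.asIdeal := by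
  rw [primesOver, dif_neg h, Set.Finite.mem_toFinset]
  rfl

lemma prod_union_sq_le (S T : Finset (HeightOneSpectrum (𝓞 K))) :
    (∏ v ∈ S ∪ T, (1 + (nrm v : ℝ)⁻¹)) ^ 2 ≤
      (∏ v ∈ S, (1 + (nrm v : ℝ)⁻¹)) ^ 2 * ∏ v ∈ T, (1 + 3 * (nrm v : ℝ)⁻¹) := by
  have hfac : ∀ v : HeightOneSpectrum (𝓞 K), 1 ≤ 1 + (nrm v : ℝ)⁻¹ := fun v =>
    le_add_of_nonneg_right (by positivity)
  calc (∏ v ∈ S ∪ T, (1 + (nrm v : ℝ)⁻¹)) ^ 2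
      ≤ ((∏ v ∈ S, (1 + (nrm v : ℝ)⁻¹)) * ∏ v ∈ T, (1 + (nrm v : ℝ)⁻¹)) ^ 2 := by
        gcongr
        rw [← Finset.prod_union_inter]
        exact le_mul_of_one_le_right (by positivity) (Finset.one_le_prod fun v _ => hfac v)
    _ = (∏ v ∈ S, (1 + (nrm v : ℝ)⁻¹)) ^ 2 * ∏ v ∈ T, (1 + (nrm v : ℝ)⁻¹) ^ 2 := by
        rw [mul_pow, ← Finset.prod_pow T]
    _ ≤ _ := by
        gcongr with v _
        have h1 : (nrm v : ℝ)⁻¹ ≤ 1 := inv_le_one_of_one_le₀ (one_lt_nrm v).le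
        have h0 : (0 : ℝ) ≤ (nrm v : ℝ)⁻¹ := by positivity
        nlinarith

lemma eventually_rpow_le {a b : ℝ} (ha : 0 < a) (hb : 0 < b) :
    ∀ᶠ x : ℝ in atTop, (a * x) ^ (1 / 16 : ℝ) ≤ b * x := by
  filter_upwards [eventually_ge_atTop a⁻¹, eventually_ge_atTop (a / b ^ 2)] with x h1 h2
  have hx : 0 < x := (inv_pos.mpr ha).trans_le h1
  have h3 : 1 ≤ a * x := by rwa [inv_le_iff_one_le_mul₀' ha] at h1
  calc (a * x) ^ (1 / 16 : ℝ) ≤ (a * x) ^ (1 / 2 : ℝ) :=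
        Real.rpow_le_rpow_of_exponent_le h3 (by norm_num)
    _ = Real.sqrt (a * x) := (Real.sqrt_eq_rpow _).symm
    _ ≤ b * x := by
        rw [Real.sqrt_le_iff]
        refine ⟨by positivity, ?_⟩
        rw [div_le_iff₀ (by positivity)] at h2
        nlinarith

/-- The number of sums of a prime element and a power of `ξ` has the maximal order of magnitude. -/
theorem exists_card_representable_ge (ξ : 𝓞 K) (hξ0 : ξ ≠ 0) (hξ : ¬ IsUnit ξ) :
    ∃ c : ℝ, 0 < c ∧ ∀ᶠ x : ℝ in atTop, ∃ S : Finset (𝓞 K), c * x ^ finrank ℚ K ≤ S.card ∧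
      ∀ ζ ∈ S, house (ζ : K) ≤ 2 * x ∧
        ∃ (π : 𝓞 K) (k : ℕ), Prime π ∧ 1 ≤ k ∧ ζ = π + ξ ^ k := by
  obtain ⟨Cs, hCs0, hCs⟩ := exists_sieve_bound K
  obtain ⟨Cr, hCr0, hCr⟩ := exists_romanov_average ξ hξ0 hξ
  obtain ⟨Cb, hCb1, hCb⟩ := exists_house_mem_box K
  obtain ⟨c, hc0, hc⟩ := exists_primeElements K
  set n := finrank ℚ K with hn
  set H := max (house (ξ : K)) 2 with hH
  have hH2 : 2 ≤ H := le_max_right _ _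
  set l := Real.log H with hl
  have hl0 : 0 < l := Real.log_pos (by linarith)
  set A := (∏ v ∈ primesOver ξ, (1 + (nrm v : ℝ)⁻¹)) ^ 2 with hA
  have hA0 : 0 < A := by positivity
  set c₁ := c / (2 * l) with hc₁
  have hc₁0 : 0 < c₁ := by positivity
  set E := 2 * Cr * (Cs * A * (2 * Cb) ^ n / l ^ 2) with hE
  have hE0 : 0 < E := by positivity
  refine ⟨c₁ / (1 + E / c₁), by positivity, ?_⟩
  filter_upwards [hc, eventually_rpow_le (show 0 < 2 * Cb by positivity) hc0,
    eventually_ge_atTop H] with x hQ hpow hxH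
  obtain ⟨Q, hQ1, hQ2, hQ3⟩ := hQ
  have hx2 : 2 ≤ x := hH2.trans hxH
  have hx0 : 0 < x := by linarith
  have hlx : l ≤ Real.log x := Real.log_le_log (by linarith) hxH
  have hlx0 : 0 < Real.log x := hl0.trans_le hlx
  set M := ⌊Real.log x / l⌋₊ with hM
  have hM1 : (M : ℝ) ≤ Real.log x / l := Nat.floor_le (by positivity)
  have hM2 : Real.log x / (2 * l) ≤ M := by
    have h1 : 1 ≤ Real.log x / l := by rwa [one_le_div hl0]
    have h2 : (1 : ℝ) ≤ M := by exact_mod_cast Nat.le_floor (by simpa using h1)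
    have h3 := Nat.lt_floor_add_one (Real.log x / l)
    rw [mul_comm, ← div_div]
    linarith
  have hHM : H ^ M ≤ x := by
    rw [← Real.log_le_log_iff (by positivity) hx0, Real.log_pow]
    rwa [le_div_iff₀ hl0] at hM1
  have hpowhouse : ∀ k < M, house ((ξ ^ (k + 1) : 𝓞 K) : K) ≤ x := by
    intro k hk
    have h1 : house ((ξ ^ (k + 1) : 𝓞 K) : K) ≤ house (ξ : K) ^ (k + 1) := by
      simpa using house_pow_le (ξ : K) (k + 1)
    refine h1.trans (le_trans ?_ hHM)
    calc house (ξ : K) ^ (k + 1) ≤ H ^ (k + 1) :=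
          pow_le_pow_left₀ (house_nonneg _) (le_max_left _ _) _
      _ ≤ H ^ M := pow_le_pow_right₀ (by linarith) hk
  set L := ⌊Cb * x⌋₊ + 1 with hL
  have hCx : x ≤ Cb * x := le_mul_of_one_le_left hx0.le hCb1
  have hL1 : Cb * x < L := by rw [hL]; push_cast; exact Nat.lt_floor_add_one _
  have hL2 : (L : ℝ) ≤ 2 * Cb * x := by
    rw [hL]
    push_cast
    linarith [Nat.floor_le (hx0.le.trans hCx)]
  have hxL : x ≤ L := hCx.trans hL1.le
  have hL3 : 2 ≤ L := by exact_mod_cast hx2.trans hxL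
  have hLpow : (L : ℝ) ^ (1 / 16 : ℝ) ≤ c * x :=
    (Real.rpow_le_rpow (by positivity) hL2 (by norm_num)).trans hpow
  set W := Cs * (L : ℝ) ^ n / Real.log L ^ 2 * A with hW
  have hW0 : 0 ≤ W := by positivity
  set T : ℕ → Finset (HeightOneSpectrum (𝓞 K)) := fun m => primesOver (ξ ^ (m + 1) - 1) with hT
  have hTm : ∀ m, ∀ v, v ∈ T m ↔ ξ ^ (m + 1) - 1 ∈ v.asIdeal := fun m v =>
    mem_primesOver (pow_sub_one_ne_zero hξ m.succ_ne_zero)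
  have hU : ∀ j m, j + m + 1 < M →
      ((Q.filter fun a => a + (ξ ^ (j + m + 1 + 1) - ξ ^ (j + 1)) ∈ Q).card : ℝ) ≤
        W * ∏ v ∈ T m, (1 + 3 * (nrm v : ℝ)⁻¹) := by
    intro j m _
    refine (hCs L hL3 (ξ ^ (j + m + 1 + 1) - ξ ^ (j + 1)) (primesOver ξ ∪ T m) ?_ _ ?_ ?_).trans ?_
    · intro v hv
      rw [show ξ ^ (j + m + 1 + 1) - ξ ^ (j + 1) = ξ ^ (j + 1) * (ξ ^ (m + 1) - 1) by ring] at hv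
      rw [Finset.mem_union, mem_primesOver hξ0, hTm]
      exact (v.isPrime.mem_or_mem hv).imp (v.isPrime.mem_of_pow_mem _) id
    · intro α hα
      exact hCb x α L (hQ1 α (Finset.mem_filter.mp hα).1).2 hL1
    · intro α hα v hv
      rw [Finset.mem_filter] at hα
      exact ⟨hQ2 α hα.1 v (hv.trans hLpow), hQ2 _ hα.2 v (hv.trans hLpow)⟩
    · rw [hW, mul_assoc _ A]
      gcongr
      exact prod_union_sq_le _ _
  have hmain := second_moment_bound Q (fun k => ξ ^ (k + 1)) M
    (fun m => W * ∏ v ∈ T m, (1 + 3 * (nrm v : ℝ)⁻¹)) (fun m => by positivity) hU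
  set S := (Q ×ˢ Finset.range M).image fun y => y.1 + ξ ^ (y.2 + 1) with hS
  refine ⟨S, ?_, ?_⟩
  · set R : ℝ := Q.card * M with hR
    have hR1 : c₁ * x ^ n ≤ R := by
      calc c₁ * x ^ n = (c * x ^ n / Real.log x) * (Real.log x / (2 * l)) := by
            rw [hc₁]
            field_simp
        _ ≤ R := by
            rw [hR]
            gcongr
    have hR0 : 0 < R := lt_of_lt_of_le (by positivity) hR1
    have hsum : 2 * M * ∑ m ∈ Finset.range M, W * ∏ v ∈ T m, (1 + 3 * (nrm v : ℝ)⁻¹) ≤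
        E * x ^ n := by
      rw [← Finset.mul_sum]
      have h1 := hCr M T fun m v => (hTm m v).mp
      have hlL : Real.log x ≤ Real.log L := Real.log_le_log hx0 hxL
      calc 2 * M * (W * ∑ m ∈ Finset.range M, ∏ v ∈ T m, (1 + 3 * (nrm v : ℝ)⁻¹))
          ≤ 2 * M * (W * (Cr * M)) := by gcongr
        _ = 2 * Cr * (W * M ^ 2) := by ring
        _ ≤ 2 * Cr * ((Cs * (2 * Cb * x) ^ n / Real.log x ^ 2 * A) * (Real.log x / l) ^ 2) := by
            rw [hW]
            gcongr
        _ = E * x ^ n := by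
            rw [hE, mul_pow (2 * Cb) x]
            field_simp
    have hxn : E * x ^ n ≤ E / c₁ * R := by
      rw [div_mul_eq_mul_div, le_div_iff₀ hc₁0]
      nlinarith
    have h2 : R ^ 2 ≤ S.card * (R * (1 + E / c₁)) := by
      refine hmain.trans ?_
      gcongr
      linarith
    have h3 : R ≤ S.card * (1 + E / c₁) := by
      refine le_of_mul_le_mul_right ?_ hR0
      linarith
    rw [div_mul_eq_mul_div, div_le_iff₀ (by positivity)]
    exact hR1.trans h3
  · intro ζ hζ
    obtain ⟨⟨π, k⟩, hy, rfl⟩ := Finset.mem_image.mp hζ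
    rw [Finset.mem_product, Finset.mem_range] at hy
    obtain ⟨hπ1, hπ2⟩ := hQ1 π hy.1
    refine ⟨?_, π, k + 1, hπ1, by omega, rfl⟩
    have h1 := house_add_le (π : K) ((ξ ^ (k + 1) : 𝓞 K) : K)
    have h2 := hpowhouse k hy.2
    rw [← map_add] at h1
    linarith

end Representations

end Romanov

open NumberField Filter

/-- **Romanov's Theorem for number fields.** The lower density of algebraic integers
representable as a prime element plus a power of a fixed nonzero non-unit `ξ` is positive. -/
theorem romanov_number_field (K : Type*) [Field K] [NumberField K]
    (ξ : 𝓞 K) (hξ0 : ξ ≠ 0) (hξ : ¬ IsUnit ξ) :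
    0 < liminf (fun x : ℝ =>
      (Nat.card {ζ : 𝓞 K // house (ζ : K) ≤ x ∧
          ∃ (π : 𝓞 K) (k : ℕ), Prime π ∧ 1 ≤ k ∧ ζ = π + ξ ^ k} : ℝ) /
      (Nat.card {ζ : 𝓞 K // house (ζ : K) ≤ x} : ℝ)) atTop := by
  obtain ⟨c, hc0, hc⟩ := Romanov.exists_card_representable_ge ξ hξ0 hξ
  obtain ⟨C, hC0, hC⟩ := Romanov.exists_card_house_le K
  set n := Module.finrank ℚ K with hn
  have hmono : ∀ x : ℝ, Nat.card {ζ : 𝓞 K // house (ζ : K) ≤ x ∧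
      ∃ (π : 𝓞 K) (k : ℕ), Prime π ∧ 1 ≤ k ∧ ζ = π + ξ ^ k} ≤
        Nat.card {ζ : 𝓞 K // house (ζ : K) ≤ x} := fun x =>
    Nat.card_mono (Romanov.finite_house_le K x) fun ζ hζ => hζ.1
  have hpos : 0 < c / (2 ^ n * C) := by positivity
  refine hpos.trans_le (le_liminf_of_le ?_ ?_)
  · refine isCoboundedUnder_ge_of_le atTop (x := 1) fun x => ?_
    exact div_le_one_of_le₀ (by exact_mod_cast hmono x) (Nat.cast_nonneg _)
  have htend : Tendsto (fun x : ℝ => x / 2) atTop atTop := tendsto_id.atTop_div_const two_pos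
  filter_upwards [htend.eventually hc, eventually_ge_atTop 1] with x hx hx1
  obtain ⟨S, hS1, hS2⟩ := hx
  have hfin : {ζ : 𝓞 K | house (ζ : K) ≤ x ∧
      ∃ (π : 𝓞 K) (k : ℕ), Prime π ∧ 1 ≤ k ∧ ζ = π + ξ ^ k}.Finite :=
    (Romanov.finite_house_le K x).subset fun ζ hζ => hζ.1
  have h1 : S.card ≤ Nat.card {ζ : 𝓞 K // house (ζ : K) ≤ x ∧
      ∃ (π : 𝓞 K) (k : ℕ), Prime π ∧ 1 ≤ k ∧ ζ = π + ξ ^ k} := by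
    have h2 := Nat.card_mono (s := (S : Set (𝓞 K))) hfin fun ζ hζ => by
      have := hS2 ζ hζ
      rwa [mul_div_cancel₀ x two_ne_zero] at this
    rwa [Nat.card_coe_set_eq (S : Set (𝓞 K)), Set.ncard_coe_finset] at h2
  have hden : 0 < Nat.card {ζ : 𝓞 K // house (ζ : K) ≤ x} := by
    have : Finite {ζ : 𝓞 K // house (ζ : K) ≤ x} := (Romanov.finite_house_le K x).to_subtype
    have : Nonempty {ζ : 𝓞 K // house (ζ : K) ≤ x} := ⟨0, by
      have := house_intCast (K := K) 0
      simp only [Int.cast_zero, abs_zero] at this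
      exact (le_of_eq (by simpa using this)).trans (zero_le_one.trans hx1)⟩
    exact Nat.card_pos
  rw [le_div_iff₀ (by exact_mod_cast hden)]
  calc c / (2 ^ n * C) * (Nat.card {ζ : 𝓞 K // house (ζ : K) ≤ x} : ℝ)
      ≤ c / (2 ^ n * C) * (C * x ^ n) := by
        gcongr
        exact hC x hx1
    _ = c * (x / 2) ^ n := by
        rw [div_pow]
        field_simp
    _ ≤ S.card := hS1
    _ ≤ _ := by exact_mod_cast h1
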